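/- arXiv:1707.08456 — 2 statements merged into one kernel-verified Lean document; each statement's English description precedes it below -/
import Mathlib

section
/- For every N ≥ 2, the set of eigenvalues of the real symmetric matrix M_F(N) is exactly {0, 1, 2, …, N−2} ∪ {N}; in particular, N−1 is not an eigenvalue of M_F(N). -/
/-- `AddBox α μ` means that the Young diagram `μ` is obtained from the Young diagram `α`
by adding a single box; equivalently, `α` is obtained from `μ` by removing a box:
the diagram of `α` is contained in the diagram of `μ` and `μ` has exactly one more cell. -/
def AddBox (α μ : YoungDiagram) : Prop :=
  α ≤ μ ∧ μ.card = α.card + 1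

/-- `MoveBox μ ν` (written `μ/ν = □` in the paper): `μ ≠ ν` and some Young diagram can be
obtained from both `μ` and `ν` by removing a single box, i.e. `μ` is obtained from `ν`
by moving a single box. -/
def MoveBox (μ ν : YoungDiagram) : Prop :=
  μ ≠ ν ∧ ∃ α : YoungDiagram, AddBox α μ ∧ AddBox α ν

/-- `nBox μ` is the number `n_μ` of Young diagrams obtained from `μ` by removing a box. -/
noncomputable def nBox (μ : YoungDiagram) : ℕ :=
  Nat.card {α : YoungDiagram // AddBox α μ}

/-- Partitions of `N` with at most `d` parts, identified with Young diagrams with `N` boxes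
whose first column has height at most `d`. -/
abbrev PartLE (N d : ℕ) : Type :=
  {μ : YoungDiagram // μ.card = N ∧ μ.colLen 0 ≤ d}

instance : DecidableEq YoungDiagram := fun μ ν =>
  decidable_of_iff (μ.cells = ν.cells) (YoungDiagram.ext_iff).symm

theorem cell_lt_card {μ : YoungDiagram} {i j : ℕ} (h : (i, j) ∈ μ.cells) :
    i < μ.card ∧ j < μ.card := by
  rw [YoungDiagram.mem_cells] at h
  constructor
  · have hsub : Finset.range (i + 1) ×ˢ ({j} : Finset ℕ) ⊆ μ.cells := by
      rintro ⟨a, b⟩ hab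
      rw [Finset.mem_product, Finset.mem_range, Finset.mem_singleton] at hab
      rw [YoungDiagram.mem_cells]
      obtain ⟨h1, h2⟩ := hab
      subst h2
      exact μ.up_left_mem (Nat.lt_succ_iff.mp h1) le_rfl h
    have := Finset.card_le_card hsub
    simpa [YoungDiagram.card] using this
  · have hsub : ({i} : Finset ℕ) ×ˢ Finset.range (j + 1) ⊆ μ.cells := by
      rintro ⟨a, b⟩ hab
      rw [Finset.mem_product, Finset.mem_range, Finset.mem_singleton] at hab
      rw [YoungDiagram.mem_cells]
      obtain ⟨h1, h2⟩ := hab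
      subst h1
      exact μ.up_left_mem le_rfl (Nat.lt_succ_iff.mp h2) h
    have := Finset.card_le_card hsub
    simpa [YoungDiagram.card] using this

noncomputable instance (N d : ℕ) : Fintype (PartLE N d) := by
  apply Fintype.ofInjective
    (β := {s : Finset (ℕ × ℕ) // s ∈ (Finset.range N ×ˢ Finset.range N).powerset})
    (f := fun μ => ⟨μ.1.cells, by
      rw [Finset.mem_powerset]
      rintro ⟨i, j⟩ hc
      have h := cell_lt_card hc
      rw [μ.2.1] at h
      simp only [Finset.mem_product, Finset.mem_range]
      exact h⟩)
  rintro ⟨μ, hμ⟩ ⟨ν, hν⟩ h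
  simp only [Subtype.mk.injEq] at h ⊢
  exact YoungDiagram.ext h

open scoped Classical in
/-- The Teleportation Matrix `M_F^d(N)`, indexed by the partitions of `N` with at most
`d` parts: the diagonal entry at `μ` is `n_μ`, the off-diagonal entry at `(μ, ν)` is `1`
if `μ/ν = □` and `0` otherwise.  For `d ≥ N` this is the full matrix `M_F(N)`. -/
noncomputable def MF (N d : ℕ) : Matrix (PartLE N d) (PartLE N d) ℝ :=
  fun μ ν => if μ = ν then (nBox μ.1 : ℝ) else if MoveBox μ.1 ν.1 then 1 else 0


theorem yd_eq {α β : YoungDiagram} (h : α ≤ β) (hc : β.card ≤ α.card) : α = β :=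
  YoungDiagram.ext (Finset.eq_of_subset_of_card_le (YoungDiagram.cells_subset_iff.mpr h) hc)

theorem yd_card_mono {α β : YoungDiagram} (h : α ≤ β) : α.card ≤ β.card :=
  Finset.card_le_card (YoungDiagram.cells_subset_iff.mpr h)

theorem yd_modular (α β : YoungDiagram) :
    (α ⊔ β).card + (α ⊓ β).card = α.card + β.card := by
  simp only [YoungDiagram.card, YoungDiagram.cells_sup, YoungDiagram.cells_inf]
  exact Finset.card_union_add_card_inter _ _

theorem diamond_down {α β μ : YoungDiagram} (h1 : AddBox α μ) (h2 : AddBox β μ) (hne : α ≠ β) :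
    AddBox (α ⊓ β) α ∧ AddBox (α ⊓ β) β ∧ α ⊔ β = μ := by
  have hm := yd_modular α β
  have hle : α ⊔ β ≤ μ := sup_le h1.1 h2.1
  have hc1 := h1.2
  have hc2 := h2.2
  have hlt : α.card < (α ⊔ β).card := by
    by_contra hcon
    have e := yd_eq (le_sup_left : α ≤ α ⊔ β) (by omega)
    have : β ≤ α := by rw [e]; exact le_sup_right
    exact hne (yd_eq this (by omega)).symm
  have hle' := yd_card_mono hle
  exact ⟨⟨inf_le_left, by omega⟩, ⟨inf_le_right, by omega⟩, yd_eq hle (by omega)⟩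

theorem diamond_up {α β γ : YoungDiagram} (h1 : AddBox γ α) (h2 : AddBox γ β) (hne : α ≠ β) :
    AddBox α (α ⊔ β) ∧ AddBox β (α ⊔ β) ∧ α ⊓ β = γ := by
  have hm := yd_modular α β
  have hle : γ ≤ α ⊓ β := le_inf h1.1 h2.1
  have hc1 := h1.2
  have hc2 := h2.2
  have hlt : (α ⊓ β).card < α.card := by
    by_contra hcon
    have e := yd_eq (inf_le_left : α ⊓ β ≤ α) (by omega)
    have : α ≤ β := by rw [← e]; exact inf_le_right
    exact hne (yd_eq this (by omega))
  have hle' := yd_card_mono hle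
  exact ⟨⟨le_sup_left, by omega⟩, ⟨le_sup_right, by omega⟩, (yd_eq hle (by omega)).symm⟩

theorem colLen_le_card (μ : YoungDiagram) : μ.colLen 0 ≤ μ.card := by
  by_contra h
  have : (μ.card, 0) ∈ μ := YoungDiagram.mem_iff_lt_colLen.mpr (by omega)
  have := cell_lt_card ((YoungDiagram.mem_cells _).mpr this)
  omega

theorem level_finite (n : ℕ) : {μ : YoungDiagram | μ.card = n}.Finite := by
  refine (Set.finite_range (Subtype.val : PartLE n n → YoungDiagram)).subset ?_
  intro μ hμ
  have hμ' : μ.card = n := hμ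
  exact ⟨⟨μ, hμ', hμ' ▸ colLen_le_card μ⟩, rfl⟩

theorem up_finite (α : YoungDiagram) : {μ : YoungDiagram | AddBox α μ}.Finite :=
  (level_finite (α.card + 1)).subset fun _ h => h.2

theorem dn_finite (α : YoungDiagram) : {γ : YoungDiagram | AddBox γ α}.Finite :=
  (level_finite (α.card - 1)).subset fun γ h => by
    have := h.2
    show γ.card = _
    omega

noncomputable def ups (α : YoungDiagram) : Finset YoungDiagram := (up_finite α).toFinset
noncomputable def dns (α : YoungDiagram) : Finset YoungDiagram := (dn_finite α).toFinset

theorem mem_ups {α μ : YoungDiagram} : μ ∈ ups α ↔ AddBox α μ := by simp [ups]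
theorem mem_dns {α μ : YoungDiagram} : μ ∈ dns α ↔ AddBox μ α := by simp [dns]

/-- rows to which a box can be added -/
def Addable (α : YoungDiagram) (i : ℕ) : Prop := ∀ k < i, α.rowLen i < α.rowLen k

def addRow (α : YoungDiagram) (i : ℕ) (h : Addable α i) : YoungDiagram where
  cells := insert (i, α.rowLen i) α.cells
  isLowerSet := by
    rintro ⟨a, b⟩ ⟨c, d⟩ hle hab
    obtain ⟨h1, h2⟩ := Prod.mk_le_mk.mp hle
    simp only [Finset.coe_insert, Set.mem_insert_iff, Finset.mem_coe, YoungDiagram.mem_cells,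
      Prod.mk.injEq] at hab ⊢
    rcases hab with ⟨rfl, rfl⟩ | hab
    · rcases Nat.lt_or_ge c a with hc | hc
      · right
        rw [YoungDiagram.mem_iff_lt_rowLen]
        exact lt_of_le_of_lt h2 (h c hc)
      · have : c = a := le_antisymm h1 hc
        subst this
        rcases Nat.lt_or_ge d (α.rowLen c) with hd | hd
        · right
          exact YoungDiagram.mem_iff_lt_rowLen.mpr hd
        · left; exact ⟨rfl, le_antisymm h2 hd⟩
    · right; exact α.up_left_mem h1 h2 hab

theorem addRow_addBox (α : YoungDiagram) (i : ℕ) (h : Addable α i) : AddBox α (addRow α i h) := by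
  constructor
  · rw [← YoungDiagram.cells_subset_iff]
    exact Finset.subset_insert _ _
  · refine Finset.card_insert_of_notMem ?_
    rw [YoungDiagram.mem_cells, YoungDiagram.mem_iff_lt_rowLen]
    omega

theorem mem_addRow {α : YoungDiagram} {i : ℕ} {h : Addable α i} {c : ℕ × ℕ} :
    c ∈ addRow α i h ↔ c = (i, α.rowLen i) ∨ c ∈ α := by
  rw [← YoungDiagram.mem_cells]
  simp [addRow]

theorem addRow_inj {α : YoungDiagram} {i j : ℕ} {h : Addable α i} {h' : Addable α j}
    (e : addRow α i h = addRow α j h') : i = j := by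
  have : (i, α.rowLen i) ∈ addRow α j h' := by
    rw [← e, mem_addRow]; left; rfl
  rw [mem_addRow] at this
  rcases this with h | h
  · exact (Prod.mk.inj h).1
  · rw [YoungDiagram.mem_iff_lt_rowLen] at h; omega

theorem addBox_cell {α μ : YoungDiagram} (h : AddBox α μ) :
    ∃ i j, (i, j) ∉ α ∧ μ.cells = insert (i, j) α.cells := by
  have hs := YoungDiagram.cells_subset_iff.mpr h.1
  have hc : (μ.cells \ α.cells).card = 1 := by
    rw [Finset.card_sdiff_of_subset hs]
    have := h.2
    simp only [YoungDiagram.card] at this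
    omega
  obtain ⟨⟨i, j⟩, hx⟩ := Finset.card_eq_one.mp hc
  refine ⟨i, j, ?_, ?_⟩
  · have : (i, j) ∈ μ.cells \ α.cells := by rw [hx]; simp
    simpa using (Finset.mem_sdiff.mp this).2
  · rw [Finset.insert_eq, ← hx, Finset.sdiff_union_of_subset hs]

theorem addBox_eq_addRow {α μ : YoungDiagram} (h : AddBox α μ) :
    ∃ i, ∃ hi : Addable α i, μ = addRow α i hi := by
  obtain ⟨i, j, hn, hc⟩ := addBox_cell h
  have hmem : ∀ c, c ∈ μ ↔ c = (i, j) ∨ c ∈ α := by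
    intro c
    rw [← YoungDiagram.mem_cells, hc]; simp
  have hij : (i, j) ∈ μ := (hmem _).2 (Or.inl rfl)
  have hj : j = α.rowLen i := by
    rw [YoungDiagram.mem_iff_lt_rowLen] at hn
    by_contra hne
    have : (i, α.rowLen i) ∈ μ := μ.up_left_mem le_rfl (by omega) hij
    rcases (hmem _).1 this with e | e
    · exact hne (Prod.mk.inj e).2.symm
    · rw [YoungDiagram.mem_iff_lt_rowLen] at e; omega
  subst hj
  refine ⟨i, ?_, YoungDiagram.ext hc⟩
  intro k hk
  have : (k, α.rowLen i) ∈ μ := μ.up_left_mem hk.le le_rfl hij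
  rcases (hmem _).1 this with e | e
  · have := (Prod.mk.inj e).1; omega
  · exact YoungDiagram.mem_iff_lt_rowLen.mp e

/-- rows from which a box can be removed -/
def Removable (α : YoungDiagram) (i : ℕ) : Prop := α.rowLen (i + 1) < α.rowLen i

def remRow (α : YoungDiagram) (i : ℕ) (h : Removable α i) : YoungDiagram where
  cells := α.cells.erase (i, α.rowLen i - 1)
  isLowerSet := by
    rintro ⟨a, b⟩ ⟨c, d⟩ hle hab
    obtain ⟨h1, h2⟩ := Prod.mk_le_mk.mp hle
    simp only [Finset.coe_erase, Set.mem_sdiff, Finset.mem_coe, YoungDiagram.mem_cells,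
      Set.mem_singleton_iff, Prod.mk.injEq] at hab ⊢
    refine ⟨α.up_left_mem h1 h2 hab.1, ?_⟩
    rintro ⟨rfl, rfl⟩
    have hb := YoungDiagram.mem_iff_lt_rowLen.mp hab.1
    unfold Removable at h
    rcases Nat.lt_or_ge c a with hc | hc
    · have := α.rowLen_anti _ _ (show c + 1 ≤ a from hc)
      omega
    · have : a = c := le_antisymm hc h1
      subst this
      exact hab.2 ⟨rfl, by omega⟩

theorem remRow_addBox (α : YoungDiagram) (i : ℕ) (h : Removable α i) : AddBox (remRow α i h) α := by
  constructor
  · rw [← YoungDiagram.cells_subset_iff]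
    exact Finset.erase_subset _ _
  · refine (Finset.card_erase_add_one ?_).symm
    rw [YoungDiagram.mem_cells, YoungDiagram.mem_iff_lt_rowLen]
    unfold Removable at h
    omega

theorem remRow_inj {α : YoungDiagram} {i j : ℕ} {h : Removable α i} {h' : Removable α j}
    (e : remRow α i h = remRow α j h') : i = j := by
  by_contra hne
  have h1 : (i, α.rowLen i - 1) ∈ (remRow α j h').cells := by
    simp only [remRow, Finset.mem_erase, ne_eq, Prod.mk.injEq, YoungDiagram.mem_cells,
      YoungDiagram.mem_iff_lt_rowLen]
    unfold Removable at h
    exact ⟨fun h => hne h.1, by omega⟩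
  rw [← e] at h1
  simp [remRow] at h1

theorem addBox_eq_remRow {α μ : YoungDiagram} (h : AddBox α μ) :
    ∃ i, ∃ hi : Removable μ i, α = remRow μ i hi := by
  obtain ⟨i, hi, rfl⟩ := addBox_eq_addRow h
  have hr : (addRow α i hi).rowLen i = α.rowLen i + 1 := by
    apply le_antisymm
    · by_contra hcon
      have : (i, α.rowLen i + 1) ∈ addRow α i hi :=
        YoungDiagram.mem_iff_lt_rowLen.mpr (by omega)
      rcases mem_addRow.1 this with e | e
      · have := (Prod.mk.inj e).2; omega
      · rw [YoungDiagram.mem_iff_lt_rowLen] at e; omega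
    · exact YoungDiagram.mem_iff_lt_rowLen.mp (mem_addRow.2 (Or.inl rfl))
  have hr1 : (addRow α i hi).rowLen (i + 1) ≤ α.rowLen i := by
    by_contra hcon
    have : (i + 1, α.rowLen i) ∈ addRow α i hi :=
      YoungDiagram.mem_iff_lt_rowLen.mpr (by omega)
    rcases mem_addRow.1 this with e | e
    · have := (Prod.mk.inj e).1; omega
    · rw [YoungDiagram.mem_iff_lt_rowLen] at e
      have := α.rowLen_anti _ _ (Nat.le_succ i)
      simp only [Nat.succ_eq_add_one] at this
      omega
  refine ⟨i, by unfold Removable; omega, ?_⟩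
  apply YoungDiagram.ext
  simp only [remRow, hr, Nat.add_sub_cancel]
  rw [show (addRow α i hi).cells = insert (i, α.rowLen i) α.cells from rfl,
    Finset.erase_insert]
  rw [YoungDiagram.mem_cells, YoungDiagram.mem_iff_lt_rowLen]
  omega

theorem addable_zero (α : YoungDiagram) : Addable α 0 := fun k hk => absurd hk (by omega)

theorem addable_succ {α : YoungDiagram} {i : ℕ} : Addable α (i + 1) ↔ Removable α i := by
  constructor
  · intro h; exact h i (by omega)
  · intro h k hk
    exact lt_of_lt_of_le h (α.rowLen_anti _ _ (by omega))

open scoped Classical in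
theorem card_ups (α : YoungDiagram) : (ups α).card = (dns α).card + 1 := by
  have hz : addRow α 0 (addable_zero α) ∈ ups α := mem_ups.2 (addRow_addBox _ _ _)
  rw [← Finset.card_erase_add_one hz]
  congr 1
  symm
  have key : ∀ γ ∈ dns α, ∃ i, ∃ hi : Removable α i, γ = remRow α i hi :=
    fun γ h => addBox_eq_remRow (mem_dns.1 h)
  choose! r hr hr' using key
  refine Finset.card_bij (fun γ hγ => addRow α (r γ + 1) (addable_succ.2 (hr γ hγ))) ?_ ?_ ?_
  · intro γ hγ
    refine Finset.mem_erase.2 ⟨?_, mem_ups.2 (addRow_addBox _ _ _)⟩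
    intro e
    have := addRow_inj e
    omega
  · intro γ hγ δ hδ e
    have := addRow_inj e
    have e2 : r γ = r δ := by omega
    have h1 := hr' γ hγ
    have h2 := hr' δ hδ
    rw [h1, h2]
    congr 1
  · intro μ hμ
    obtain ⟨hne, hμ⟩ := Finset.mem_erase.1 hμ
    obtain ⟨i, hi, rfl⟩ := addBox_eq_addRow (mem_ups.1 hμ)
    cases i with
    | zero => exact absurd rfl hne
    | succ i =>
      have hri := addable_succ.1 hi
      have hm : remRow α i hri ∈ dns α := mem_dns.2 (remRow_addBox _ _ _)
      refine ⟨_, hm, ?_⟩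
      have := remRow_inj (hr' _ hm).symm
      congr 1
      omega

noncomputable def Uo : (YoungDiagram → ℝ) →ₗ[ℝ] (YoungDiagram → ℝ) where
  toFun f μ := ∑ γ ∈ dns μ, f γ
  map_add' f g := by ext; simp [Finset.sum_add_distrib]
  map_smul' c f := by ext; simp [Finset.mul_sum]

noncomputable def Do : (YoungDiagram → ℝ) →ₗ[ℝ] (YoungDiagram → ℝ) where
  toFun f μ := ∑ γ ∈ ups μ, f γ
  map_add' f g := by ext; simp [Finset.sum_add_distrib]
  map_smul' c f := by ext; simp [Finset.mul_sum]

theorem Uo_apply (f : YoungDiagram → ℝ) (μ) : Uo f μ = ∑ γ ∈ dns μ, f γ := rfl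
theorem Do_apply (f : YoungDiagram → ℝ) (μ) : Do f μ = ∑ γ ∈ ups μ, f γ := rfl

theorem comm_rel (f : YoungDiagram → ℝ) : Do (Uo f) = Uo (Do f) + f := by
  ext α
  simp only [Pi.add_apply, Uo_apply, Do_apply]
  have h1 : ∑ μ ∈ ups α, ∑ β ∈ dns μ, f β
      = ∑ μ ∈ ups α, (f α + ∑ β ∈ (dns μ).erase α, f β) := by
    refine Finset.sum_congr rfl fun μ hμ => ?_
    rw [Finset.add_sum_erase]
    exact mem_dns.2 (mem_ups.1 hμ)
  have h2 : ∑ μ ∈ dns α, ∑ β ∈ ups μ, f β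
      = ∑ μ ∈ dns α, (f α + ∑ β ∈ (ups μ).erase α, f β) := by
    refine Finset.sum_congr rfl fun μ hμ => ?_
    rw [Finset.add_sum_erase]
    exact mem_ups.2 (mem_dns.1 hμ)
  have h3 : ∑ μ ∈ ups α, ∑ β ∈ (dns μ).erase α, f β
      = ∑ μ ∈ dns α, ∑ β ∈ (ups μ).erase α, f β := by
    rw [Finset.sum_sigma', Finset.sum_sigma']
    refine Finset.sum_bij' (fun x _ => ⟨α ⊓ x.2, x.2⟩) (fun x _ => ⟨α ⊔ x.2, x.2⟩) ?_ ?_ ?_ ?_ ?_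
    · rintro ⟨μ, β⟩ h
      simp only [Finset.mem_sigma, mem_ups, mem_dns, Finset.mem_erase] at h ⊢
      have := diamond_down h.1 h.2.2 h.2.1.symm
      exact ⟨this.1, h.2.1, this.2.1⟩
    · rintro ⟨μ, β⟩ h
      simp only [Finset.mem_sigma, mem_ups, mem_dns, Finset.mem_erase] at h ⊢
      have := diamond_up h.1 h.2.2 h.2.1.symm
      exact ⟨this.1, h.2.1, this.2.1⟩
    · rintro ⟨μ, β⟩ h
      simp only [Finset.mem_sigma, mem_ups, mem_dns, Finset.mem_erase] at h ⊢
      have := diamond_down h.1 h.2.2 h.2.1.symm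
      rw [this.2.2]
    · rintro ⟨μ, β⟩ h
      simp only [Finset.mem_sigma, mem_ups, mem_dns, Finset.mem_erase] at h ⊢
      have := diamond_up h.1 h.2.2 h.2.1.symm
      rw [this.2.2]
    · intros; rfl
  rw [h1, h2, Finset.sum_add_distrib, Finset.sum_add_distrib, h3]
  simp only [Finset.sum_const, card_ups, nsmul_eq_mul]
  push_cast
  ring

def Lev (n : ℕ) (f : YoungDiagram → ℝ) : Prop := ∀ μ, μ.card ≠ n → f μ = 0

theorem Lev.Do {n : ℕ} {f} (h : Lev (n + 1) f) : Lev n (Do f) := by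
  intro μ hμ
  refine Finset.sum_eq_zero fun ν hν => h ν ?_
  have := (mem_ups.1 hν).2
  omega

theorem Lev.Uo {n : ℕ} {f} (h : Lev n f) : Lev (n + 1) (Uo f) := by
  intro μ hμ
  refine Finset.sum_eq_zero fun ν hν => h ν ?_
  have := (mem_dns.1 hν).2
  omega

def Eig (n : ℕ) (lam : ℝ) : Prop := ∃ f, f ≠ 0 ∧ Lev n f ∧ Uo (Do f) = lam • f

theorem Eig.succ {n : ℕ} {lam : ℝ} (h0 : 0 ≤ lam) (h : Eig n lam) : Eig (n + 1) (lam + 1) := by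
  obtain ⟨f, hf, hl, he⟩ := h
  have hD : Do (Uo f) = (lam + 1) • f := by rw [comm_rel, he, add_smul, one_smul]
  refine ⟨Uo f, ?_, hl.Uo, ?_⟩
  · intro h
    rw [h, map_zero] at hD
    rcases smul_eq_zero.1 hD.symm with h | h
    · linarith
    · exact hf h
  · rw [hD, map_smul]

theorem Eig.pred {n : ℕ} {lam : ℝ} (h : Eig (n + 1) lam) : 
    (∃ f, f ≠ 0 ∧ Lev (n + 1) f ∧ Do f = 0 ∧ lam = 0) ∨ Eig n (lam - 1) := by
  obtain ⟨f, hf, hl, he⟩ := h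
  by_cases hD : Do f = 0
  · left
    refine ⟨f, hf, hl, hD, ?_⟩
    rw [hD, map_zero] at he
    rcases smul_eq_zero.1 he.symm with h | h
    · exact h
    · exact absurd h hf
  · right
    refine ⟨Do f, hD, hl.Do, ?_⟩
    have := comm_rel (Do f)
    rw [he, map_smul] at this
    rw [sub_smul, one_smul, this]
    simp

theorem yd_card_zero {μ : YoungDiagram} (h : μ.card = 0) : μ = ⊥ := by
  apply YoungDiagram.ext
  rw [YoungDiagram.cells_bot]
  exact Finset.card_eq_zero.1 h

theorem Eig.zero_level {lam : ℝ} (h : Eig 0 lam) : lam = 0 := by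
  obtain ⟨f, hf, hl, he⟩ := h
  have hD : Do f = 0 := by
    ext μ
    refine Finset.sum_eq_zero fun ν hν => hl ν ?_
    have := (mem_ups.1 hν).2
    omega
  rw [hD, map_zero] at he
  rcases smul_eq_zero.1 he.symm with h | h
  · exact h
  · exact absurd h hf

theorem eig_zero_zero : Eig 0 0 := by
  refine ⟨Pi.single ⊥ 1, ?_, ?_, ?_⟩
  · intro h
    have := congrFun h ⊥
    simp at this
  · intro μ hμ
    rw [Pi.single_eq_of_ne]
    rintro rfl
    exact hμ rfl
  · rw [zero_smul]
    have : Do (Pi.single ⊥ 1) = 0 := by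
      ext μ
      refine Finset.sum_eq_zero fun ν hν => ?_
      rw [Pi.single_eq_of_ne]
      rintro rfl
      have h : 0 = μ.card + 1 := (mem_ups.1 hν).2
      omega
    rw [this, map_zero]

theorem Eig.one_level {lam : ℝ} (h : Eig 1 lam) : lam = 1 := by
  rcases h.pred with ⟨f, hf, hl, hD, rfl⟩ | h
  · exfalso
    apply hf
    ext μ
    by_cases hμ : μ.card = 1
    · have h1 := congrFun hD ⊥
      rw [Do_apply, Finset.sum_eq_single_of_mem μ (mem_ups.2 ⟨bot_le, hμ⟩)] at h1
      · exact h1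
      · intro ν hν hne
        exfalso
        have hall : ∀ κ, AddBox ⊥ κ → κ = addRow ⊥ 0 (addable_zero _) := by
          intro κ hκ
          obtain ⟨i, hi, rfl⟩ := addBox_eq_addRow hκ
          have : i = 0 := by
            by_contra h0
            have h3 := hi 0 (by omega)
            have h4 : (0, 0) ∈ (⊥ : YoungDiagram) :=
              YoungDiagram.mem_iff_lt_rowLen.mpr (by omega)
            simp at h4
          subst this
          rfl
        exact hne ((hall ν (mem_ups.1 hν)).trans (hall μ ⟨bot_le, hμ⟩).symm)
    · exact hl μ hμ
  · have := h.zero_level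
    linarith

theorem Eig.sub (n : ℕ) : ∀ lam : ℝ, Eig (n + 1) lam →
    ((∃ k : ℕ, k + 2 ≤ n + 1 ∧ lam = (k : ℝ)) ∨ lam = ((n + 1 : ℕ) : ℝ)) := by
  induction n with
  | zero => intro lam h; right; simpa using h.one_level
  | succ n ih =>
    intro lam h
    rcases h.pred with ⟨f, _, _, _, rfl⟩ | h
    · left; exact ⟨0, by omega, by simp⟩
    · rcases ih _ h with ⟨k, hk, e⟩ | e
      · left; exact ⟨k + 1, by omega, by push_cast; linarith⟩
      · right; push_cast at e ⊢; linarith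

/-- extension by zero -/
noncomputable def ext0 (n : ℕ) (v : PartLE n n → ℝ) (μ : YoungDiagram) : ℝ :=
  if h : μ.card = n ∧ μ.colLen 0 ≤ n then v ⟨μ, h⟩ else 0

theorem ext0_val {n : ℕ} (v : PartLE n n → ℝ) (μ : PartLE n n) : ext0 n v μ.1 = v μ := by
  simp only [ext0, dif_pos μ.2]

theorem ext0_lev {n : ℕ} (v : PartLE n n → ℝ) : Lev n (ext0 n v) := by
  intro μ hμ
  rw [ext0, dif_neg]
  exact fun h => hμ h.1

theorem ext0_restrict {n : ℕ} {f : YoungDiagram → ℝ} (h : Lev n f) :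
    ext0 n (fun μ => f μ.1) = f := by
  ext μ
  by_cases hμ : μ.card = n
  · exact ext0_val (fun μ => f μ.1) ⟨μ, hμ, hμ ▸ colLen_le_card μ⟩
  · rw [h μ hμ, ext0_lev _ μ hμ]

theorem lev_ext {n : ℕ} {f g : YoungDiagram → ℝ} (hf : Lev n f) (hg : Lev n g)
    (h : ∀ μ : PartLE n n, f μ.1 = g μ.1) : f = g := by
  ext μ
  by_cases hμ : μ.card = n
  · exact h ⟨μ, hμ, hμ ▸ colLen_le_card μ⟩
  · rw [hf μ hμ, hg μ hμ]

theorem mf_entry {n : ℕ} (μ ν : PartLE n n) :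
    MF n n μ ν = ((dns μ.1 ∩ dns ν.1).card : ℝ) := by
  classical
  unfold MF
  split_ifs with h1 h2
  · subst h1
    rw [Finset.inter_self, nBox, dns]
    congr 1
    exact Nat.card_eq_card_finite_toFinset (dn_finite μ.1)
  · obtain ⟨hne, α, ha, hb⟩ := h2
    have : dns μ.1 ∩ dns ν.1 = {α} := by
      ext γ
      simp only [Finset.mem_inter, mem_dns, Finset.mem_singleton]
      constructor
      · rintro ⟨h3, h4⟩
        rw [← (diamond_up h3 h4 hne).2.2, ← (diamond_up ha hb hne).2.2]
      · rintro rfl; exact ⟨ha, hb⟩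
    rw [this]; simp
  · have : dns μ.1 ∩ dns ν.1 = ∅ := by
      rw [Finset.eq_empty_iff_forall_notMem]
      intro γ hγ
      simp only [Finset.mem_inter, mem_dns] at hγ
      exact h2 ⟨fun e => h1 (Subtype.ext e), γ, hγ⟩
    rw [this]; simp

theorem mf_mulVec {n : ℕ} (v : PartLE n n → ℝ) (μ : PartLE n n) :
    (MF n n).mulVec v μ = Uo (Do (ext0 n v)) μ.1 := by
  classical
  rw [Matrix.mulVec, dotProduct, Uo_apply]
  simp only [Do_apply, mf_entry]
  have : ∀ γ ∈ dns μ.1, ∑ β ∈ ups γ, ext0 n v β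
      = ∑ ν : PartLE n n, if γ ∈ dns ν.1 then v ν else 0 := by
    intro γ hγ
    rw [← Finset.sum_filter]
    symm
    refine Finset.sum_bij (fun ν _ => ν.1) ?_ ?_ ?_ ?_
    · intro ν hν
      rw [Finset.mem_filter] at hν
      exact mem_ups.2 (mem_dns.1 hν.2)
    · intro a _ b _ e
      exact Subtype.ext e
    · intro β hβ
      have h1 := mem_ups.1 hβ
      have h2 := mem_dns.1 hγ
      have hc : β.card = n := by rw [h1.2, ← h2.2, μ.2.1]
      refine ⟨⟨β, hc, hc ▸ colLen_le_card β⟩, ?_, rfl⟩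
      rw [Finset.mem_filter]
      exact ⟨Finset.mem_univ _, mem_dns.2 h1⟩
    · intro ν _
      exact (ext0_val v ν).symm
  rw [Finset.sum_congr rfl this, Finset.sum_comm]
  refine Finset.sum_congr rfl fun ν _ => ?_
  rw [← Finset.sum_filter, Finset.filter_mem_eq_inter]
  simp

theorem eig_iff (n : ℕ) (lam : ℝ) :
    (∃ v : PartLE n n → ℝ, v ≠ 0 ∧ (MF n n).mulVec v = lam • v) ↔ Eig n lam := by
  have hlev : ∀ f, Lev n f → Lev n (Uo (Do f)) := by
    intro f hf
    cases n with
    | zero =>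
      intro μ hμ
      refine Finset.sum_eq_zero fun γ _ => Finset.sum_eq_zero fun ν hν => hf ν ?_
      have := (mem_ups.1 hν).2
      omega
    | succ n => exact hf.Do.Uo
  constructor
  · rintro ⟨v, hv, he⟩
    refine ⟨ext0 n v, ?_, ext0_lev v, ?_⟩
    · intro h
      apply hv
      ext μ
      rw [← ext0_val v μ, h]; rfl
    · refine lev_ext (hlev _ (ext0_lev v)) ?_ ?_
      · intro μ hμ
        simp [ext0_lev v μ hμ]
      · intro μ
        rw [← mf_mulVec, he]
        simp [ext0_val]
  · rintro ⟨f, hf, hl, he⟩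
    refine ⟨fun μ => f μ.1, ?_, ?_⟩
    · intro h
      apply hf
      refine lev_ext hl (fun _ _ => rfl) ?_
      intro μ
      exact congrFun h μ
    · ext μ
      rw [mf_mulVec, ext0_restrict hl, he]
      rfl

def colDiag (n : ℕ) : YoungDiagram where
  cells := Finset.range n ×ˢ {0}
  isLowerSet := by
    rintro ⟨a, b⟩ ⟨c, d⟩ hle hab
    obtain ⟨h1, h2⟩ := Prod.mk_le_mk.mp hle
    simp only [Finset.coe_product, Set.mem_prod, Finset.mem_coe, Finset.mem_range,
      Finset.mem_singleton] at hab ⊢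
    omega

theorem addRow_zero_inj {α β : YoungDiagram}
    (e : addRow α 0 (addable_zero α) = addRow β 0 (addable_zero β)) : α = β := by
  have key : ∀ {α β : YoungDiagram},
      addRow α 0 (addable_zero α) = addRow β 0 (addable_zero β) → α.rowLen 0 ≤ β.rowLen 0 := by
    intro α β e
    have : (0, α.rowLen 0) ∈ addRow β 0 (addable_zero β) := by
      rw [← e, mem_addRow]; left; rfl
    rcases mem_addRow.1 this with h | h
    · exact (Prod.mk.inj h).2.le
    · exact (YoungDiagram.mem_iff_lt_rowLen.mp h).le
  have hr := le_antisymm (key e) (key e.symm)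
  have hc : insert (0, α.rowLen 0) α.cells = insert (0, β.rowLen 0) β.cells :=
    congrArg YoungDiagram.cells e
  apply YoungDiagram.ext
  have hn : ∀ α : YoungDiagram, (0, α.rowLen 0) ∉ α.cells := by
    intro α h
    rw [YoungDiagram.mem_cells, YoungDiagram.mem_iff_lt_rowLen] at h
    omega
  rw [← Finset.erase_insert (hn α), ← Finset.erase_insert (hn β), hc, hr]

theorem card_level_lt (n : ℕ) :
    Fintype.card (PartLE (n + 1) (n + 1)) < Fintype.card (PartLE (n + 2) (n + 2)) := by
  have hc : ∀ α : PartLE (n + 1) (n + 1), (addRow α.1 0 (addable_zero α.1)).card = n + 2 := by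
    intro α
    rw [(addRow_addBox α.1 0 (addable_zero α.1)).2, α.2.1]
  have hcol : (colDiag (n + 2)).card = n + 2 := by
    simp [colDiag, YoungDiagram.card]
  refine Fintype.card_lt_of_injective_of_notMem
    (fun α => ⟨addRow α.1 0 (addable_zero α.1), hc α, (colLen_le_card _).trans (hc α).le⟩)
    ?_ (b := ⟨colDiag (n + 2), hcol, (colLen_le_card _).trans hcol.le⟩) ?_
  · intro α β e
    exact Subtype.ext (addRow_zero_inj (congrArg Subtype.val e))
  · rintro ⟨α, e⟩
    have e' : addRow α.1 0 (addable_zero α.1) = colDiag (n + 2) := congrArg Subtype.val e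
    have h1 : (0, α.1.rowLen 0) ∈ colDiag (n + 2) := by
      rw [← e', mem_addRow]; left; rfl
    have h2 : α.1.rowLen 0 = 0 := by
      rw [← YoungDiagram.mem_cells] at h1
      simp only [colDiag, Finset.mem_product, Finset.mem_singleton] at h1
      exact h1.2
    have h3 : α.1.cells = ∅ := by
      rw [Finset.eq_empty_iff_forall_notMem]
      rintro ⟨i, j⟩ h
      rw [YoungDiagram.mem_cells] at h
      have := YoungDiagram.mem_iff_lt_rowLen.mp
        (α.1.up_left_mem (Nat.zero_le i) (Nat.zero_le j) h)
      omega
    have h4 := α.2.1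
    simp [YoungDiagram.card, h3] at h4

theorem eig_zero (n : ℕ) : Eig (n + 2) 0 := by
  let T : (PartLE (n + 2) (n + 2) → ℝ) →ₗ[ℝ] (PartLE (n + 1) (n + 1) → ℝ) :=
    { toFun := fun v α => Do (ext0 (n + 2) v) α.1
      map_add' := by
        intro v w
        have : ext0 (n + 2) (v + w) = ext0 (n + 2) v + ext0 (n + 2) w := by
          ext μ
          simp only [ext0, Pi.add_apply]
          split_ifs <;> simp
        ext α
        simp [this]
      map_smul' := by
        intro c v
        have : ext0 (n + 2) (c • v) = c • ext0 (n + 2) v := by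
          ext μ
          simp only [ext0, Pi.smul_apply]
          split_ifs <;> simp
        ext α
        simp [this] }
  have hker : LinearMap.ker T ≠ ⊥ := by
    apply LinearMap.ker_ne_bot_of_finrank_lt
    rw [Module.finrank_fintype_fun_eq_card, Module.finrank_fintype_fun_eq_card]
    exact card_level_lt n
  obtain ⟨v, hv, hne⟩ := Submodule.exists_mem_ne_zero_of_ne_bot hker
  refine ⟨ext0 (n + 2) v, ?_, ext0_lev v, ?_⟩
  · intro h
    apply hne
    ext μ
    rw [← ext0_val v μ, h]; rfl
  · have : Do (ext0 (n + 2) v) = 0 := by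
      refine lev_ext (n := n + 1) (ext0_lev v).Do (fun _ _ => rfl) ?_
      intro μ
      exact congrFun (LinearMap.mem_ker.1 hv) μ
    rw [this, map_zero, zero_smul]

theorem Eig.iter {n : ℕ} (h : Eig n 0) (k : ℕ) : Eig (n + k) (k : ℝ) := by
  induction k with
  | zero => simpa using h
  | succ k ih =>
    have := ih.succ (Nat.cast_nonneg k)
    push_cast
    exact this

theorem eig_main (N : ℕ) (hN : 2 ≤ N) (lam : ℝ) :
    Eig N lam ↔ ((∃ k : ℕ, k ≤ N - 2 ∧ lam = (k : ℝ)) ∨ lam = (N : ℝ)) := by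
  constructor
  · intro h
    obtain ⟨n, rfl⟩ : ∃ n, N = n + 1 := ⟨N - 1, by omega⟩
    rcases Eig.sub n lam h with ⟨k, hk, e⟩ | e
    · left; exact ⟨k, by omega, e⟩
    · right; exact e
  · rintro (⟨k, hk, rfl⟩ | rfl)
    · obtain ⟨m, rfl⟩ : ∃ m, N = m + 2 + k := ⟨N - 2 - k, by omega⟩
      exact (eig_zero m).iter k
    · have := eig_zero_zero.iter N
      rwa [Nat.zero_add] at this

/-- For every `N ≥ 2`, the set of eigenvalues of the real symmetric Teleportation Matrix
`M_F(N)` is exactly `{0, 1, …, N-2} ∪ {N}`; in particular `N - 1` is not an eigenvalue. -/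
theorem spectrum_MF (N : ℕ) (hN : 2 ≤ N) :
    (∀ lam : ℝ,
        (∃ v : PartLE N N → ℝ, v ≠ 0 ∧ (MF N N).mulVec v = lam • v) ↔
          ((∃ k : ℕ, k ≤ N - 2 ∧ lam = (k : ℝ)) ∨ lam = (N : ℝ))) ∧
      ¬ ∃ v : PartLE N N → ℝ, v ≠ 0 ∧ (MF N N).mulVec v = ((N : ℝ) - 1) • v := by
  refine ⟨fun lam => (eig_iff N lam).trans (eig_main N hN lam), ?_⟩
  rw [eig_iff, eig_main N hN]
  rintro (⟨k, hk, e⟩ | e)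
  · have h1 : ((k + 1 : ℕ) : ℝ) = (N : ℝ) := by push_cast; linarith
    have h2 : k + 1 = N := by exact_mod_cast h1
    omega
  · linarith
end

section
/- Fix integers d ≥ 2 and N ≥ 1. The supremum of (1/d²)·Σ_{a=1}^{N} tr(Π_a σ_a), taken over all families (Π_a)_{a=1}^{N} of positive semidefinite d^{N+1} × d^{N+1} complex matrices and all positive semidefinite d^N × d^N complex matrices X satisfying Σ_{a=1}^{N} Π_a ≤ X ⊗ I_d and tr X = d^N, equals (1/d²)·λ_max(M_F^d(N)), where λ_max(M_F^d(N)) is the largest eigenvalue of the Teleportation Matrix restricted to partitions of N with at most d parts. (This is the optimal fidelity of deterministic port-based teleportation of a d-dimensional state through N ports, optimized simultaneously over the resource state and the measurement.) -/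
open scoped ComplexOrder

/-- The operator `σ_a` of the deterministic port-based teleportation protocol, acting on
`(ℂ^d)^{⊗(N+1)}`: its `(f, g)` entry is `d^{-N}` if `f(a) = f(n)`, `g(a) = g(n)` and
`f(i) = g(i)` for all `i ∉ {a, n}` (where `n = N + 1` is the last tensor factor), and `0`
otherwise; i.e. `σ_a = d^{-N} · 1 ⊗ P̃⁺_{a,n}`. -/
noncomputable def sigmaPBT (d N : ℕ) (a : Fin N) :
    Matrix (Fin (N + 1) → Fin d) (Fin (N + 1) → Fin d) ℂ := fun f g =>
  if f a.castSucc = f (Fin.last N) ∧ g a.castSucc = g (Fin.last N) ∧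
      ∀ i : Fin (N + 1), i ≠ a.castSucc → i ≠ Fin.last N → f i = g i
    then ((d : ℂ) ^ N)⁻¹ else 0

/-- `X ⊗ I_d` : the operator on `(ℂ^d)^{⊗(N+1)}` acting as `X` on the first `N` tensor factors
and as the identity on the last factor. -/
noncomputable def tensorIdRight (d N : ℕ)
    (X : Matrix (Fin N → Fin d) (Fin N → Fin d) ℂ) :
    Matrix (Fin (N + 1) → Fin d) (Fin (N + 1) → Fin d) ℂ := fun f g =>
  if f (Fin.last N) = g (Fin.last N) then X (Fin.init f) (Fin.init g) else 0

/-- The set of fidelities `(1/d²)·∑_a tr(Π_a σ_a)` achievable in deterministic port-based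
teleportation by families `(Π_a)` of positive semidefinite operators and positive semidefinite
`X` with `∑_a Π_a ≤ X ⊗ I_d` and `tr X = d^N`. -/
noncomputable def pbtFidelitySet (d N : ℕ) : Set ℝ :=
  {r : ℝ |
    ∃ (P : Fin N → Matrix (Fin (N + 1) → Fin d) (Fin (N + 1) → Fin d) ℂ)
      (X : Matrix (Fin N → Fin d) (Fin N → Fin d) ℂ),
      (∀ a : Fin N, (P a).PosSemidef) ∧ X.PosSemidef ∧
      (tensorIdRight d N X - ∑ a : Fin N, P a).PosSemidef ∧
      X.trace = (d : ℂ) ^ N ∧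
      (r : ℂ) = (1 / (d : ℂ) ^ 2) * ∑ a : Fin N, (P a * sigmaPBT d N a).trace}

open scoped ComplexOrder

namespace PBT
open Matrix Finset

/-- Operators on the `n`-fold tensor power. -/
abbrev H (d n : ℕ) := Matrix (Fin n → Fin d) (Fin n → Fin d) ℂ

variable {d n : ℕ}

/-- Appending a letter. -/
def sn (g : Fin n → Fin d) (k : Fin d) : Fin (n + 1) → Fin d :=
  Fin.snoc (α := fun _ => Fin d) g k

@[simp] theorem sn_last (g : Fin n → Fin d) (k : Fin d) : sn g k (Fin.last n) = k := by
  simp [sn]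

@[simp] theorem sn_castSucc (g : Fin n → Fin d) (k : Fin d) (i : Fin n) :
    sn g k i.castSucc = g i := by
  simp [sn]

@[simp] theorem init_sn (g : Fin n → Fin d) (k : Fin d) : Fin.init (sn g k) = g := by
  ext i; simp [Fin.init]

theorem exists_sn (f : Fin (n + 1) → Fin d) : ∃ g k, f = sn g k :=
  ⟨Fin.init f, f (Fin.last n), by simp [sn]⟩

@[simp] theorem sn_inj (g g' : Fin n → Fin d) (k k' : Fin d) :
    sn g k = sn g' k' ↔ g = g' ∧ k = k' := by
  constructor
  · intro h
    refine ⟨?_, ?_⟩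
    · rw [← init_sn g k, h, init_sn]
    · rw [← sn_last g k, h, sn_last]
  · rintro ⟨rfl, rfl⟩; rfl

theorem sum_sn {M : Type*} [AddCommMonoid M] (F : (Fin (n + 1) → Fin d) → M) :
    ∑ f, F f = ∑ g, ∑ k, F (sn g k) := by
  rw [← (Fin.snocEquiv (fun _ : Fin (n + 1) => Fin d)).sum_comp, Fintype.sum_prod_type,
    Finset.sum_comm]
  rfl

/-- Permutation operators. -/
def pm (σ : Equiv.Perm (Fin n)) : H d n := fun f g => if f ∘ σ = g then 1 else 0

theorem pm_mul_apply (σ : Equiv.Perm (Fin n)) (A : H d n) (f g) :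
    (pm σ * A : H d n) f g = A (f ∘ σ) g := by
  simp only [Matrix.mul_apply, pm]
  simp

theorem mul_pm_apply (σ : Equiv.Perm (Fin n)) (A : H d n) (f g) :
    (A * pm σ : H d n) f g = A f (g ∘ ⇑σ⁻¹) := by
  simp only [Matrix.mul_apply, pm]
  rw [Finset.sum_eq_single (g ∘ ⇑σ⁻¹)]
  · simp [Function.comp_assoc]
  · intro b _ hb
    rw [if_neg, mul_zero]
    rintro rfl
    exact hb (by ext; simp)
  · simp

theorem pm_mul (σ τ : Equiv.Perm (Fin n)) : (pm (σ * τ) : H d n) = pm σ * pm τ := by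
  ext f g
  rw [pm_mul_apply]; rfl

@[simp] theorem pm_one : (pm 1 : H d n) = 1 := by
  ext f g
  simp [pm, Matrix.one_apply]

theorem pm_conjTranspose (σ : Equiv.Perm (Fin n)) : (pm σ : H d n)ᴴ = pm σ⁻¹ := by
  ext f g
  simp only [conjTranspose_apply, pm]
  have : g ∘ σ = f ↔ f ∘ ⇑σ⁻¹ = g := by
    constructor <;> (rintro rfl; ext; simp)
  simp only [this]
  split_ifs <;> simp

/-- `A ↦ A ⊗ 1` as an algebra homomorphism. -/
noncomputable def io (d n : ℕ) : H d n →ₐ[ℝ] H d (n + 1) where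
  toFun := tensorIdRight d n
  map_one' := by
    ext f g
    obtain ⟨f, a, rfl⟩ := exists_sn f
    obtain ⟨g, b, rfl⟩ := exists_sn g
    simp [tensorIdRight, Matrix.one_apply]
    grind
  map_zero' := by
    ext f g
    simp [tensorIdRight]
  map_mul' A B := by
    ext f g
    obtain ⟨f, a, rfl⟩ := exists_sn f
    obtain ⟨g, b, rfl⟩ := exists_sn g
    simp [tensorIdRight, Matrix.mul_apply, sum_sn]
  map_add' A B := by
    ext f g
    simp only [tensorIdRight, Matrix.add_apply]
    split_ifs <;> simp
  commutes' r := by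
    ext f g
    obtain ⟨f, a, rfl⟩ := exists_sn f
    obtain ⟨g, b, rfl⟩ := exists_sn g
    simp [tensorIdRight, Matrix.algebraMap_matrix_apply]
    grind

theorem io_apply (A : H d n) (f g a b) :
    io d n A (sn f a) (sn g b) = if a = b then A f g else 0 := by
  change tensorIdRight d n A _ _ = _
  simp [tensorIdRight]

theorem io_conjTranspose (A : H d n) : (io d n A)ᴴ = io d n Aᴴ := by
  ext f g
  obtain ⟨f, a, rfl⟩ := exists_sn f
  obtain ⟨g, b, rfl⟩ := exists_sn g
  simp only [conjTranspose_apply, io_apply, eq_comm (a := a)]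
  split_ifs <;> simp

/-- Partial trace over the last factor. -/
noncomputable def pt (d n : ℕ) : H d (n + 1) →ₗ[ℝ] H d n where
  toFun A := Matrix.of fun f g => ∑ k, A (sn f k) (sn g k)
  map_add' A B := by
    ext f g
    simp [Finset.sum_add_distrib]
  map_smul' r A := by
    ext f g
    simp [Finset.mul_sum]

theorem pt_apply (A : H d (n + 1)) (f g) : pt d n A f g = ∑ k, A (sn f k) (sn g k) := rfl

theorem pt_io_mul (a : H d n) (B : H d (n + 1)) : pt d n (io d n a * B) = a * pt d n B := by
  ext f g
  simp only [pt_apply, Matrix.mul_apply, sum_sn, io_apply]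
  rw [Finset.sum_comm]
  refine Finset.sum_congr rfl fun h _ => ?_
  simp [Finset.mul_sum]

theorem pt_mul_io (a : H d n) (B : H d (n + 1)) : pt d n (B * io d n a) = pt d n B * a := by
  ext f g
  simp only [pt_apply, Matrix.mul_apply, sum_sn, io_apply]
  rw [Finset.sum_comm]
  refine Finset.sum_congr rfl fun h _ => ?_
  simp [Finset.sum_mul]

theorem pt_one : pt d n 1 = (d : ℝ) • 1 := by
  ext f g
  simp only [pt_apply, Matrix.one_apply, Matrix.smul_apply, sn_inj]
  split_ifs <;> simp_all

theorem trace_pt (A : H d (n + 1)) : (pt d n A).trace = A.trace := by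
  simp [Matrix.trace, pt_apply, sum_sn]

theorem trace_io_mul (a : H d n) (B : H d (n + 1)) :
    (io d n a * B).trace = (a * pt d n B).trace := by
  rw [← trace_pt, pt_io_mul]

/-- swap with the last position -/
def tr (a : Fin (n + 1)) : Equiv.Perm (Fin (n + 1)) := Equiv.swap a (Fin.last n)

theorem pt_swap (i : Fin n) : pt d n (pm (tr i.castSucc)) = 1 := by
  ext f g
  simp only [pt_apply, Matrix.one_apply, pm]
  have key : ∀ k, (sn f k ∘ ⇑(tr i.castSucc) = sn g k) ↔ (k = f i ∧ f = g) := by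
    intro k
    constructor
    · intro h
      have h1 := congrFun h (Fin.last n)
      have h2 := congrFun h i.castSucc
      simp [tr] at h1 h2
      refine ⟨h1.symm, ?_⟩
      ext j
      by_cases hj : j = i
      · subst hj; rw [h1, ← h2]
      · have h3 := congrFun h j.castSucc
        simp only [tr, Function.comp] at h3
        rw [Equiv.swap_apply_of_ne_of_ne (by simpa using hj) (Fin.castSucc_lt_last j).ne] at h3
        simpa using congrArg Fin.val h3
    · rintro ⟨rfl, rfl⟩
      ext j
      refine Fin.lastCases ?_ (fun j => ?_) j
      · simp [tr]
      · by_cases hj : j = i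
        · subst hj; simp [tr]
        · simp only [tr, Function.comp]
          rw [Equiv.swap_apply_of_ne_of_ne (by simpa using hj) (Fin.castSucc_lt_last j).ne]
  simp only [key]
  by_cases h : f = g <;> simp [h]

theorem sn_sn_swap (f : Fin n → Fin d) (a b : Fin d) :
    sn (sn f a) b ∘ ⇑(tr (Fin.last n).castSucc) = sn (sn f b) a := by
  funext j
  refine Fin.lastCases ?_ (fun j => ?_) j
  · simp [tr]
  · refine Fin.lastCases ?_ (fun j => ?_) j
    · simp [tr]
    · simp only [tr, Function.comp]
      rw [Equiv.swap_apply_of_ne_of_ne]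
      · simp
      · simpa using (Fin.castSucc_lt_last j).ne
      · exact (Fin.castSucc_lt_last _).ne

theorem tr_inv (a : Fin (n + 1)) : (tr a)⁻¹ = tr a := by simp [tr]

theorem tr_sq (a : Fin (n + 1)) : (pm (tr a) : H d (n + 1)) * pm (tr a) = 1 := by
  rw [← pm_mul]; simp [tr]

theorem tr_star (a : Fin (n + 1)) : (pm (tr a) : H d (n + 1))ᴴ = pm (tr a) := by
  rw [pm_conjTranspose, tr_inv]

theorem pt_conj (A : H d (n + 1)) :
    pt d (n + 1) (pm (tr (Fin.last n).castSucc) * io d (n + 1) A * pm (tr (Fin.last n).castSucc))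
      = io d n (pt d n A) := by
  ext f g
  obtain ⟨f, a, rfl⟩ := exists_sn f
  obtain ⟨g, b, rfl⟩ := exists_sn g
  simp only [pt_apply, io_apply, mul_pm_apply, pm_mul_apply, tr_inv, sn_sn_swap]
  split_ifs <;> simp

/-- Extension of a permutation by fixing the last point. -/
theorem exists_ext (σ : Equiv.Perm (Fin n)) : ∃ τ : Equiv.Perm (Fin (n + 1)),
    (∀ i, τ i.castSucc = (σ i).castSucc) ∧ τ (Fin.last n) = Fin.last n ∧
    (io d n (pm σ) = pm τ) := by
  have key : ∀ τ : Equiv.Perm (Fin (n + 1)), (∀ i, τ i.castSucc = (σ i).castSucc) →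
      τ (Fin.last n) = Fin.last n → io d n (pm σ) = pm τ := by
    intro τ h1 h2
    ext f g
    obtain ⟨f, a, rfl⟩ := exists_sn f
    obtain ⟨g, b, rfl⟩ := exists_sn g
    have : sn f a ∘ ⇑τ = sn (f ∘ σ) a := by
      funext j
      refine Fin.lastCases ?_ (fun j => ?_) j
      · simp [h2]
      · simp [h1]
    simp only [io_apply, pm, this, sn_inj]
    grind
  let τ : Equiv.Perm (Fin (n + 1)) :=
    { toFun := Fin.lastCases (Fin.last n) (fun i => (σ i).castSucc)
      invFun := Fin.lastCases (Fin.last n) (fun i => (σ⁻¹ i).castSucc)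
      left_inv := by
        intro j
        refine Fin.lastCases ?_ (fun j => ?_) j <;> simp
      right_inv := by
        intro j
        refine Fin.lastCases ?_ (fun j => ?_) j <;> simp }
  have h1 : ∀ i, τ i.castSucc = (σ i).castSucc := by intro i; simp [τ]
  have h2 : τ (Fin.last n) = Fin.last n := by simp [τ]
  exact ⟨τ, h1, h2, key τ h1 h2⟩

theorem exists_restrict (τ : Equiv.Perm (Fin (n + 1))) (h : τ (Fin.last n) = Fin.last n) :
    ∃ σ : Equiv.Perm (Fin n), (io d n (pm σ) = pm τ) := by
  have hne : ∀ i : Fin n, τ i.castSucc ≠ Fin.last n := by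
    intro i hi
    rw [← h] at hi
    exact (Fin.castSucc_lt_last i).ne (τ.injective hi)
  have h' : τ⁻¹ (Fin.last n) = Fin.last n := by
    rw [Equiv.Perm.inv_eq_iff_eq, h]
  have hne' : ∀ i : Fin n, τ⁻¹ i.castSucc ≠ Fin.last n := by
    intro i hi
    rw [← h'] at hi
    exact (Fin.castSucc_lt_last i).ne (τ⁻¹.injective hi)
  let σ : Equiv.Perm (Fin n) :=
    { toFun := fun i => (τ i.castSucc).castPred (hne i)
      invFun := fun i => (τ⁻¹ i.castSucc).castPred (hne' i)
      left_inv := by intro j; simp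
      right_inv := by intro j; simp }
  obtain ⟨τ', h1, h2, h3⟩ := exists_ext (d := d) σ
  refine ⟨σ, ?_⟩
  rw [h3]
  congr 1
  ext j
  refine Fin.lastCases ?_ (fun j => ?_) j
  · rw [h2, h]
  · rw [h1]; simp [σ]

theorem io_tr (a : Fin (n + 1)) :
    io d (n + 1) (pm (tr a)) = pm (Equiv.swap a.castSucc (Fin.last n).castSucc) := by
  obtain ⟨τ, h1, h2, h3⟩ := exists_ext (d := d) (tr a)
  rw [h3]
  congr 1
  ext j
  refine Fin.lastCases ?_ (fun j => ?_) j
  · rw [h2, Equiv.swap_apply_of_ne_of_ne (Fin.castSucc_lt_last _).ne'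
      (Fin.castSucc_lt_last _).ne']
  · rw [h1]
    simp only [tr, Equiv.swap_apply_def]
    grind

theorem pm_conj_tr (σ : Equiv.Perm (Fin (n + 1))) (h : σ (Fin.last n) = Fin.last n)
    (a : Fin (n + 1)) :
    (pm σ : H d (n + 1)) * pm (tr a) = pm (tr (σ a)) * pm σ := by
  rw [← pm_mul, ← pm_mul]
  congr 1
  rw [tr, tr, ← mul_inv_eq_iff_eq_mul, ← Equiv.swap_apply_apply, h]

/-- Jucys-Murphy element. -/
noncomputable def X (d n : ℕ) : H d (n + 1) := ∑ i : Fin n, pm (tr i.castSucc)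

theorem X_star : (X d n)ᴴ = X d n := by
  simp [X, conjTranspose_sum, tr_star]

theorem X_comm (σ : Equiv.Perm (Fin n)) : Commute (X d n) (io d n (pm σ)) := by
  obtain ⟨τ, h1, h2, h3⟩ := exists_ext (d := d) σ
  rw [h3, Commute, SemiconjBy, X, Finset.mul_sum, Finset.sum_mul]
  simp only [pm_conj_tr τ h2, h1]
  rw [← Equiv.sum_comp σ (fun i => pm (tr i.castSucc) * pm τ)]

theorem conj_s (a : Fin (n + 1)) :
    io d (n + 1) (pm (tr a)) * pm (tr (Fin.last n).castSucc) * io d (n + 1) (pm (tr a)) =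
      pm (tr a.castSucc) := by
  obtain ⟨τ, h1, h2, h3⟩ := exists_ext (d := d) (tr a)
  rw [h3, pm_conj_tr τ h2, h1, mul_assoc, ← h3, ← map_mul, tr_sq, map_one, mul_one]
  simp [tr]

theorem X_succ : X d (n + 1) =
    pm (tr (Fin.last n).castSucc) * io d (n + 1) (X d n) * pm (tr (Fin.last n).castSucc)
      + pm (tr (Fin.last n).castSucc) := by
  rw [X, Fin.sum_univ_castSucc, X, map_sum, Finset.mul_sum, Finset.sum_mul]
  congr 1
  refine Finset.sum_congr rfl fun i _ => ?_
  rw [io_tr, ← pm_mul, ← pm_mul]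
  congr 1
  have h := Equiv.swap_apply_apply (tr (Fin.last n).castSucc) i.castSucc.castSucc
    (Fin.last n).castSucc
  rw [tr_inv] at h
  rw [← h]
  simp only [tr, Equiv.swap_apply_left]
  rw [Equiv.swap_apply_of_ne_of_ne]
  · simpa using (Fin.castSucc_lt_last i).ne
  · exact (Fin.castSucc_lt_last _).ne

theorem sum_conj_s :
    ∑ a : Fin (n + 1), io d (n + 1) (pm (tr a)) * pm (tr (Fin.last n).castSucc) *
      io d (n + 1) (pm (tr a)) = X d (n + 1) := by
  simp only [conj_s]; rfl

end PBT

open scoped ComplexOrder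

namespace PBT
open Matrix Finset

variable {d n : ℕ}

section ring
variable {A : Type*} [Ring A] {x y s u Rx Ry : A}

theorem ring_lemma (hs : s * s = 1) (hy : y = s * x * s + s) (hus : Commute u s)
    (hxy : Commute x y)
    (h1 : Rx * (u - x) = 1) (h2 : (u - x) * Rx = 1) (h3 : Ry * (u - y) = 1)
    (h4 : (u - y) * Ry = 1) (hR : Commute Rx Ry) :
    Ry = s * Rx * s + Rx * s * Rx + Rx * Rx * Ry ∧
    s * Ry * s = Rx + Ry * s * Ry - Rx * Ry * Ry := by
  have e1 : s * (u - y) = (u - x) * s - 1 := by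
    rw [hy, mul_sub, sub_mul, hus.eq, mul_add, ← mul_assoc, ← mul_assoc, hs]
    noncomm_ring
  have e2 : (u - y) * s = s * (u - x) - 1 := by
    rw [hy, mul_sub, sub_mul, hus.eq, add_mul, mul_assoc, hs]
    noncomm_ring
  have f1 : s * Ry = Rx * s + Rx * Ry := by
    have : Rx * (s * (u - y)) * Ry = Rx * ((u - x) * s - 1) * Ry := by rw [e1]
    calc s * Ry = (Rx * (u - x)) * s * Ry := by rw [h1, one_mul]
      _ = Rx * ((u - x) * s - 1) * Ry + Rx * Ry := by noncomm_ring
      _ = Rx * s * ((u - y) * Ry) + Rx * Ry := by rw [← this]; noncomm_ring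
      _ = _ := by rw [h4, mul_one]
  have f2 : Ry * s = s * Rx + Ry * Rx := by
    have : Ry * ((u - y) * s) * Rx = Ry * (s * (u - x) - 1) * Rx := by rw [e2]
    calc Ry * s = Ry * s * ((u - x) * Rx) := by rw [h2, mul_one]
      _ = Ry * (s * (u - x) - 1) * Rx + Ry * Rx := by noncomm_ring
      _ = (Ry * (u - y)) * s * Rx + Ry * Rx := by rw [← this]; noncomm_ring
      _ = _ := by rw [h3, one_mul]
  have hc := hR.eq
  constructor
  · calc Ry = s * (s * Ry) := by rw [← mul_assoc, hs, one_mul]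
      _ = s * Rx * s + (s * Rx) * Ry := by rw [f1]; noncomm_ring
      _ = s * Rx * s + (Ry * s - Ry * Rx) * Ry := by rw [f2]; noncomm_ring
      _ = s * Rx * s + Ry * (s * Ry) - Ry * Rx * Ry := by noncomm_ring
      _ = s * Rx * s + Ry * Rx * s := by rw [f1]; noncomm_ring
      _ = s * Rx * s + Rx * (Ry * s) := by rw [← hc]; noncomm_ring
      _ = s * Rx * s + Rx * s * Rx + Rx * (Ry * Rx) := by rw [f2]; noncomm_ring
      _ = _ := by rw [← hc]; noncomm_ring
  · have g : Rx * s * Rx = Ry * s * Ry - Rx * Ry * Ry - Rx * Rx * Ry := by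
      calc Rx * s * Rx = Rx * (s * Rx) := by noncomm_ring
        _ = Rx * (Ry * s - Ry * Rx) := by rw [f2]; noncomm_ring
        _ = (Rx * Ry) * s - Rx * (Ry * Rx) := by noncomm_ring
        _ = Ry * (Rx * s) - Rx * (Ry * Rx) := by rw [hc]; noncomm_ring
        _ = Ry * (s * Ry - Rx * Ry) - Rx * (Ry * Rx) := by rw [f1]; noncomm_ring
        _ = Ry * s * Ry - (Ry * Rx) * Ry - Rx * (Ry * Rx) := by noncomm_ring
        _ = _ := by rw [← hc]; noncomm_ring
    calc s * Ry * s = Rx * (s * s) + Rx * (Ry * s) := by rw [f1]; noncomm_ring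
      _ = Rx + Rx * s * Rx + Rx * (Ry * Rx) := by rw [hs, f2]; noncomm_ring
      _ = _ := by rw [g, ← hc]; noncomm_ring

theorem inv_comm {B C R : A} (h1 : R * B = 1) (h2 : B * R = 1) (h : Commute C B) :
    Commute C R := by
  have := h.eq
  calc C * R = (R * B) * C * R := by rw [h1, one_mul]
    _ = R * (C * B) * R := by rw [this]; noncomm_ring
    _ = R * C * (B * R) := by noncomm_ring
    _ = R * C := by rw [h2, mul_one]
theorem conj_lemma {t : A} (hca : t * Ry = Ry * t) (hsa : t * t = 1)
    (h : s * Ry * s = Rx + Ry * s * Ry - Rx * Ry * Ry) :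
    t * s * t * Ry * (t * s * t) = t * Rx * t + Ry * (t * s * t) * Ry - t * Rx * t * Ry * Ry := by
  have a1 : t * Ry * s * Ry * t = Ry * (t * s * t) * Ry := by
    calc t * Ry * s * Ry * t = (t * Ry) * s * (Ry * t) := by noncomm_ring
      _ = (Ry * t) * s * (t * Ry) := by rw [hca]
      _ = _ := by noncomm_ring
  have a2 : t * Rx * Ry * Ry * t = t * Rx * t * Ry * Ry := by
    rw [mul_assoc _ Ry t, ← hca, ← mul_assoc, mul_assoc _ Ry t, ← hca]; noncomm_ring
  calc t * s * t * Ry * (t * s * t) = t * s * (t * Ry) * t * s * t := by noncomm_ring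
    _ = t * (s * Ry * (t * t) * s) * t := by rw [hca]; noncomm_ring
    _ = t * (s * Ry * s) * t := by rw [hsa, mul_one]
    _ = t * Rx * t + t * Ry * s * Ry * t - t * Rx * Ry * Ry * t := by rw [h]; noncomm_ring
    _ = _ := by rw [a1, a2]
end ring

/-- Resolvent of the Jucys-Murphy element. -/
noncomputable def Res (d n : ℕ) (u : ℝ) : H d (n + 1) := (algebraMap ℝ (H d (n + 1)) u - X d n)⁻¹

theorem one_sub_tr (a : Fin (n + 1)) : (1 - pm (tr a) : H d (n + 1)).PosSemidef := by
  have h : (1 - pm (tr a) : H d (n + 1)) =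
      (1/2 : ℝ) • ((1 - pm (tr a) : H d (n + 1))ᴴ * (1 - pm (tr a) : H d (n + 1))) := by
    rw [conjTranspose_sub, tr_star, conjTranspose_one]
    have : (1 - pm (tr a) : H d (n + 1)) * (1 - pm (tr a) : H d (n + 1)) =
      (2 : ℝ) • (1 - pm (tr a) : H d (n + 1)) := by
      rw [mul_sub, sub_mul, sub_mul, tr_sq, two_smul]; noncomm_ring
    rw [this, smul_smul]; norm_num
  rw [h]
  exact (posSemidef_conjTranspose_mul_self _).smul (by norm_num)

theorem isUnit_sub_X {u : ℝ} (hu : (n : ℝ) < u) :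
    IsUnit (algebraMap ℝ (H d (n + 1)) u - X d n) := by
  have : algebraMap ℝ (H d (n + 1)) u - X d n =
      (u - n) • (1 : H d (n + 1)) + ∑ i : Fin n, (1 - pm (tr i.castSucc)) := by
    rw [Finset.sum_sub_distrib, sub_smul, Algebra.algebraMap_eq_smul_one, X]
    simp [Nat.cast_smul_eq_nsmul]
  rw [this]
  apply PosDef.isUnit
  apply PosDef.add_posSemidef
  · exact PosDef.one.smul (sub_pos.2 hu)
  · exact posSemidef_sum _ fun i _ => one_sub_tr _

theorem Res_mul {u : ℝ} (hu : (n : ℝ) < u) :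
    Res d n u * (algebraMap ℝ (H d (n + 1)) u - X d n) = 1 :=
  nonsing_inv_mul _ ((isUnit_iff_isUnit_det _).1 (isUnit_sub_X hu))

theorem mul_Res {u : ℝ} (hu : (n : ℝ) < u) :
    (algebraMap ℝ (H d (n + 1)) u - X d n) * Res d n u = 1 :=
  mul_nonsing_inv _ ((isUnit_iff_isUnit_det _).1 (isUnit_sub_X hu))

theorem Res_comm {u : ℝ} (hu : (n : ℝ) < u) {B : H d (n + 1)} (h : Commute B (X d n)) :
    Commute B (Res d n u) :=
  inv_comm (Res_mul hu) (mul_Res hu) (Commute.sub_right (Algebra.commutes u B).symm h)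

theorem Res_zero {u : ℝ} (hu : 0 < u) : Res d 0 u = u⁻¹ • 1 := by
  have h := mul_Res (d := d) (n := 0) (u := u) (by simpa using hu)
  simp only [X, Finset.univ_eq_empty, Finset.sum_empty, sub_zero] at h
  rw [← Algebra.smul_def] at h
  rw [← h, smul_smul, inv_mul_cancel₀ hu.ne', one_smul]

theorem X_comm_X : Commute (io d (n + 1) (X d n)) (X d (n + 1)) := by
  rw [X.eq_1 d n, map_sum]
  exact Commute.sum_left _ _ _ fun i _ => (X_comm _).symm

theorem key {u : ℝ} (hu : ((n + 1 : ℕ) : ℝ) < u) :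
    let s : H d (n + 2) := pm (tr (Fin.last n).castSucc)
    let Rx := io d (n + 1) (Res d n u)
    let Ry := Res d (n + 1) u
    Ry = s * Rx * s + Rx * s * Rx + Rx * Rx * Ry ∧
    s * Ry * s = Rx + Ry * s * Ry - Rx * Ry * Ry := by
  intro s Rx Ry
  have hu' : (n : ℝ) < u := by push_cast at hu; linarith
  have h1 : Rx * (algebraMap ℝ (H d (n + 2)) u - io d (n + 1) (X d n)) = 1 := by
    rw [← AlgHom.commutes (io d (n + 1)) u, ← map_sub, ← map_mul, Res_mul hu', map_one]
  have h2 : (algebraMap ℝ (H d (n + 2)) u - io d (n + 1) (X d n)) * Rx = 1 := by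
    rw [← AlgHom.commutes (io d (n + 1)) u, ← map_sub, ← map_mul, mul_Res hu', map_one]
  refine ring_lemma (tr_sq _) X_succ (Algebra.commutes u s) X_comm_X h1 h2 (Res_mul hu)
    (mul_Res hu) ?_
  apply Res_comm hu
  refine (inv_comm h1 h2 ?_).symm
  exact Commute.sub_right (Algebra.commutes u _).symm X_comm_X.symm

noncomputable def psi (d n : ℕ) (u : ℝ) : H d n := pt d n (Res d n u)

noncomputable def avg (d n : ℕ) : H d (n + 1) →ₗ[ℝ] H d (n + 1) where
  toFun A := ∑ a : Fin (n + 1), pm (tr a) * A * pm (tr a)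
  map_add' A B := by simp [mul_add, add_mul, Finset.sum_add_distrib]
  map_smul' r A := by simp [Finset.smul_sum]

theorem avg_apply (A : H d (n + 1)) : avg d n A = ∑ a : Fin (n + 1), pm (tr a) * A * pm (tr a) :=
  rfl

theorem psi_zero {u : ℝ} (hu : 0 < u) : psi d 0 u = (d / u) • 1 := by
  rw [psi, Res_zero hu, map_smul, pt_one, smul_smul, mul_comm]; rfl

theorem psi_succ {u : ℝ} (hu : ((n + 1 : ℕ) : ℝ) < u) :
    (1 - Res d n u * Res d n u) * (1 + psi d (n + 1) u) = io d n (1 + psi d n u) := by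
  have h := (key (d := d) hu).1
  have h' := congrArg (pt d (n + 1)) h
  rw [map_add, map_add, pt_conj, pt_mul_io, pt_io_mul, pt_swap, mul_one, ← map_mul,
    pt_io_mul] at h'
  change psi d (n + 1) u = io d n (psi d n u) + _ + _ * psi d (n + 1) u at h'
  rw [map_add, map_one]
  generalize io d n (psi d n u) = a at *
  generalize psi d (n + 1) u = b at *
  calc _ = 1 + b - Res d n u * Res d n u - Res d n u * Res d n u * b := by noncomm_ring
    _ = _ := by nth_rewrite 1 [h']; abel

theorem psi_comm {u : ℝ} (hu : (n : ℝ) < u) (σ : Equiv.Perm (Fin n)) :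
    Commute (psi d n u) (pm σ) := by
  have h := Res_comm hu (X_comm (d := d) σ).symm
  rw [Commute, SemiconjBy, psi, ← pt_io_mul, ← pt_mul_io, h.eq]

noncomputable def theta (d n : ℕ) (u : ℝ) : H d (n + 1) := avg d n (Res d n u)

theorem theta_zero {u : ℝ} (hu : 0 < u) : theta d 0 u = u⁻¹ • 1 := by
  rw [theta, Res_zero hu, map_smul, avg_apply]
  simp [tr_sq]

theorem avg_succ (A : H d (n + 2)) : avg d (n + 1) A = A +
    ∑ a : Fin (n + 1), pm (tr a.castSucc) * A * pm (tr a.castSucc) := by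
  rw [avg_apply, Fin.sum_univ_castSucc]
  refine (add_comm _ _).trans ?_
  congr 1
  have : tr (Fin.last (n + 1)) = 1 := by simp [tr]; rfl
  rw [this, pm_one, one_mul, mul_one]

theorem theta_succ {u : ℝ} (hu : ((n + 1 : ℕ) : ℝ) < u) :
    u • 1 - theta d (n + 1) u =
      io d (n + 1) (u • 1 - theta d n u) * (1 - Res d (n + 1) u * Res d (n + 1) u) := by
  have h := (key (d := d) hu).2
  set Ry := Res d (n + 1) u
  set Rx := io d (n + 1) (Res d n u) with hRx
  set s : H d (n + 2) := pm (tr (Fin.last n).castSucc)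
  have hc : ∀ a : Fin (n + 1), Commute (io d (n + 1) (pm (tr a))) Ry :=
    fun a => Res_comm hu (X_comm _).symm
  have hsq : ∀ a : Fin (n + 1), io d (n + 1) (pm (tr a)) * io d (n + 1) (pm (tr a)) = 1 := by
    intro a; rw [← map_mul, tr_sq, map_one]
  have e : theta d (n + 1) u = Ry + (io d (n + 1) (theta d n u) + Ry * X d (n + 1) * Ry -
      io d (n + 1) (theta d n u) * Ry * Ry) := by
    rw [theta, avg_succ]
    congr 1
    have : ∀ a : Fin (n + 1), pm (tr a.castSucc) * Ry * pm (tr a.castSucc) =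
       (io d (n + 1) (pm (tr a) * Res d n u * pm (tr a)))
       + Ry * (io d (n + 1) (pm (tr a)) * s * io d (n + 1) (pm (tr a))) * Ry
       - (io d (n + 1) (pm (tr a) * Res d n u * pm (tr a))) * Ry * Ry := by
      intro a
      rw [← conj_s a]
      rw [map_mul, map_mul, ← hRx]
      have hca := (hc a).eq
      have hsa := hsq a
      generalize io d (n + 1) (pm (tr a)) = t at hca hsa ⊢
      exact conj_lemma hca hsa h
    rw [Finset.sum_congr rfl fun a _ => this a, Finset.sum_sub_distrib, Finset.sum_add_distrib,
      ← Finset.sum_mul, ← Finset.sum_mul, ← Finset.sum_mul, ← Finset.mul_sum, sum_conj_s,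
      ← map_sum]
    rfl
  have hy : Ry + Ry * X d (n + 1) * Ry = u • (Ry * Ry) := by
    have h1 := mul_Res (d := d) hu
    have : X d (n + 1) * Ry = u • Ry - 1 := by
      rw [← h1, sub_mul, ← Algebra.smul_def]; abel
    rw [mul_assoc, this, mul_sub, mul_one, mul_smul_comm]; abel
  rw [e, map_sub, map_smul, map_one]
  generalize io d (n + 1) (theta d n u) = T at *
  rw [show Ry + (T + Ry * X d (n + 1) * Ry - T * Ry * Ry) = (Ry + Ry * X d (n + 1) * Ry) +
    T - T * Ry * Ry by abel, hy]
  rw [sub_mul, mul_sub, mul_sub, mul_one, mul_one, smul_mul_assoc, one_mul, mul_assoc]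
  abel

theorem theta_psi {u : ℝ} (hu : ((n + 1 : ℕ) : ℝ) < u) :
    (u • 1 - theta d n u) * (1 + psi d (n + 1) u) = (u + d) • 1 := by
  induction n with
  | zero =>
    have hu0 : 0 < u := by push_cast at hu; linarith
    have h := psi_succ (d := d) hu
    rw [Res_zero hu0, psi_zero hu0] at h
    rw [theta_zero hu0]
    have : (u • 1 - u⁻¹ • 1 : H d (0 + 1)) = u • (1 - u⁻¹ • 1 * u⁻¹ • 1) := by
      rw [smul_sub, smul_mul_smul_comm, smul_smul, mul_one]
      congr 2; field_simp
    rw [this, smul_mul_assoc, h, map_add, map_smul, map_one, smul_add, smul_smul,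
      mul_div_cancel₀ _ hu0.ne', add_smul]
  | succ n ih =>
    have hu' : ((n + 1 : ℕ) : ℝ) < u := by push_cast at hu ⊢; linarith
    rw [theta_succ hu', mul_assoc, psi_succ hu, ← map_mul, ih hu', map_smul, map_one]

end PBT

open scoped ComplexOrder

namespace PBT
open Matrix Finset

theorem isUnit_aeval_nodal {A : Type*} [Ring A] [Algebra ℝ A] {ι : Type*} (s : Finset ι) (c : ι → ℝ)
    (x : A) (h : ∀ i ∈ s, IsUnit (algebraMap ℝ A (c i) - x)) :
    IsUnit (Polynomial.aeval x (Lagrange.nodal s c)) := by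
  classical
  induction s using Finset.induction_on with
  | empty => simp
  | insert a s ha ih =>
    rw [Lagrange.nodal_insert_eq_nodal ha, map_mul]
    refine IsUnit.mul ?_ (ih fun i hi => h i (Finset.mem_insert_of_mem hi))
    have := (h a (Finset.mem_insert_self _ _)).neg
    simpa using this

theorem pf (g f : Polynomial ℝ) (hg : g.Monic) (B : ℝ) :
    ∃ (m : ℕ) (c : Fin m → ℝ) (k : Fin m → ℝ), (∀ i, B < c i) ∧
      ∀ (A : Type) [Ring A] [Algebra ℝ A] (x : A) (r : Fin m → A), Polynomial.aeval x g = 0 →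
        (∀ i, (algebraMap ℝ A (c i) - x) * r i = 1) →
        (∀ i, r i * (algebraMap ℝ A (c i) - x) = 1) →
        Polynomial.aeval x f = ∑ i, k i • r i := by
  classical
  set m := g.natDegree
  let c : Fin m → ℝ := fun i => B + 1 + (i : ℕ)
  have hc : Set.InjOn c ((Finset.univ : Finset (Fin m)) : Set (Fin m)) := by
    intro i _ j _ h
    simp only [c, add_right_inj, Nat.cast_inj] at h
    exact Fin.ext h
  let e := Lagrange.nodal Finset.univ c
  let p := (f * e) %ₘ g
  have hp : p.degree < (Finset.univ : Finset (Fin m)).card := by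
    rw [Finset.card_fin]
    refine lt_of_lt_of_eq (Polynomial.degree_modByMonic_lt _ hg) ?_
    exact Polynomial.degree_eq_natDegree hg.ne_zero
  have hinterp := Lagrange.eq_interpolate hc hp
  refine ⟨m, c, fun i => - (p.eval (c i) * Lagrange.nodalWeight Finset.univ c i), ?_, ?_⟩
  · intro i
    have : (0 : ℝ) ≤ (i : ℕ) := Nat.cast_nonneg _
    simp only [c]; linarith
  intro A _ _ x r hx h1 h2
  have hu : IsUnit (Polynomial.aeval x e) :=
    isUnit_aeval_nodal _ _ _ fun i _ => ⟨⟨_, r i, h1 i, h2 i⟩, rfl⟩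
  refine hu.mul_right_cancel ?_
  have hpx : Polynomial.aeval x p = Polynomial.aeval x f * Polynomial.aeval x e := by
    have := Polynomial.modByMonic_add_div (f * e) g
    have h' := congrArg (Polynomial.aeval x) this
    rw [map_add, map_mul, hx, zero_mul, add_zero, map_mul] at h'
    exact h'
  have hint2 : Polynomial.aeval x p = ∑ i, Polynomial.aeval x
      (Polynomial.C (p.eval (c i)) * Lagrange.basis Finset.univ c i) := by
    conv_lhs => rw [hinterp, Lagrange.interpolate_apply, map_sum]
  rw [← hpx, hint2, Finset.sum_mul]
  refine Finset.sum_congr rfl fun i _ => ?_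
  have hb : (Polynomial.X - Polynomial.C (c i)) * Lagrange.basis Finset.univ c i =
      Polynomial.C (Lagrange.nodalWeight Finset.univ c i) * e := by
    have hne : Polynomial.X - Polynomial.C (c i) ≠ 0 := Polynomial.X_sub_C_ne_zero _
    rw [Lagrange.basis_eq_prod_sub_inv_mul_nodal_div (Finset.mem_univ i),
      ← Lagrange.nodal_erase_eq_nodal_div (Finset.mem_univ i), mul_left_comm,
      ← Lagrange.nodal_eq_mul_nodal_erase (Finset.mem_univ i)]
  have hb' := congrArg (Polynomial.aeval x) hb
  rw [map_mul, map_mul, map_sub, Polynomial.aeval_X, Polynomial.aeval_C, Polynomial.aeval_C] at hb'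
  have hb2 : Polynomial.aeval x (Lagrange.basis Finset.univ c i) =
      - (Lagrange.nodalWeight Finset.univ c i • (r i * Polynomial.aeval x e)) := by
    rw [← mul_smul_comm, Algebra.smul_def, ← hb', ← mul_assoc, ← neg_sub, mul_neg, h2 i]
    simp
  rw [map_mul, Polynomial.aeval_C, ← Algebra.smul_def, hb2, neg_smul, smul_neg, smul_smul,
    neg_mul, smul_mul_assoc]

theorem transfer {E A : Type} [AddCommGroup E] [Module ℝ E] [Ring A] [Algebra ℝ A] (x : A)
    (hx : IsIntegral ℝ x) (R : ℝ → A) (B : ℝ)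
    (hR1 : ∀ u, B < u → (algebraMap ℝ A u - x) * R u = 1)
    (hR2 : ∀ u, B < u → R u * (algebraMap ℝ A u - x) = 1)
    (L : A →ₗ[ℝ] E) {ι : Type} [Fintype ι] (h : ι → ℝ) (m : ι → E) (hh : ∀ i, h i ≤ B)
    (hL : ∀ u, B < u → L (R u) = ∑ i, (u - h i)⁻¹ • m i) (f : Polynomial ℝ) :
    L (Polynomial.aeval x f) = ∑ i, f.eval (h i) • m i := by
  classical
  obtain ⟨g0, hg0, hx0⟩ := hx
  obtain ⟨N, c, k, hc, H⟩ := pf (g0 * Lagrange.nodal Finset.univ h) f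
    (hg0.mul (Lagrange.nodal_monic)) B
  have e1 := H A x (fun i => R (c i)) (by
    rw [map_mul]
    have : Polynomial.aeval x g0 = 0 := hx0
    rw [this, zero_mul]) (fun i => hR1 _ (hc i)) (fun i => hR2 _ (hc i))
  have hne : ∀ i j, c i - h j ≠ 0 := fun i j => by have := hc i; have := hh j; linarith
  have e2 : ∀ j, f.eval (h j) = ∑ i, k i * (c i - h j)⁻¹ := by
    intro j
    have := H ℝ (h j) (fun i => (c i - h j)⁻¹) (by
      rw [map_mul]
      have : Polynomial.aeval (h j) (Lagrange.nodal Finset.univ h) = 0 := by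
        simpa using Lagrange.eval_nodal_at_node (v := h) (Finset.mem_univ j)
      rw [this, mul_zero]) (fun i => mul_inv_cancel₀ (hne i j)) (fun i => inv_mul_cancel₀ (hne i j))
    simpa using this
  rw [e1, map_sum]
  simp only [map_smul, e2, Finset.sum_smul]
  rw [Finset.sum_comm]
  refine Finset.sum_congr rfl fun i _ => ?_
  rw [hL _ (hc i), Finset.smul_sum]
  simp only [smul_smul]

section scalar
variable {ι : Type*} [DecidableEq ι]

/-- residues -/
noncomputable def rsd (c : ℝ) (a : ι → ℝ) (s : Finset ι) (i : ι) : ℝ :=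
  ∏ j ∈ s.erase i, (1 + c * (a i - a j)⁻¹)

theorem rsd_insert (c : ℝ) (a : ι → ℝ) {s : Finset ι} {i k : ι} (hk : k ∉ s) (hi : i ∈ s) :
    rsd c a (insert k s) i = rsd c a s i * (1 + c * (a i - a k)⁻¹) := by
  have hne : k ≠ i := fun h => hk (h ▸ hi)
  rw [rsd, Finset.erase_insert_of_ne hne, Finset.prod_insert (by simp [hk]), mul_comm, rsd]

theorem rsd_insert_self (c : ℝ) (a : ι → ℝ) {s : Finset ι} {k : ι} (hk : k ∉ s) :
    rsd c a (insert k s) k = ∏ j ∈ s, (1 + c * (a k - a j)⁻¹) := by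
  rw [rsd, Finset.erase_insert hk]

theorem partial_fractions (c : ℝ) (a : ι → ℝ) (ha : Function.Injective a) (s : Finset ι) (u : ℝ)
    (hu : ∀ i ∈ s, u ≠ a i) :
    ∏ i ∈ s, (1 + c * (u - a i)⁻¹) = 1 + c * ∑ i ∈ s, rsd c a s i * (u - a i)⁻¹ := by
  induction s using Finset.induction_on generalizing u with
  | empty => simp
  | insert k s hk ih =>
    have hs : ∀ i ∈ s, a k ≠ a i := fun i hi h => hk (ha h ▸ hi)
    rw [Finset.prod_insert hk, ih u fun i hi => hu i (Finset.mem_insert_of_mem hi),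
      Finset.sum_insert hk, rsd_insert_self c a hk, ih (a k) hs]
    have hsum : ∑ i ∈ s, rsd c a (insert k s) i * (u - a i)⁻¹ =
        ∑ i ∈ s, rsd c a s i * (1 + c * (a i - a k)⁻¹) * (u - a i)⁻¹ :=
      Finset.sum_congr rfl fun i hi => by rw [rsd_insert c a hk hi]
    rw [hsum]
    have huk : u - a k ≠ 0 := sub_ne_zero.2 (hu k (Finset.mem_insert_self _ _))
    have : ∑ i ∈ s, rsd c a s i * (1 + c * (a i - a k)⁻¹) * (u - a i)⁻¹ =
        (1 + c * (u - a k)⁻¹) * (∑ i ∈ s, rsd c a s i * (u - a i)⁻¹) -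
        c * (u - a k)⁻¹ * (∑ i ∈ s, rsd c a s i * (a k - a i)⁻¹) := by
      rw [Finset.mul_sum, Finset.mul_sum, ← Finset.sum_sub_distrib]
      refine Finset.sum_congr rfl fun i hi => ?_
      have h1 : u - a i ≠ 0 := sub_ne_zero.2 (hu i (Finset.mem_insert_of_mem hi))
      have h2 : a k - a i ≠ 0 := sub_ne_zero.2 (hs i hi)
      have h3 : a i - a k ≠ 0 := sub_ne_zero.2 (hs i hi).symm
      have e3 : (a i - a k)⁻¹ = - (a k - a i)⁻¹ := by rw [← neg_sub, neg_inv]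
      have : (u - a i)⁻¹ * (a k - a i)⁻¹ + (u - a k)⁻¹ * (u - a i)⁻¹
          = (u - a k)⁻¹ * (a k - a i)⁻¹ := by
        field_simp; ring
      rw [e3]
      linear_combination (- c * rsd c a s i) * this
    rw [this]
    ring

theorem sum_rsd (c : ℝ) (a : ι → ℝ) (ha : Function.Injective a) (s : Finset ι) :
    ∑ i ∈ s, rsd c a s i = s.card := by
  induction s using Finset.induction_on with
  | empty => simp
  | insert k s hk ih =>
    have hs : ∀ i ∈ s, a k ≠ a i := fun i hi h => hk (ha h ▸ hi)
    rw [Finset.sum_insert hk, rsd_insert_self c a hk, partial_fractions c a ha s (a k) hs,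
      Finset.card_insert_of_notMem hk]
    have hsum : ∑ i ∈ s, rsd c a (insert k s) i =
        ∑ i ∈ s, rsd c a s i * (1 + c * (a i - a k)⁻¹) :=
      Finset.sum_congr rfl fun i hi => by rw [rsd_insert c a hk hi]
    rw [hsum]
    simp only [mul_add, Finset.sum_add_distrib, mul_one, ih]
    have : ∑ i ∈ s, rsd c a s i * (c * (a i - a k)⁻¹) =
      - (c * ∑ i ∈ s, rsd c a s i * (a k - a i)⁻¹) := by
      rw [Finset.mul_sum, ← Finset.sum_neg_distrib]
      refine Finset.sum_congr rfl fun i hi => ?_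
      have e3 : (a i - a k)⁻¹ = - (a k - a i)⁻¹ := by rw [← neg_sub, neg_inv]
      rw [e3]; ring
    rw [this]; push_cast; ring

theorem theta_fractions (a : ι → ℝ) (ha : Function.Injective a) (s : Finset ι) (u : ℝ)
    (hu : ∀ i ∈ s, u ≠ a i) :
    u - (u + s.card) * ∏ i ∈ s, (1 + (-1) * (u - a i)⁻¹) =
      ∑ i ∈ s, (a i + s.card) * rsd (-1) a s i * (u - a i)⁻¹ := by
  rw [partial_fractions (-1) a ha s u hu]
  have h : (u + s.card) * ∑ i ∈ s, rsd (-1) a s i * (u - a i)⁻¹ =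
      ∑ i ∈ s, (a i + s.card) * rsd (-1) a s i * (u - a i)⁻¹ + s.card := by
    rw [← sum_rsd (-1) a ha s, ← Finset.sum_add_distrib, Finset.mul_sum]
    refine Finset.sum_congr rfl fun i hi => ?_
    have h1 : u - a i ≠ 0 := sub_ne_zero.2 (hu i hi)
    have : (u - a i) * (u - a i)⁻¹ = 1 := mul_inv_cancel₀ h1
    linear_combination rsd (-1) a s i * this
  linear_combination h
end scalar

variable {d : ℕ}

/-- shifted row lengths -/
def hh (w : Fin d → ℕ) (i : Fin d) : ℝ := (w i : ℝ) - (i : ℕ)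

theorem hh_strictAnti {w : Fin d → ℕ} (hw : Antitone w) : StrictAnti (hh w) := by
  intro i j hij
  have h1 : (w j : ℝ) ≤ w i := by exact_mod_cast hw hij.le
  have h2 : ((i : ℕ) : ℝ) < (j : ℕ) := by exact_mod_cast hij
  simp only [hh]; linarith

theorem hh_inj {w : Fin d → ℕ} (hw : Antitone w) : Function.Injective (hh w) :=
  (hh_strictAnti hw).injective

/-- `1 + ψ_w(u)` -/
noncomputable def Ps (w : Fin d → ℕ) (u : ℝ) : ℝ := ∏ i, (1 + 1 * (u - hh w i)⁻¹)

theorem hh_single_ne (w : Fin d → ℕ) {i j : Fin d} (h : j ≠ i) :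
    hh (w + Pi.single i 1) j = hh w j := by
  simp [hh, h]

theorem hh_single (w : Fin d → ℕ) (i : Fin d) :
    hh (w + Pi.single i 1) i = hh w i + 1 := by
  simp [hh]; ring

theorem Ps_step (w : Fin d → ℕ) (i : Fin d) (u : ℝ) (hu : hh w i + 1 < u) :
    (1 - (u - hh w i)⁻¹ * (u - hh w i)⁻¹) * Ps (w + Pi.single i 1) u = Ps w u := by
  rw [Ps, Ps, ← Finset.mul_prod_erase _ _ (Finset.mem_univ i),
    ← Finset.mul_prod_erase (a := i) (h := Finset.mem_univ i), hh_single, ← mul_assoc]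
  congr 1
  · have h1 : u - hh w i ≠ 0 := by linarith
    have h2 : u - (hh w i + 1) ≠ 0 := by linarith
    field_simp
    ring
  · refine Finset.prod_congr rfl fun j hj => ?_
    rw [hh_single_ne w (Finset.ne_of_mem_erase hj)]

theorem Ps_sep {w w' : Fin d → ℕ} (hw : Antitone w) (hw' : Antitone w') (B : ℝ)
    (hB : ∀ i, hh w i ≤ B) (hB' : ∀ i, hh w' i ≤ B) (h : ∀ u, B < u → Ps w u = Ps w' u) :
    w = w' := by
  let p (w : Fin d → ℕ) : Polynomial ℝ := Lagrange.nodal Finset.univ (hh w)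
  have hpm : ∀ w, (p w).Monic := fun w => Lagrange.nodal_monic
  have hev : ∀ w u, (p w).eval u = ∏ i, (u - hh w i) := fun w u => Lagrange.eval_nodal
  have hpos : ∀ w : Fin d → ℕ, (∀ i, hh w i ≤ B) → ∀ u, B < u → 0 < (p w).eval u := by
    intro w hB u hu
    rw [hev]
    exact Finset.prod_pos fun i _ => by have := hB i; linarith
  have hPs : ∀ w : Fin d → ℕ, (∀ i, hh w i ≤ B) → ∀ u, B < u →
      (p w).eval (u + 1) = Ps w u * (p w).eval u := by
    intro w hB u hu
    rw [hev, hev, Ps, ← Finset.prod_mul_distrib]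
    refine Finset.prod_congr rfl fun i _ => ?_
    have : u - hh w i ≠ 0 := by have := hB i; linarith
    field_simp; ring
  let q : ℝ → ℝ := fun u => (p w).eval u / (p w').eval u
  have hq1 : ∀ u, B < u → q (u + 1) = q u := by
    intro u hu
    have a1 := hPs w hB u hu
    have a2 := hPs w' hB' u hu
    have a3 := hpos w' hB' u hu
    have a4 := hpos w' hB' (u + 1) (by linarith)
    simp only [q]
    rw [div_eq_div_iff a4.ne' a3.ne', a1, a2, h u hu]; ring
  have hqk : ∀ (k : ℕ) u, B < u → q (u + k) = q u := by
    intro k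
    induction k with
    | zero => intro u _; simp
    | succ k ih =>
      intro u hu
      rw [Nat.cast_succ, ← add_assoc, hq1 _ (by have : (0:ℝ) ≤ k := k.cast_nonneg; linarith), ih u hu]
  have hlim : Filter.Tendsto q Filter.atTop (nhds 1) := by
    have hdeg : (p w).degree = (p w').degree := by
      simp only [p, Lagrange.degree_nodal]
    have := Polynomial.div_tendsto_atTop_leadingCoeff_div_of_degree_eq (p w) (p w') hdeg
    rwa [(hpm w).leadingCoeff, (hpm w').leadingCoeff, div_one] at this
  have hq : ∀ u, B < u → q u = 1 := by
    intro u hu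
    have t1 : Filter.Tendsto (fun k : ℕ => u + (k : ℝ)) Filter.atTop Filter.atTop :=
      Filter.tendsto_atTop_add_const_left _ _ tendsto_natCast_atTop_atTop
    have t2 := hlim.comp t1
    have t3 : (q ∘ fun k : ℕ => u + (k : ℝ)) = fun _ => q u := by
      funext k; exact hqk k u hu
    rw [t3] at t2
    exact tendsto_nhds_unique tendsto_const_nhds t2
  have hpp : p w = p w' := by
    refine Polynomial.eq_of_infinite_eval_eq _ _ ((Set.Ioi_infinite B).mono ?_)
    intro u hu
    have := hq u hu
    simp only [q] at this
    exact (div_eq_one_iff_eq (hpos w' hB' u hu).ne').1 this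
  have hr : ∀ w : Fin d → ℕ, Set.range (fun i => - hh w i) = {x | (p w).eval (-x) = 0} := by
    intro w
    ext x
    simp only [Set.mem_range, Set.mem_ofPred_eq, hev, Finset.prod_eq_zero_iff, Finset.mem_univ,
      true_and]
    constructor
    · rintro ⟨i, rfl⟩; exact ⟨i, by ring⟩
    · rintro ⟨i, hi⟩; exact ⟨i, by linarith⟩
  have hm : ∀ w : Fin d → ℕ, Antitone w → StrictMono (fun i => - hh w i) := by
    intro w hw i j hij
    exact neg_lt_neg (hh_strictAnti hw hij)
  have := (StrictMono.range_inj (hm w hw) (hm w' hw')).1 (by rw [hr, hr, hpp])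
  funext i
  have hi := congrFun this i
  simp only [hh, neg_inj, sub_left_inj, Nat.cast_inj] at hi
  exact hi

/-- The residues `y`. -/
noncomputable def yy (w : Fin d → ℕ) (i : Fin d) : ℝ := rsd 1 (hh w) Finset.univ i

/-- The residues `z`. -/
noncomputable def zz (w : Fin d → ℕ) (i : Fin d) : ℝ :=
  (hh w i - 1 + d) * rsd (-1) (fun j => hh w j - 1) Finset.univ i

theorem yy_mul_zz {w : Fin d → ℕ} {i : Fin d} (hw : Antitone w)
    (hw' : Antitone (w + Pi.single i 1)) :
    yy w i * zz (w + Pi.single i 1) i = hh w i + d := by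
  rw [yy, zz, mul_left_comm, rsd, rsd, ← Finset.prod_mul_distrib, hh_single]
  rw [Finset.prod_eq_one, mul_one]
  · ring
  intro j hj
  have hne := Finset.ne_of_mem_erase hj
  rw [hh_single_ne w hne]
  have h1 : hh w i - hh w j ≠ 0 := sub_ne_zero.2 fun h => hne (hh_inj hw h).symm
  have h2 : hh w i + 1 - hh w j ≠ 0 := sub_ne_zero.2 fun h => by
    rw [← hh_single, ← hh_single_ne w hne] at h
    exact hne (hh_inj hw' h).symm
  have h3 : hh w i + 1 - 1 - (hh w j - 1) ≠ 0 := by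
    intro h; apply h2; linarith
  field_simp
  ring

theorem yy_ne_zero {w : Fin d → ℕ} {i : Fin d} (hw : Antitone w)
    (hw' : Antitone (w + Pi.single i 1)) : yy w i ≠ 0 := by
  rw [yy, rsd, Finset.prod_ne_zero_iff]
  intro j hj
  have hne := Finset.ne_of_mem_erase hj
  have h1 : hh w i - hh w j ≠ 0 := sub_ne_zero.2 fun h => hne (hh_inj hw h).symm
  have h2 : hh w i + 1 - hh w j ≠ 0 := sub_ne_zero.2 fun h => by
    rw [← hh_single, ← hh_single_ne w hne] at h
    exact hne (hh_inj hw' h).symm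
  intro h
  field_simp at h
  apply h2; linarith

theorem yy_eq_zero {w : Fin d → ℕ} {i : Fin d} (hw : Antitone w)
    (hw' : ¬ Antitone (w + Pi.single i 1)) : yy w i = 0 := by
  have : ∃ j : Fin d, j < i ∧ w j = w i ∧ (i : ℕ) = j + 1 := by
    by_contra hcon
    push Not at hcon
    apply hw'
    intro a b hab
    by_cases hb : b = i
    · subst hb
      rcases eq_or_lt_of_le hab with rfl | hlt
      · exact le_rfl
      · have hb0 : 0 < (b : ℕ) := lt_of_le_of_lt (Nat.zero_le _) hlt
        let j : Fin d := ⟨b - 1, by omega⟩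
        have hj : j < b := by show (b : ℕ) - 1 < b; omega
        have h1 := hcon j hj
        have h2 : w b < w j := lt_of_le_of_ne (hw hj.le) (fun h => h1 h.symm (by simp [j]; omega))
        have h3 : a ≤ j := by
          show (a : ℕ) ≤ b - 1
          have : (a : ℕ) < b := hlt
          omega
        have h4 := hw h3
        simp [hlt.ne]
        omega
    · have := hw hab
      simp only [Pi.add_apply, Pi.single_eq_of_ne hb]
      omega
  obtain ⟨j, hj, hwj, hij⟩ := this
  rw [yy, rsd, Finset.prod_eq_zero_iff]
  refine ⟨j, by simp [hj.ne], ?_⟩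
  have : hh w i - hh w j = -1 := by
    simp only [hh, hwj, hij]; push_cast; ring
  rw [this]; norm_num

theorem r_pos (w : Fin d → ℕ) (i : Fin d) : 0 < hh w i + d := by
  have h1 : (0 : ℝ) ≤ w i := Nat.cast_nonneg _
  have h2 : ((i : ℕ) : ℝ) < d := by exact_mod_cast i.2
  simp only [hh]; linarith

end PBT

open scoped ComplexOrder

namespace PBT
open Matrix Finset

variable {d n : ℕ}

open scoped Classical in
/-- Partitions of `n` with at most `d` parts, as antitone functions. -/
noncomputable def Sn (d n : ℕ) : Finset (Fin d → ℕ) :=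
  (Finset.piAntidiag Finset.univ n).filter Antitone

theorem mem_Sn {w : Fin d → ℕ} : w ∈ Sn d n ↔ Antitone w ∧ ∑ i, w i = n := by
  simp [Sn, and_comm]

theorem hh_le {w : Fin d → ℕ} (hw : w ∈ Sn d n) (i : Fin d) : hh w i ≤ n := by
  have h1 : w i ≤ ∑ j, w j := Finset.single_le_sum (fun _ _ => Nat.zero_le _) (Finset.mem_univ i)
  rw [(mem_Sn.1 hw).2] at h1
  have h2 : (w i : ℝ) ≤ n := by exact_mod_cast h1
  have h3 : (0 : ℝ) ≤ (i : ℕ) := Nat.cast_nonneg _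
  simp only [hh]; linarith

theorem add_single_mem {w : Fin d → ℕ} (hw : w ∈ Sn d n) (i : Fin d) :
    w + Pi.single i 1 ∈ Sn d (n + 1) ↔ Antitone (w + Pi.single i 1) := by
  rw [mem_Sn]
  simp [Finset.sum_add_distrib, (mem_Sn.1 hw).2]

/-- The algebra generated by permutation operators. -/
noncomputable def PA (d n : ℕ) : Subalgebra ℝ (H d n) :=
  Algebra.adjoin ℝ (Set.range (pm : Equiv.Perm (Fin n) → H d n))

theorem pm_mem (σ : Equiv.Perm (Fin n)) : (pm σ : H d n) ∈ PA d n :=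
  Algebra.subset_adjoin ⟨σ, rfl⟩

theorem comm_of_pm {B : H d n} (h : ∀ σ, Commute B (pm σ)) {A : H d n} (hA : A ∈ PA d n) :
    Commute B A := by
  induction hA using Algebra.adjoin_induction with
  | mem x hx => obtain ⟨σ, rfl⟩ := hx; exact h σ
  | algebraMap r => exact (Algebra.commutes r B).symm
  | add x y _ _ h1 h2 => exact h1.add_right h2
  | mul x y _ _ h1 h2 => exact h1.mul_right h2

theorem comm_io_of_pm {B : H d (n + 1)} (h : ∀ σ, Commute B (io d n (pm σ))) {A : H d n}
    (hA : A ∈ PA d n) : Commute B (io d n A) := by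
  induction hA using Algebra.adjoin_induction with
  | mem x hx => obtain ⟨σ, rfl⟩ := hx; exact h σ
  | algebraMap r => rw [AlgHom.commutes]; exact (Algebra.commutes r B).symm
  | add x y _ _ h1 h2 => rw [map_add]; exact h1.add_right h2
  | mul x y _ _ h1 h2 => rw [map_mul]; exact h1.mul_right h2

theorem X_mem : X d n ∈ PA d (n + 1) := Subalgebra.sum_mem _ fun _ _ => pm_mem _

theorem io_mem {A : H d n} (hA : A ∈ PA d n) : io d n A ∈ PA d (n + 1) := by
  induction hA using Algebra.adjoin_induction with
  | mem x hx =>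
    obtain ⟨σ, rfl⟩ := hx
    obtain ⟨τ, _, _, h⟩ := exists_ext (d := d) σ
    rw [h]; exact pm_mem _
  | algebraMap r => rw [AlgHom.commutes]; exact Subalgebra.algebraMap_mem _ _
  | add x y _ _ h1 h2 => rw [map_add]; exact Subalgebra.add_mem _ h1 h2
  | mul x y _ _ h1 h2 => rw [map_mul]; exact Subalgebra.mul_mem _ h1 h2

theorem aeval_mem (f : Polynomial ℝ) : Polynomial.aeval (X d n) f ∈ PA d (n + 1) := by
  have h := Polynomial.aeval_mem_adjoin_singleton ℝ (X d n) (p := f)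
  refine (Algebra.adjoin_le ?_) h
  simpa using X_mem

theorem aeval_star (f : Polynomial ℝ) :
    (Polynomial.aeval (X d n) f)ᴴ = Polynomial.aeval (X d n) f := by
  induction f using Polynomial.induction_on' with
  | add p q h1 h2 => rw [map_add, conjTranspose_add, h1, h2]
  | monomial k a =>
    rw [Polynomial.aeval_monomial, ← Algebra.smul_def, conjTranspose_smul, conjTranspose_pow, X_star]
    simp

theorem aeval_eig {A : Type*} [Ring A] [Algebra ℝ A] {x q : A} {c : ℝ} (h : x * q = c • q)
    (f : Polynomial ℝ) : Polynomial.aeval x f * q = f.eval c • q := by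
  have hk : ∀ k : ℕ, x ^ k * q = c ^ k • q := by
    intro k
    induction k with
    | zero => simp
    | succ k ih => rw [pow_succ, mul_assoc, h, mul_smul_comm, ih, smul_smul, pow_succ']
  induction f using Polynomial.induction_on' with
  | add p q h1 h2 => rw [map_add, add_mul, h1, h2, Polynomial.eval_add, add_smul]
  | monomial k a =>
    rw [Polynomial.aeval_monomial, ← Algebra.smul_def, smul_mul_assoc, hk, smul_smul,
      Polynomial.eval_monomial]

theorem sub_mul_basis (c : Fin d → ℝ) (i : Fin d) :
    (Polynomial.X - Polynomial.C (c i)) * Lagrange.basis Finset.univ c i =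
      Polynomial.C (Lagrange.nodalWeight Finset.univ c i) * Lagrange.nodal Finset.univ c := by
  rw [Lagrange.basis_eq_prod_sub_inv_mul_nodal_div (Finset.mem_univ i),
      ← Lagrange.nodal_erase_eq_nodal_div (Finset.mem_univ i), mul_left_comm,
      ← Lagrange.nodal_eq_mul_nodal_erase (Finset.mem_univ i)]

/-- The inductive properties of the Young projectors. -/
structure Good (P : (Fin d → ℕ) → H d n) : Prop where
  ne : ∀ α ∈ Sn d n, P α ≠ 0
  star : ∀ α, (P α)ᴴ = P α
  mul : ∀ α ∈ Sn d n, ∀ β ∈ Sn d n, P α * P β = if α = β then P α else 0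
  sum : ∑ α ∈ Sn d n, P α = 1
  mem : ∀ α, P α ∈ PA d n
  comm : ∀ α ∈ Sn d n, ∀ σ, Commute (P α) (pm σ)
  psi : ∀ α ∈ Sn d n, ∀ u : ℝ, (n : ℝ) < u → (1 + psi d n u) * P α = Ps α u • P α

/-- Refined projectors -/
noncomputable def Qg (P : (Fin d → ℕ) → H d n) (α : Fin d → ℕ) (i : Fin d) : H d (n + 1) :=
  Polynomial.aeval (X d n) (Lagrange.basis Finset.univ (hh α) i) * io d n (P α)

namespace Good
variable {P : (Fin d → ℕ) → H d n} (G : Good P) {α β : Fin d → ℕ}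
include G

theorem X_io (α) : Commute (X d n) (io d n (P α)) := comm_io_of_pm X_comm (G.mem α)

theorem aeval_io (f : Polynomial ℝ) (α) :
    Commute (Polynomial.aeval (X d n) f) (io d n (P α)) :=
  (comm_io_of_pm (fun σ => by
    have : Commute (io d n (pm σ)) (X d n) := (X_comm σ).symm
    induction f using Polynomial.induction_on' with
    | add p q h1 h2 => rw [map_add]; exact h1.add_left h2
    | monomial k a =>
      rw [Polynomial.aeval_monomial]
      exact (Commute.mul_left (Algebra.commutes a _) (this.symm.pow_left k))) (G.mem α))

theorem pt_aeval (hα : α ∈ Sn d n) (f : Polynomial ℝ) :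
    pt d n (Polynomial.aeval (X d n) f) * P α = (∑ i, f.eval (hh α i) * yy α i) • P α := by
  have h := transfer (E := H d n) (A := H d (n + 1)) (X d n) (Algebra.IsIntegral.isIntegral _)
    (Res d n) n (fun u hu => mul_Res hu) (fun u hu => Res_mul hu)
    ((LinearMap.mulRight ℝ (P α)) ∘ₗ pt d n) (hh α) (fun i => yy α i • P α) (hh_le hα) (by
      intro u hu
      have h1 := G.psi α hα u hu
      rw [add_mul, one_mul] at h1
      have h2 : PBT.psi d n u * P α = Ps α u • P α - P α := by rw [← h1]; abel
      show PBT.psi d n u * P α = _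
      rw [h2, Ps, partial_fractions 1 (hh α) (hh_inj (mem_Sn.1 hα).1) univ u
        (fun i _ => by have := hh_le hα i; linarith)]
      rw [add_smul, one_smul, add_sub_cancel_left, one_mul, Finset.sum_smul]
      refine Finset.sum_congr rfl fun i _ => ?_
      rw [smul_smul, mul_comm]; rfl) f
  simp only [LinearMap.comp_apply, LinearMap.mulRight_apply, smul_smul] at h
  rw [h, Finset.sum_smul]

theorem sq (hα : α ∈ Sn d n) : P α * P α = P α := by
  rw [G.mul α hα α hα, if_pos rfl]

theorem io_sq (hα : α ∈ Sn d n) : io d n (P α) * io d n (P α) = io d n (P α) := by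
  rw [← map_mul, G.sq hα]

theorem pt_aeval_io (hα : α ∈ Sn d n) (f : Polynomial ℝ) :
    pt d n (Polynomial.aeval (X d n) f * io d n (P α)) =
      (∑ i, f.eval (hh α i) * yy α i) • P α := by
  rw [pt_mul_io, G.pt_aeval hα]

theorem aeval_io_star (f : Polynomial ℝ) (α) :
    (Polynomial.aeval (X d n) f * io d n (P α))ᴴ = Polynomial.aeval (X d n) f * io d n (P α) := by
  rw [conjTranspose_mul, aeval_star, io_conjTranspose, G.star, (G.aeval_io f α).eq]

theorem aeval_io_sq (hα : α ∈ Sn d n) (f g : Polynomial ℝ) :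
    (Polynomial.aeval (X d n) f * io d n (P α)) * (Polynomial.aeval (X d n) g * io d n (P α)) =
      Polynomial.aeval (X d n) (f * g) * io d n (P α) := by
  rw [(G.aeval_io g α).eq, mul_assoc, ← mul_assoc _ _ (Polynomial.aeval _ g), G.io_sq hα,
    ← (G.aeval_io g α).eq, ← mul_assoc, map_mul]

theorem zero_of_eval (hα : α ∈ Sn d n) (f : Polynomial ℝ)
    (h : ∀ i, f.eval (hh α i) = 0 ∨ yy α i = 0) :
    Polynomial.aeval (X d n) f * io d n (P α) = 0 := by
  rw [← trace_conjTranspose_mul_self_eq_zero_iff, G.aeval_io_star, G.aeval_io_sq hα, ← trace_pt,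
    G.pt_aeval_io hα]
  rw [Finset.sum_eq_zero, zero_smul, trace_zero]
  intro i _
  rcases h i with h | h <;> simp [h]

theorem X_Q (hα : α ∈ Sn d n) (i : Fin d) : X d n * Qg P α i = hh α i • Qg P α i := by
  have h := congrArg (Polynomial.aeval (X d n)) (sub_mul_basis (hh α) i)
  have h0 := G.zero_of_eval hα (Lagrange.nodal univ (hh α)) fun i =>
    Or.inl (Lagrange.eval_nodal_at_node (Finset.mem_univ i))
  rw [map_mul, map_mul, map_sub, Polynomial.aeval_X, Polynomial.aeval_C, Polynomial.aeval_C] at h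
  have h2 := congrArg (· * io d n (P α)) h
  simp only [mul_assoc] at h2
  rw [h0, mul_zero, sub_mul, sub_eq_zero, ← Algebra.smul_def] at h2
  exact h2

theorem aeval_Q (hα : α ∈ Sn d n) (i : Fin d) (f : Polynomial ℝ) :
    Polynomial.aeval (X d n) f * Qg P α i = f.eval (hh α i) • Qg P α i :=
  aeval_eig (G.X_Q hα i) f

theorem Q_star (α i) : (Qg P α i)ᴴ = Qg P α i := G.aeval_io_star _ _

theorem Q_mem (α i) : Qg P α i ∈ PA d (n + 1) :=
  Subalgebra.mul_mem _ (aeval_mem _) (io_mem (G.mem α))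

theorem sum_Q [NeZero d] (hα : α ∈ Sn d n) : ∑ i, Qg P α i = io d n (P α) := by
  simp only [Qg]
  rw [← Finset.sum_mul, ← map_sum, Lagrange.sum_basis, map_one, one_mul]
  · exact (hh_inj (mem_Sn.1 hα).1).injOn
  · exact Finset.univ_nonempty

theorem Q_io (hα : α ∈ Sn d n) (hβ : β ∈ Sn d n) (i) :
    Qg P α i * io d n (P β) = if α = β then Qg P α i else 0 := by
  rw [Qg, mul_assoc, ← map_mul, G.mul α hα β hβ]
  split_ifs <;> simp

theorem io_Q (hα : α ∈ Sn d n) (hβ : β ∈ Sn d n) (i) :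
    io d n (P β) * Qg P α i = if α = β then Qg P α i else 0 := by
  rw [← G.Q_io hα hβ, Qg, ← mul_assoc, ← (G.aeval_io _ β).eq, mul_assoc, mul_assoc, ← map_mul,
    ← map_mul, G.mul α hα β hβ, G.mul β hβ α hα]
  by_cases h : α = β
  · subst h; rfl
  · simp [h, Ne.symm h]

theorem Q_mul (hα : α ∈ Sn d n) (hβ : β ∈ Sn d n) (i j) :
    Qg P α i * Qg P β j = if α = β ∧ i = j then Qg P α i else 0 := by
  rw [Qg, mul_assoc, G.io_Q hβ hα]
  by_cases h : α = β
  · subst h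
    rw [if_pos rfl, G.aeval_Q hα]
    by_cases hij : i = j
    · subst hij
      rw [Lagrange.eval_basis_self (hh_inj (mem_Sn.1 hα).1).injOn (Finset.mem_univ _)]
      simp [Qg]
    · rw [Lagrange.eval_basis_of_ne hij (Finset.mem_univ _)]
      simp [hij]
  · simp [h, Ne.symm h]

theorem pt_Q (hα : α ∈ Sn d n) (i) : pt d n (Qg P α i) = yy α i • P α := by
  rw [Qg, G.pt_aeval_io hα, Finset.sum_eq_single i]
  · rw [Lagrange.eval_basis_self (hh_inj (mem_Sn.1 hα).1).injOn (Finset.mem_univ _), one_mul]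
  · intro j _ hj
    rw [Lagrange.eval_basis_of_ne hj.symm (Finset.mem_univ _), zero_mul]
  · simp

theorem Q_zero (hα : α ∈ Sn d n) (i) (h : ¬ Antitone (α + Pi.single i 1)) : Qg P α i = 0 := by
  apply G.zero_of_eval hα
  intro j
  by_cases hj : j = i
  · subst hj
    exact Or.inr (yy_eq_zero (mem_Sn.1 hα).1 h)
  · exact Or.inl (Lagrange.eval_basis_of_ne (Ne.symm hj) (Finset.mem_univ _))

theorem Q_ne (hα : α ∈ Sn d n) (i) (h : Antitone (α + Pi.single i 1)) : Qg P α i ≠ 0 := by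
  intro h0
  have h1 := G.pt_Q hα i
  rw [h0, map_zero, eq_comm, smul_eq_zero] at h1
  exact h1.elim (yy_ne_zero (mem_Sn.1 hα).1 h) (G.ne α hα)

theorem Res_Q (hα : α ∈ Sn d n) (i) {u : ℝ} (hu : (n : ℝ) < u) :
    Res d n u * Qg P α i = (u - hh α i)⁻¹ • Qg P α i := by
  have h1 : (algebraMap ℝ (H d (n + 1)) u - X d n) * Qg P α i = (u - hh α i) • Qg P α i := by
    rw [sub_mul, G.X_Q hα, ← Algebra.smul_def, sub_smul]
  have h2 := congrArg (Res d n u * ·) h1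
  simp only [← mul_assoc, Res_mul hu, one_mul, mul_smul_comm] at h2
  have : u - hh α i ≠ 0 := by have := hh_le hα i; linarith
  conv_rhs => rw [h2]
  rw [smul_smul, inv_mul_cancel₀ this, one_smul]

theorem psi_Q (hα : α ∈ Sn d n) (i) {u : ℝ} (hu : ((n + 1 : ℕ) : ℝ) < u) :
    (1 + PBT.psi d (n + 1) u) * Qg P α i = Ps (α + Pi.single i 1) u • Qg P α i := by
  have hu' : (n : ℝ) < u := by push_cast at hu; linarith
  have hlt : hh α i + 1 < u := by have := hh_le hα i; push_cast at hu; linarith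
  have hc : Commute (1 + PBT.psi d (n + 1) u) (Qg P α i) :=
    comm_of_pm (fun σ => (Commute.one_left _).add_left (psi_comm hu σ)) (G.Q_mem α i)
  have h := congrArg (· * Qg P α i) (psi_succ (d := d) hu)
  have hR : (1 - Res d n u * Res d n u) * Qg P α i =
      (1 - (u - hh α i)⁻¹ * (u - hh α i)⁻¹) • Qg P α i := by
    rw [sub_mul, one_mul, mul_assoc, G.Res_Q hα i hu', mul_smul_comm, G.Res_Q hα i hu', smul_smul,
      sub_smul, one_smul]
  have hP : io d n (1 + PBT.psi d n u) * Qg P α i = Ps α u • Qg P α i := by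
    conv_lhs => rw [Qg, (G.aeval_io _ _).eq, ← mul_assoc, ← map_mul, G.psi α hα u hu', map_smul,
      smul_mul_assoc, ← (G.aeval_io _ _).eq]
    rfl
  rw [mul_assoc, hc.eq, ← mul_assoc, hR, smul_mul_assoc, ← hc.eq, hP, ← Ps_step α i u hlt,
    ← smul_smul] at h
  have hne : 1 - (u - hh α i)⁻¹ * (u - hh α i)⁻¹ ≠ 0 := by
    have h1 : 1 < u - hh α i := by linarith
    have h2 : (u - hh α i)⁻¹ < 1 := inv_lt_one_of_one_lt₀ h1
    have h3 : 0 < (u - hh α i)⁻¹ := by positivity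
    nlinarith
  exact smul_right_injective _ hne h
end Good

open scoped Classical in
/-- The Young projectors at the next level. -/
noncomputable def nextP (P : (Fin d → ℕ) → H d n) (μ : Fin d → ℕ) : H d (n + 1) :=
  ∑ α ∈ Sn d n, ∑ i, if α + Pi.single i 1 = μ then Qg P α i else 0

theorem exists_remove {μ : Fin d → ℕ} (hμ : μ ∈ Sn d (n + 1)) :
    ∃ α ∈ Sn d n, ∃ i, α + Pi.single i 1 = μ := by
  obtain ⟨h1, h2⟩ := mem_Sn.1 hμ
  have hne : (Finset.univ.filter fun i => 0 < μ i).Nonempty := by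
    by_contra hcon
    rw [Finset.not_nonempty_iff_eq_empty, Finset.filter_eq_empty_iff] at hcon
    rw [Finset.sum_eq_zero] at h2
    · omega
    · intro i hi; have := hcon hi; omega
  let i := (Finset.univ.filter fun i => 0 < μ i).max' hne
  have hi : 0 < μ i := (Finset.mem_filter.1 (Finset.max'_mem _ hne)).2
  have hmax : ∀ j, i < j → μ j = 0 := by
    intro j hj
    by_contra h0
    have := Finset.le_max' (Finset.univ.filter fun i => 0 < μ i) j (by simp; omega)
    exact absurd hj (not_lt.2 this)
  have he : μ - Pi.single i 1 + Pi.single i 1 = μ := by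
    funext j
    by_cases hj : j = i
    · subst hj; simp; omega
    · simp [hj]
  refine ⟨μ - Pi.single i 1, mem_Sn.2 ⟨?_, ?_⟩, i, he⟩
  · intro a b hab
    have := h1 hab
    by_cases ha : a = i
    · subst ha
      rcases eq_or_lt_of_le hab with rfl | hlt
      · exact le_rfl
      · simp [hmax b hlt]
    · simp [ha]; omega
  · have := congrArg (fun w => ∑ j, w j) he
    simp only [Pi.add_apply, Finset.sum_add_distrib, h2] at this
    simp at this
    simpa using this

namespace Good
variable {P : (Fin d → ℕ) → H d n} (G : Good P) {α β : Fin d → ℕ}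
include G

theorem next_Q (hα : α ∈ Sn d n) (i) (μ) :
    nextP P μ * Qg P α i = if α + Pi.single i 1 = μ then Qg P α i else 0 := by
  classical
  rw [nextP, Finset.sum_mul, Finset.sum_eq_single_of_mem α hα, Finset.sum_mul,
    Finset.sum_eq_single_of_mem i (Finset.mem_univ _)]
  · split_ifs
    · rw [G.Q_mul hα hα, if_pos ⟨rfl, rfl⟩]
    · rw [zero_mul]
  · intro j _ hj
    simp [ite_mul, G.Q_mul hα hα, hj]
  · intro β hβ hne
    rw [Finset.sum_mul]
    refine Finset.sum_eq_zero fun j _ => ?_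
    simp [ite_mul, G.Q_mul hβ hα, hne]

theorem next_star (μ) : (nextP P μ)ᴴ = nextP P μ := by
  classical
  rw [nextP, conjTranspose_sum]
  refine Finset.sum_congr rfl fun α _ => ?_
  rw [conjTranspose_sum]
  refine Finset.sum_congr rfl fun i _ => ?_
  split_ifs
  · exact G.Q_star _ _
  · simp

theorem next_mem (μ) : nextP P μ ∈ PA d (n + 1) := by
  classical
  refine Subalgebra.sum_mem _ fun α _ => Subalgebra.sum_mem _ fun i _ => ?_
  split_ifs
  · exact G.Q_mem _ _
  · exact Subalgebra.zero_mem _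

theorem next_mul {μ ν} : nextP P μ * nextP P ν = if μ = ν then nextP P μ else 0 := by
  classical
  rw [nextP.eq_1 P ν, Finset.mul_sum]
  simp only [Finset.mul_sum, mul_ite, mul_zero]
  by_cases h : μ = ν
  · subst h
    rw [if_pos rfl, nextP.eq_1 P μ]
    refine Finset.sum_congr rfl fun α hα => Finset.sum_congr rfl fun i _ => ?_
    split_ifs with h
    · rw [← nextP.eq_1, G.next_Q hα, if_pos h]
    · rfl
  · rw [if_neg h]
    refine Finset.sum_eq_zero fun α hα => Finset.sum_eq_zero fun i _ => ?_
    split_ifs with h2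
    · rw [G.next_Q hα, if_neg (fun h3 => h (h3.symm.trans h2))]
    · rfl

theorem next_sum [NeZero d] : ∑ μ ∈ Sn d (n + 1), nextP P μ = 1 := by
  classical
  have : (1 : H d (n + 1)) = ∑ α ∈ Sn d n, ∑ i, Qg P α i := by
    rw [Finset.sum_congr rfl fun α hα => G.sum_Q hα, ← map_sum, G.sum, map_one]
  rw [this]
  simp only [nextP]
  rw [Finset.sum_comm]
  refine Finset.sum_congr rfl fun α hα => ?_
  rw [Finset.sum_comm]
  refine Finset.sum_congr rfl fun i _ => ?_
  rw [Finset.sum_ite_eq]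
  split_ifs with h
  · rfl
  · rw [G.Q_zero hα]
    rwa [← add_single_mem hα]

theorem next_ne {μ} (hμ : μ ∈ Sn d (n + 1)) : nextP P μ ≠ 0 := by
  obtain ⟨α, hα, i, rfl⟩ := exists_remove hμ
  intro h
  have := G.next_Q hα i (α + Pi.single i 1)
  rw [h, zero_mul, if_pos rfl] at this
  exact G.Q_ne hα i (mem_Sn.1 hμ).1 this.symm

theorem next_psi (μ) {u : ℝ} (hu : ((n + 1 : ℕ) : ℝ) < u) :
    (1 + PBT.psi d (n + 1) u) * nextP P μ = Ps μ u • nextP P μ := by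
  classical
  rw [nextP, Finset.mul_sum, Finset.smul_sum]
  refine Finset.sum_congr rfl fun α hα => ?_
  rw [Finset.mul_sum, Finset.smul_sum]
  refine Finset.sum_congr rfl fun i _ => ?_
  split_ifs with h
  · rw [G.psi_Q hα i hu, h]
  · simp

theorem next_off {μ ν} (hμ : μ ∈ Sn d (n + 1)) (hν : ν ∈ Sn d (n + 1)) (hne : μ ≠ ν)
    (σ : Equiv.Perm (Fin (n + 1))) : nextP P μ * pm σ * nextP P ν = 0 := by
  have : ∃ u : ℝ, ((n + 1 : ℕ) : ℝ) < u ∧ Ps μ u ≠ Ps ν u := by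
    by_contra hcon
    push Not at hcon
    exact hne (Ps_sep (mem_Sn.1 hμ).1 (mem_Sn.1 hν).1 ((n + 1 : ℕ) : ℝ) (hh_le hμ) (hh_le hν) hcon)
  obtain ⟨u, hu, hP⟩ := this
  have hcs : ∀ σ, Commute (1 + PBT.psi d (n + 1) u) (pm σ) :=
    fun σ => (Commute.one_left _).add_left (psi_comm hu σ)
  have hc : Commute (1 + PBT.psi d (n + 1) u) (nextP P μ) := comm_of_pm hcs (G.next_mem μ)
  have e1 : (1 + PBT.psi d (n + 1) u) * (nextP P μ * pm σ * nextP P ν) =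
      Ps μ u • (nextP P μ * pm σ * nextP P ν) := by
    rw [← mul_assoc, ← mul_assoc, G.next_psi μ hu, smul_mul_assoc, smul_mul_assoc]
  have e2 : (1 + PBT.psi d (n + 1) u) * (nextP P μ * pm σ * nextP P ν) =
      Ps ν u • (nextP P μ * pm σ * nextP P ν) := by
    rw [← mul_assoc, ← mul_assoc, hc.eq, mul_assoc (nextP P μ), (hcs σ).eq, ← mul_assoc,
      mul_assoc _ (1 + PBT.psi d (n + 1) u), G.next_psi ν hu, mul_smul_comm]
  rw [e1, ← sub_eq_zero, ← sub_smul, smul_eq_zero] at e2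
  exact e2.resolve_left (sub_ne_zero.2 hP)

theorem next [NeZero d] : Good (nextP P) where
  ne := fun μ hμ => G.next_ne hμ
  star := G.next_star
  mul := fun _ _ _ _ => G.next_mul
  sum := G.next_sum
  mem := G.next_mem
  comm := by
    intro μ hμ σ
    have e1 : nextP P μ * pm σ = nextP P μ * pm σ * nextP P μ := by
      conv_lhs => rw [← mul_one (nextP P μ * pm σ), ← G.next_sum, Finset.mul_sum]
      exact Finset.sum_eq_single_of_mem μ hμ fun ν hν hne => G.next_off hμ hν hne.symm σ
    have e2 : pm σ * nextP P μ = nextP P μ * pm σ * nextP P μ := by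
      conv_lhs => rw [← one_mul (pm σ * nextP P μ), ← G.next_sum, Finset.sum_mul]
      rw [mul_assoc]
      exact Finset.sum_eq_single_of_mem μ hμ fun ν hν hne => by
        rw [← mul_assoc]; exact G.next_off hν hμ hne σ
    exact e1.trans e2.symm
  psi := fun μ _ u hu => G.next_psi μ hu
end Good

open scoped Classical in
/-- The Young projectors. -/
noncomputable def PP (d : ℕ) : (n : ℕ) → (Fin d → ℕ) → H d n
  | 0 => fun _ => 1
  | (n + 1) => nextP (PP d n)

theorem Sn_zero : Sn d 0 = {0} := by
  ext w
  rw [mem_Sn, Finset.mem_singleton]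
  constructor
  · rintro ⟨_, h⟩
    rw [Finset.sum_eq_zero_iff] at h
    funext i; exact h i (Finset.mem_univ i)
  · rintro rfl; exact ⟨fun _ _ _ => le_rfl, by simp⟩

theorem Ps_zero {u : ℝ} (hu : 0 < u) : Ps (0 : Fin d → ℕ) u = 1 + d / u := by
  have : ∀ d : ℕ, ∏ i ∈ Finset.range d, (1 + 1 * (u + (i : ℝ))⁻¹) = 1 + d / u := by
    intro d
    induction d with
    | zero => simp
    | succ d ih =>
      rw [Finset.prod_range_succ, ih]
      have : u + d ≠ 0 := by positivity
      push_cast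
      field_simp
      ring
  rw [← this d, Ps, ← Fin.prod_univ_eq_prod_range (fun i => 1 + 1 * (u + (i : ℝ))⁻¹)]
  refine Finset.prod_congr rfl fun i _ => ?_
  simp [hh]

theorem good_zero : Good (PP d 0) where
  ne := fun _ _ => one_ne_zero
  star := fun _ => conjTranspose_one
  mul := by
    intro α hα β hβ
    rw [Sn_zero, Finset.mem_singleton] at hα hβ
    simp [PP, hα, hβ]
  sum := by simp [Sn_zero, PP]
  mem := fun _ => Subalgebra.one_mem _
  comm := fun _ _ _ => Commute.one_left _
  psi := by
    intro α hα u hu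
    rw [Sn_zero, Finset.mem_singleton] at hα
    have hu : 0 < u := by simpa using hu
    rw [hα, Ps_zero hu, psi_zero hu, PP, add_smul, one_smul, mul_one]

theorem good [NeZero d] (n : ℕ) : Good (PP d n) := by
  induction n with
  | zero => exact good_zero
  | succ n ih => exact ih.next

end PBT

open scoped ComplexOrder

namespace PBT
open Matrix Finset

variable {d n : ℕ}

theorem Ps_mul (w : Fin d → ℕ) {u : ℝ} (hu : ∀ i, hh w i < u) :
    Ps w u * ∏ i, (1 + (-1) * (u - (hh w i - 1))⁻¹) = 1 := by
  rw [Ps, ← Finset.prod_mul_distrib]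
  refine Finset.prod_eq_one fun i _ => ?_
  have h1 : u - hh w i ≠ 0 := by have := hu i; linarith
  have h2 : u - (hh w i - 1) ≠ 0 := by have := hu i; linarith
  field_simp
  ring

theorem avg_mul_comm (A B : H d (n + 1)) (hB : ∀ σ, Commute B (pm σ)) :
    avg d n A * B = avg d n (A * B) := by
  rw [avg_apply, avg_apply, Finset.sum_mul]
  refine Finset.sum_congr rfl fun a _ => ?_
  rw [mul_assoc, ← (hB _).eq]; noncomm_ring

namespace Good
variable [NeZero d] {P : (Fin d → ℕ) → H d n} (G : Good P) {α β μ : Fin d → ℕ}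
include G

theorem theta_next (hμ : μ ∈ Sn d (n + 1)) {u : ℝ} (hu : ((n + 1 : ℕ) : ℝ) < u) :
    theta d n u * nextP P μ = ∑ i, (u - (hh μ i - 1))⁻¹ • (zz μ i • nextP P μ) := by
  have h := congrArg (· * nextP P μ) (theta_psi (d := d) hu)
  simp only [mul_assoc, G.next_psi μ hu] at h
  have hlt : ∀ i, hh μ i < u := fun i => lt_of_le_of_lt (hh_le hμ i) hu
  have hm := Ps_mul μ hlt
  set c := ∏ i, (1 + (-1) * (u - (hh μ i - 1))⁻¹) with hc
  have h2 := congrArg (c • ·) h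
  simp only [mul_smul_comm, smul_smul, smul_mul_assoc, one_mul] at h2
  rw [mul_comm c (Ps μ u), hm, one_smul, sub_mul, smul_mul_assoc, one_mul, sub_eq_iff_eq_add] at h2
  have h3 : theta d n u * nextP P μ = (u - (u + d) * c) • nextP P μ := by
    rw [sub_smul, h2, mul_comm c]; abel
  have h4 := theta_fractions (fun i => hh μ i - 1)
    (fun i j hij => hh_inj (mem_Sn.1 hμ).1 (by simpa using hij)) univ u
    (fun i _ => by have := hlt i; linarith)
  rw [Finset.card_univ, Fintype.card_fin] at h4
  rw [h3, hc, h4, Finset.sum_smul]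
  refine Finset.sum_congr rfl fun i _ => ?_
  rw [smul_smul, mul_comm]; rfl

theorem avg_aeval (hμ : μ ∈ Sn d (n + 1)) (f : Polynomial ℝ) :
    avg d n (Polynomial.aeval (X d n) f) * nextP P μ =
      (∑ i, f.eval (hh μ i - 1) * zz μ i) • nextP P μ := by
  have hlt : ∀ u : ℝ, ((n + 1 : ℕ) : ℝ) < u → (n : ℝ) < u := fun u hu => by
    push_cast at hu; linarith
  have h := transfer (E := H d (n + 1)) (A := H d (n + 1)) (X d n)
    (Algebra.IsIntegral.isIntegral _)
    (Res d n) ((n + 1 : ℕ) : ℝ) (fun u hu => mul_Res (hlt u hu)) (fun u hu => Res_mul (hlt u hu))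
    ((LinearMap.mulRight ℝ (nextP P μ)) ∘ₗ avg d n) (fun i => hh μ i - 1)
    (fun i => zz μ i • nextP P μ) (fun i => by have := hh_le hμ i; linarith)
    (fun u hu => G.theta_next hμ hu) f
  simp only [LinearMap.comp_apply, LinearMap.mulRight_apply, smul_smul] at h
  rw [h, Finset.sum_smul]

theorem aeval_next (hα : α ∈ Sn d n) (i : Fin d) (hμ : α + Pi.single i 1 ∈ Sn d (n + 1)) :
    Polynomial.aeval (X d n)
      (Lagrange.basis Finset.univ (fun j => hh (α + Pi.single i 1) j - 1) i) *
      nextP P (α + Pi.single i 1) = Qg P α i := by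
  classical
  have hinj : Function.Injective (fun j => hh (α + Pi.single i 1) j - 1) :=
    fun a b hab => hh_inj (mem_Sn.1 hμ).1 (by simpa using hab)
  rw [nextP, Finset.mul_sum, Finset.sum_eq_single_of_mem α hα, Finset.mul_sum,
    Finset.sum_eq_single_of_mem i (Finset.mem_univ i)]
  · rw [if_pos rfl, G.aeval_Q hα]
    have : hh α i = (fun j => hh (α + Pi.single i 1) j - 1) i := by simp only [hh_single]; ring
    rw [this, Lagrange.eval_basis_self hinj.injOn (Finset.mem_univ _), one_smul]
  · intro j _ hj
    rw [if_neg, mul_zero]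
    intro h
    have := congrFun h j
    simp [hj] at this
  · intro β hβ hne
    rw [Finset.mul_sum]
    refine Finset.sum_eq_zero fun j _ => ?_
    split_ifs with h
    · rw [G.aeval_Q hβ]
      have hji : i ≠ j := by
        rintro rfl
        exact hne (add_right_cancel h)
      have : hh β j = (fun j => hh (α + Pi.single i 1) j - 1) j := by
        simp only [← h, hh_single]; ring
      have h0 := Lagrange.eval_basis_of_ne (s := Finset.univ)
        (v := fun j => hh (α + Pi.single i 1) j - 1) hji (Finset.mem_univ j)
      rw [this, h0, zero_smul]
    · simp

theorem avg_Q (hα : α ∈ Sn d n) (i : Fin d) (hμ : α + Pi.single i 1 ∈ Sn d (n + 1)) :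
    avg d n (Qg P α i) = zz (α + Pi.single i 1) i • nextP P (α + Pi.single i 1) := by
  have hinj : Function.Injective (fun j => hh (α + Pi.single i 1) j - 1) :=
    fun a b hab => hh_inj (mem_Sn.1 hμ).1 (by simpa using hab)
  rw [← G.aeval_next hα i hμ, ← avg_mul_comm _ _ (G.next.comm _ hμ), G.avg_aeval hμ]
  congr 1
  rw [Finset.sum_eq_single_of_mem i (Finset.mem_univ i)]
  · have := Lagrange.eval_basis_self (s := Finset.univ) hinj.injOn (Finset.mem_univ i)
    rw [this, one_mul]
  · intro j _ hj
    have := Lagrange.eval_basis_of_ne (s := Finset.univ)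
      (v := fun j => hh (α + Pi.single i 1) j - 1) (Ne.symm hj) (Finset.mem_univ j)
    rw [this, zero_mul]

end Good
end PBT

open scoped ComplexOrder

namespace PBT
open Matrix Finset

variable {d n : ℕ}

/-- The isometry (up to scale) inserting a maximally entangled pair. -/
def W (d n : ℕ) : Matrix (Fin (n + 2) → Fin d) (Fin n → Fin d) ℂ := fun f g =>
  if f (Fin.last (n + 1)) = f (Fin.last n).castSucc ∧ Fin.init (Fin.init f) = g then 1 else 0

theorem W_apply (g h : Fin n → Fin d) (a b : Fin d) :
    W d n (sn (sn g a) b) h = if b = a then (if g = h then 1 else 0) else 0 := by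
  simp only [W, sn_last, sn_castSucc, init_sn]
  split_ifs <;> simp_all

theorem WH_apply (g h : Fin n → Fin d) (a b : Fin d) :
    (W d n)ᴴ h (sn (sn g a) b) = if b = a then (if g = h then 1 else 0) else 0 := by
  rw [conjTranspose_apply, W_apply]
  split_ifs <;> simp

theorem WH_io_W (A : H d (n + 1)) : (W d n)ᴴ * io d (n + 1) A * W d n = pt d n A := by
  ext g h
  simp only [Matrix.mul_apply, sum_sn, W_apply, WH_apply, io_apply, pt_apply]
  simp

theorem W_mul (C : H d n) : W d n * C = io d (n + 1) (io d n C) * W d n := by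
  ext f h
  obtain ⟨f, a, rfl⟩ := exists_sn f
  obtain ⟨f, b, rfl⟩ := exists_sn f
  simp only [Matrix.mul_apply, sum_sn, W_apply, io_apply]
  simp
  split_ifs <;> simp_all

theorem mul_WH (C : H d n) : C * (W d n)ᴴ = (W d n)ᴴ * io d (n + 1) (io d n C) := by
  have := congrArg conjTranspose (W_mul (d := d) Cᴴ)
  rw [conjTranspose_mul, conjTranspose_mul, conjTranspose_conjTranspose, io_conjTranspose,
    io_conjTranspose, conjTranspose_conjTranspose] at this
  exact this

theorem pt_W (C : H d n) : pt d (n + 1) (W d n * C * (W d n)ᴴ) = io d n C := by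
  ext f h
  obtain ⟨f, a, rfl⟩ := exists_sn f
  obtain ⟨h, b, rfl⟩ := exists_sn h
  simp only [Matrix.mul_apply, W_apply, WH_apply, io_apply, pt_apply]
  simp [eq_comm]

/-- swap on the larger space -/
noncomputable def T (d n : ℕ) (a : Fin (n + 1)) : H d (n + 2) := io d (n + 1) (pm (tr a))

theorem T_sq (a : Fin (n + 1)) : T d n a * T d n a = 1 := by
  rw [T, ← map_mul, tr_sq, map_one]

theorem T_star (a : Fin (n + 1)) : (T d n a)ᴴ = T d n a := by
  rw [T, io_conjTranspose, tr_star]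

/-- unnormalised states -/
noncomputable def Ph (d n : ℕ) (a : Fin (n + 1)) : H d (n + 2) :=
  T d n a * (W d n * (W d n)ᴴ) * T d n a

theorem Phi_apply (f g : Fin n → Fin d) (a b a' b' : Fin d) :
    (W d n * (W d n)ᴴ) (sn (sn f a) b) (sn (sn g a') b') =
      if b = a ∧ b' = a' ∧ f = g then 1 else 0 := by
  simp only [Matrix.mul_apply, W_apply, WH_apply]
  by_cases h1 : b = a <;> by_cases h2 : b' = a' <;> simp [h1, h2]

theorem Phi_eq (f g : Fin (n + 2) → Fin d) :
    (W d n * (W d n)ᴴ) f g =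
      if f (Fin.last (n + 1)) = f (Fin.last n).castSucc ∧
        g (Fin.last (n + 1)) = g (Fin.last n).castSucc ∧
        ∀ i : Fin n, f i.castSucc.castSucc = g i.castSucc.castSucc then 1 else 0 := by
  obtain ⟨f, b, rfl⟩ := exists_sn f
  obtain ⟨f, a, rfl⟩ := exists_sn f
  obtain ⟨g, b', rfl⟩ := exists_sn g
  obtain ⟨g, a', rfl⟩ := exists_sn g
  rw [Phi_apply]
  simp [funext_iff]

theorem sigma_eq (a : Fin (n + 1)) :
    sigmaPBT d (n + 1) a = (((d : ℝ) ^ (n + 1))⁻¹) • Ph d n a := by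
  ext f g
  rw [Matrix.smul_apply, Ph, T, io_tr, mul_pm_apply, pm_mul_apply, Phi_eq, sigmaPBT]
  rw [Equiv.swap_inv]
  have key : (f a.castSucc = f (Fin.last (n + 1)) ∧ g a.castSucc = g (Fin.last (n + 1)) ∧
      ∀ i : Fin (n + 1 + 1), i ≠ a.castSucc → i ≠ Fin.last (n + 1) → f i = g i) ↔
    ((f ∘ ⇑(Equiv.swap a.castSucc (Fin.last n).castSucc)) (Fin.last (n + 1)) =
        (f ∘ ⇑(Equiv.swap a.castSucc (Fin.last n).castSucc)) (Fin.last n).castSucc ∧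
      (g ∘ ⇑(Equiv.swap a.castSucc (Fin.last n).castSucc)) (Fin.last (n + 1)) =
        (g ∘ ⇑(Equiv.swap a.castSucc (Fin.last n).castSucc)) (Fin.last n).castSucc ∧
      ∀ i : Fin n, (f ∘ ⇑(Equiv.swap a.castSucc (Fin.last n).castSucc)) i.castSucc.castSucc =
        (g ∘ ⇑(Equiv.swap a.castSucc (Fin.last n).castSucc)) i.castSucc.castSucc) := by
    have hl : ∀ b : Fin (n + 1), Fin.last (n + 1) ≠ b.castSucc := fun b => (Fin.castSucc_lt_last b).ne'
    simp only [Function.comp, Equiv.swap_apply_right, Equiv.swap_apply_of_ne_of_ne (hl a) (hl _)]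
    refine and_congr eq_comm (and_congr eq_comm ⟨fun h i => ?_, fun h i hi1 hi2 => ?_⟩)
    · by_cases hia : i.castSucc = a
      · subst hia
        rw [Equiv.swap_apply_left]
        apply h
        · intro h'
          exact (Fin.castSucc_lt_last i).ne' (Fin.castSucc_injective _ h')
        · exact (hl _).symm
      · rw [Equiv.swap_apply_of_ne_of_ne]
        · exact h _ (fun h' => hia (Fin.castSucc_injective _ h')) (hl _).symm
        · exact fun h' => hia (Fin.castSucc_injective _ h')
        · intro h'
          exact (Fin.castSucc_lt_last i).ne (Fin.castSucc_injective _ h')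
    · obtain ⟨j, rfl⟩ : ∃ j : Fin (n + 1), i = j.castSucc := by
        refine Fin.lastCases (fun h => absurd rfl h) (fun j _ => ⟨j, rfl⟩) i hi2
      have hja : j ≠ a := fun h' => hi1 (by rw [h'])
      by_cases hj : j = Fin.last n
      · subst hj
        obtain ⟨k, rfl⟩ : ∃ k : Fin n, a = k.castSucc := by
          refine Fin.lastCases (fun h => absurd rfl h) (fun j _ => ⟨j, rfl⟩) a hja.symm
        have := h k
        rwa [Equiv.swap_apply_left] at this
      · obtain ⟨k, rfl⟩ : ∃ k : Fin n, j = k.castSucc := by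
          refine Fin.lastCases (fun h => absurd rfl h) (fun j _ => ⟨j, rfl⟩) j hj
        have := h k
        rwa [Equiv.swap_apply_of_ne_of_ne hi1] at this
        intro h'
        exact hj (Fin.castSucc_injective _ h')
  simp only [key]
  split_ifs <;> simp

/-- `∑_a T_a W C Wᴴ T_a` -/
noncomputable def K (C : H d n) : H d (n + 2) :=
  ∑ a, T d n a * (W d n * C * (W d n)ᴴ) * T d n a

theorem K_star (C : H d n) (hC : Cᴴ = C) : (K C)ᴴ = K C := by
  rw [K, conjTranspose_sum]
  refine Finset.sum_congr rfl fun a _ => ?_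
  simp only [conjTranspose_mul, T_star, conjTranspose_conjTranspose, hC, Matrix.mul_assoc]

theorem K_comm (C : H d n) (hC : ∀ σ, Commute C (pm σ)) (σ : Equiv.Perm (Fin (n + 1))) :
    Commute (K C) (io d (n + 1) (pm σ)) := by
  rw [Commute, SemiconjBy, K, Finset.mul_sum, Finset.sum_mul]
  rw [← Equiv.sum_comp σ]
  refine Finset.sum_congr rfl fun a _ => ?_
  obtain ⟨ρ, hρ⟩ := exists_restrict (d := d) (tr (σ a) * σ * tr a) (by simp [tr])
  have h1 : T d n (σ a) * io d (n + 1) (pm σ) = io d (n + 1) (io d n (pm ρ)) * T d n a := by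
    rw [hρ, T, T, ← map_mul, ← map_mul, ← pm_mul, ← pm_mul]
    congr 2
    rw [mul_assoc, mul_assoc]
    simp [tr]
  have h2 : io d (n + 1) (pm σ) * T d n a = T d n (σ a) * io d (n + 1) (io d n (pm ρ)) := by
    rw [hρ, T, T, ← map_mul, ← map_mul, ← pm_mul, ← pm_mul]
    congr 2
    rw [← mul_assoc, ← mul_assoc]
    simp [tr]
  calc T d n (σ a) * (W d n * C * (W d n)ᴴ) * T d n (σ a) * io d (n + 1) (pm σ)
      = T d n (σ a) * (W d n * C * (W d n)ᴴ) * (T d n (σ a) * io d (n + 1) (pm σ)) := by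
        rw [Matrix.mul_assoc]
    _ = T d n (σ a) * (W d n * C * ((W d n)ᴴ * io d (n + 1) (io d n (pm ρ)))) * T d n a := by
        rw [h1]; simp only [Matrix.mul_assoc]
    _ = T d n (σ a) * (W d n * (C * (pm ρ : H d n)) * (W d n)ᴴ) * T d n a := by
        rw [← mul_WH]; simp only [Matrix.mul_assoc]
    _ = T d n (σ a) * ((W d n * (pm ρ : H d n)) * C * (W d n)ᴴ) * T d n a := by
        rw [(hC ρ).eq]; simp only [Matrix.mul_assoc]
    _ = (T d n (σ a) * io d (n + 1) (io d n (pm ρ))) * (W d n * C * (W d n)ᴴ) * T d n a := by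
        rw [W_mul (pm ρ)]; simp only [Matrix.mul_assoc]
    _ = _ := by rw [← h2]; simp only [Matrix.mul_assoc]

theorem K_W (C : H d n) :
    K C * W d n = io d (n + 1) (X d n + (d : ℝ) • 1) * (W d n * C) := by
  have h : ∀ a, T d n a * (W d n * C * (W d n)ᴴ) * T d n a * W d n =
      T d n a * (W d n * C * pt d n (pm (tr a))) := by
    intro a
    rw [← WH_io_W, T]; simp only [Matrix.mul_assoc]
  rw [K, Matrix.sum_mul, Finset.sum_congr rfl fun a _ => h a, Fin.sum_univ_castSucc]
  have hl : tr (Fin.last n) = 1 := by simp [tr]; rfl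
  simp only [pt_swap, Matrix.mul_one, T, hl, pm_one, map_one, pt_one]
  rw [map_add, map_smul, map_one, Matrix.add_mul, X, map_sum, Matrix.sum_mul, Matrix.one_mul,
    Matrix.smul_mul, Matrix.one_mul, Matrix.mul_smul, Matrix.mul_one]

theorem pt_T (a : Fin (n + 1)) (B : H d (n + 1)) :
    pt d (n + 1) (T d n a * (io d (n + 1) B * (W d n * (W d n)ᴴ)) * T d n a) =
      pm (tr a) * B * pm (tr a) := by
  have := pt_W (1 : H d n)
  rw [Matrix.mul_one, map_one] at this
  rw [T, pt_mul_io, pt_io_mul, pt_io_mul, this, mul_one]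

end PBT

open scoped ComplexOrder

namespace PBT
open Matrix Finset

variable {d n : ℕ}

/-- target of a pair -/
def tgt (p : (Fin d → ℕ) × Fin d) : Fin d → ℕ := p.1 + Pi.single p.2 1

open scoped Classical in
/-- Edges of the Young graph. -/
noncomputable def Tn (d n : ℕ) : Finset ((Fin d → ℕ) × Fin d) :=
  (Sn d n ×ˢ Finset.univ).filter fun p => tgt p ∈ Sn d (n + 1)

theorem mem_Tn {p : (Fin d → ℕ) × Fin d} : p ∈ Tn d n ↔ p.1 ∈ Sn d n ∧ tgt p ∈ Sn d (n + 1) := by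
  simp [Tn]

/-- the eigenvalue -/
def rr (p : (Fin d → ℕ) × Fin d) : ℝ := hh p.1 p.2 + d

theorem rr_pos (p : (Fin d → ℕ) × Fin d) : 0 < rr p := r_pos _ _

/-- The projectors `F`. -/
noncomputable def Fg (P : (Fin d → ℕ) → H d n) (p : (Fin d → ℕ) × Fin d) : H d (n + 2) :=
  (rr p)⁻¹ • (K (P p.1) * io d (n + 1) (nextP P (tgt p)))

/-- Abbreviation for `Qg`. -/
noncomputable def Qp (P : (Fin d → ℕ) → H d n) (p : (Fin d → ℕ) × Fin d) : H d (n + 1) :=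
  Qg P p.1 p.2

namespace Good
variable [NeZero d] {P : (Fin d → ℕ) → H d n} (G : Good P) {p q : (Fin d → ℕ) × Fin d}
include G

theorem K_comm_io (hp : p.1 ∈ Sn d n) {A : H d (n + 1)} (hA : A ∈ PA d (n + 1)) :
    Commute (K (P p.1)) (io d (n + 1) A) :=
  comm_io_of_pm (K_comm _ (G.comm _ hp)) hA

theorem next_io (hp : p.1 ∈ Sn d n) : nextP P (tgt p) * io d n (P p.1) = Qp P p := by
  rw [← G.sum_Q hp, Finset.mul_sum, Finset.sum_eq_single_of_mem p.2 (Finset.mem_univ _)]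
  · rw [G.next_Q hp, tgt, if_pos rfl]; rfl
  · intro j _ hj
    rw [G.next_Q hp, if_neg]
    intro h
    have := congrFun h j
    simp [tgt, hj] at this

theorem Q_io_self (hp : p.1 ∈ Sn d n) : Qp P p * io d n (P p.1) = Qp P p := by
  rw [Qp, G.Q_io hp hp, if_pos rfl]

theorem F_comm (hp : p ∈ Tn d n) (σ) : Commute (Fg P p) (io d (n + 1) (pm σ)) := by
  obtain ⟨h1, h2⟩ := mem_Tn.1 hp
  refine Commute.smul_left (Commute.mul_left (K_comm _ (G.comm _ h1) σ) ?_) _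
  exact ((G.next.comm _ h2 σ).map (io d (n + 1)))

theorem F_comm_io (hp : p ∈ Tn d n) {A : H d (n + 1)} (hA : A ∈ PA d (n + 1)) :
    Commute (Fg P p) (io d (n + 1) A) := comm_io_of_pm (G.F_comm hp) hA

theorem F_T (hp : p ∈ Tn d n) (a) : Commute (Fg P p) (T d n a) := G.F_comm hp _

theorem F_star (hp : p ∈ Tn d n) : (Fg P p)ᴴ = Fg P p := by
  obtain ⟨h1, h2⟩ := mem_Tn.1 hp
  rw [Fg, conjTranspose_smul, conjTranspose_mul, K_star _ (G.star _), io_conjTranspose,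
    G.next_star, (G.K_comm_io h1 (G.next_mem _)).eq]
  simp

theorem Q_eig (hp : p.1 ∈ Sn d n) : Qp P p * (X d n + (d : ℝ) • 1) = rr p • Qp P p := by
  have h1 := congrArg conjTranspose (G.X_Q hp p.2)
  rw [conjTranspose_mul, G.Q_star, X_star, conjTranspose_smul, G.Q_star, star_trivial] at h1
  rw [mul_add, Qp, h1, mul_smul_comm, mul_one, ← add_smul]; rfl

theorem Q_eig' (hp : p.1 ∈ Sn d n) : (X d n + (d : ℝ) • 1) * Qp P p = rr p • Qp P p := by
  rw [add_mul, Qp, G.X_Q hp, smul_mul_assoc, one_mul, ← add_smul]; rfl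

theorem F_eq (hp : p ∈ Tn d n) : Fg P p = (rr p)⁻¹ •
    ∑ a, T d n a * (io d (n + 1) (Qp P p) * (W d n * (W d n)ᴴ)) * T d n a := by
  obtain ⟨h1, h2⟩ := mem_Tn.1 hp
  rw [Fg, (G.K_comm_io h1 (G.next_mem _)).eq, K, Finset.mul_sum]
  congr 1
  refine Finset.sum_congr rfl fun a _ => ?_
  have hc : io d (n + 1) (nextP P (tgt p)) * T d n a = T d n a * io d (n + 1) (nextP P (tgt p)) :=
    ((G.next.comm _ h2 (tr a)).map (io d (n + 1))).eq
  rw [← G.next_io h1, map_mul, ← mul_assoc, ← mul_assoc, hc, W_mul]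
  simp only [Matrix.mul_assoc]

theorem F_W (hp : p ∈ Tn d n) : Fg P p * W d n = io d (n + 1) (Qp P p) * W d n := by
  obtain ⟨h1, h2⟩ := mem_Tn.1 hp
  rw [Fg, (G.K_comm_io h1 (G.next_mem _)).eq, Matrix.smul_mul, Matrix.mul_assoc, K_W, W_mul,
    ← Matrix.mul_assoc, ← Matrix.mul_assoc, ← map_mul, ← map_mul]
  have : nextP P (tgt p) * (X d n + (d : ℝ) • 1) * io d n (P p.1) = rr p • Qp P p := by
    have hc : Commute (X d n + (d : ℝ) • 1) (io d n (P p.1)) :=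
      (G.X_io _).add_left ((Commute.one_left _).smul_left _)
    rw [mul_assoc, hc.eq, ← mul_assoc, G.next_io h1, G.Q_eig h1]
  rw [this, map_smul, Matrix.smul_mul, smul_smul, inv_mul_cancel₀ (rr_pos p).ne', one_smul]

theorem Qp_mul (hp : p ∈ Tn d n) (hq : q ∈ Tn d n) :
    Qp P p * Qp P q = if p = q then Qp P p else 0 := by
  rw [Qp, Qp, G.Q_mul (mem_Tn.1 hp).1 (mem_Tn.1 hq).1]
  simp only [Prod.ext_iff]

theorem F_mul (hp : p ∈ Tn d n) (hq : q ∈ Tn d n) :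
    Fg P p * Fg P q = if p = q then Fg P p else 0 := by
  have key : Fg P p * Fg P q = (rr q)⁻¹ •
    ∑ a, T d n a * (io d (n + 1) (Qp P q * Qp P p) * (W d n * (W d n)ᴴ)) * T d n a := by
    rw [G.F_eq hq, mul_smul_comm, Finset.mul_sum]
    congr 1
    refine Finset.sum_congr rfl fun a _ => ?_
    rw [← mul_assoc, ← mul_assoc, (G.F_T hp a).eq, mul_assoc (T d n a), ← mul_assoc (Fg P p),
      (G.F_comm_io hp (show Qp P q ∈ _ from G.Q_mem _ _)).eq, map_mul, mul_assoc _ (Fg P p), ← Matrix.mul_assoc (Fg P p),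
      G.F_W hp]
    simp only [Matrix.mul_assoc]
  rw [key, G.Qp_mul hq hp]
  by_cases h : p = q
  · subst h
    rw [if_pos rfl, if_pos rfl, ← G.F_eq hp]
  · rw [if_neg h, if_neg (Ne.symm h)]; simp

theorem pt_F (hp : p ∈ Tn d n) : pt d (n + 1) (Fg P p) = (yy p.1 p.2)⁻¹ • nextP P (tgt p) := by
  obtain ⟨h1, h2⟩ := mem_Tn.1 hp
  rw [G.F_eq hp, map_smul, map_sum]
  simp only [pt_T]
  rw [← avg_apply, Qp, G.avg_Q h1 p.2 h2, smul_smul]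
  have h := yy_mul_zz (mem_Sn.1 h1).1 (mem_Sn.1 h2).1
  have hy := yy_ne_zero (mem_Sn.1 h1).1 (mem_Sn.1 h2).1
  have hr := (rr_pos p).ne'
  rw [show tgt p = p.1 + Pi.single p.2 1 from rfl]
  congr 1
  rw [rr] at *
  field_simp
  linarith

theorem F_io (hp : p ∈ Tn d n) {ν} :
    Fg P p * io d (n + 1) (nextP P ν) = if tgt p = ν then Fg P p else 0 := by
  rw [Fg, smul_mul_assoc, mul_assoc, ← map_mul, G.next_mul]
  split_ifs <;> simp

theorem sum_Qp : ∑ p ∈ Tn d n, Qp P p = 1 := by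
  classical
  rw [Tn, Finset.sum_filter_of_ne, Finset.sum_product]
  · simp only [Qp]
    rw [Finset.sum_congr rfl fun α hα => G.sum_Q hα, ← map_sum, G.sum, map_one]
  · intro p hp h
    by_contra hcon
    have hp1 := (Finset.mem_product.1 hp).1
    rw [tgt, add_single_mem hp1] at hcon
    exact h (G.Q_zero hp1 _ hcon)

theorem E_W : (∑ p ∈ Tn d n, Fg P p) * W d n = W d n := by
  rw [Matrix.sum_mul, Finset.sum_congr rfl fun p hp => G.F_W hp, ← Matrix.sum_mul, ← map_sum,
    G.sum_Qp, map_one, Matrix.one_mul]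

theorem rho_F (hp : p ∈ Tn d n) : (∑ a, Ph d n a) * Fg P p = rr p • Fg P p := by
  have hK : (∑ a, Ph d n a) = K (1 : H d n) := by
    simp only [Ph, K, Matrix.mul_one]
  rw [hK]
  have hc : ∀ {A : H d (n + 1)}, A ∈ PA d (n + 1) → Commute (K (1 : H d n)) (io d (n + 1) A) :=
    fun hA => comm_io_of_pm (K_comm _ (fun _ => Commute.one_left _)) hA
  rw [G.F_eq hp, mul_smul_comm, Finset.mul_sum, smul_comm]
  congr 1
  rw [Finset.smul_sum]
  refine Finset.sum_congr rfl fun a _ => ?_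
  have hT : K (1 : H d n) * T d n a = T d n a * K (1 : H d n) := (hc (pm_mem _)).eq
  have hQ : K (1 : H d n) * io d (n + 1) (Qp P p) = io d (n + 1) (Qp P p) * K (1 : H d n) :=
    (hc (G.Q_mem _ _)).eq
  rw [← mul_assoc, ← mul_assoc, hT, mul_assoc (T d n a), ← mul_assoc (K _), hQ,
    mul_assoc _ (K _), ← Matrix.mul_assoc (K _), K_W, Matrix.mul_one, Matrix.mul_assoc _ (W d n),
    ← mul_assoc (io d (n + 1) (Qp P p)), ← map_mul, G.Q_eig (mem_Tn.1 hp).1, map_smul]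
  simp only [smul_mul_assoc, mul_smul_comm]

end Good

set_option linter.unusedSectionVars false

/-- traces -/
theorem trace_pos_of_proj (A : H d n) (h1 : Aᴴ = A) (h2 : A * A = A) (h : A ≠ 0) :
    0 < A.trace := by
  have h3 : A.trace = (Aᴴ * A).trace := by rw [h1, h2]
  have h4 : 0 ≤ (Aᴴ * A).trace := (posSemidef_conjTranspose_mul_self A).trace_nonneg
  rw [h3]
  refine lt_of_le_of_ne h4 fun h5 => h ?_
  exact trace_conjTranspose_mul_self_eq_zero_iff.1 h5.symm


/-- real trace -/
noncomputable def tau (A : H d n) : ℝ := A.trace.re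

namespace Good
variable [NeZero d] {P : (Fin d → ℕ) → H d n} (G : Good P) {p q : (Fin d → ℕ) × Fin d}
include G

theorem trace_P_pos {α} (hα : α ∈ Sn d n) : 0 < (P α).trace :=
  trace_pos_of_proj _ (G.star α) (G.sq hα) (G.ne α hα)

theorem tau_pos {α} (hα : α ∈ Sn d n) : 0 < tau (P α) :=
  (Complex.pos_iff.1 (G.trace_P_pos hα)).1

theorem trace_P {α} (hα : α ∈ Sn d n) : (P α).trace = (tau (P α) : ℂ) := by
  apply Complex.ext
  · simp [tau]
  · simpa using (Complex.pos_iff.1 (G.trace_P_pos hα)).2.symm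

theorem tau_Q (hp : p ∈ Tn d n) : tau (Qp P p) = yy p.1 p.2 * tau (P p.1) := by
  obtain ⟨h1, h2⟩ := mem_Tn.1 hp
  rw [tau, ← trace_pt, Qp, G.pt_Q h1, trace_smul, tau]
  simp

theorem yy_pos (hp : p ∈ Tn d n) : 0 < yy p.1 p.2 := by
  obtain ⟨h1, h2⟩ := mem_Tn.1 hp
  have h := trace_pos_of_proj (Qp P p) (G.Q_star _ _) (by rw [G.Qp_mul hp hp, if_pos rfl])
    (G.Q_ne h1 _ (mem_Sn.1 h2).1)
  have h3 : 0 < tau (Qp P p) := (Complex.pos_iff.1 h).1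
  rw [G.tau_Q hp] at h3
  exact pos_of_mul_pos_left h3 (G.tau_pos h1).le

theorem dim_formula (hp : p ∈ Tn d n) :
    (n + 1 : ℝ) * yy p.1 p.2 ^ 2 * tau (P p.1) = rr p * tau (nextP P (tgt p)) := by
  obtain ⟨h1, h2⟩ := mem_Tn.1 hp
  have h3 : tau (avg d n (Qp P p)) = (n + 1 : ℝ) * tau (Qp P p) := by
    have : ∀ a : Fin (n + 1), (pm (tr a) * Qp P p * pm (tr a)).trace = (Qp P p).trace := by
      intro a
      rw [trace_mul_cycle, tr_sq, one_mul]
    rw [tau, tau, avg_apply, trace_sum, Finset.sum_congr rfl fun a _ => this a]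
    simp
  rw [Qp, G.avg_Q h1 p.2 h2, ← Qp, G.tau_Q hp, tau, trace_smul] at h3
  have h4 : zz (tgt p) p.2 * tau (nextP P (tgt p)) = (n + 1 : ℝ) * (yy p.1 p.2 * tau (P p.1)) := by
    rw [← h3, tau, Complex.smul_re]; rfl
  have h := yy_mul_zz (mem_Sn.1 h1).1 (mem_Sn.1 h2).1
  rw [rr, ← h, show p.1 + Pi.single p.2 1 = tgt p from rfl]
  linear_combination (- yy p.1 p.2) * h4

theorem E_mul : (∑ p ∈ Tn d n, Fg P p) * (∑ p ∈ Tn d n, Fg P p) = ∑ p ∈ Tn d n, Fg P p := by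
  classical
  rw [Finset.sum_mul]
  refine Finset.sum_congr rfl fun p hp => ?_
  rw [Finset.mul_sum, Finset.sum_congr rfl fun q hq => G.F_mul hp hq, Finset.sum_ite_eq, if_pos hp]

theorem lin_mul (f g : (Fin d → ℕ) × Fin d → ℝ) :
    (∑ p ∈ Tn d n, f p • Fg P p) * (∑ p ∈ Tn d n, g p • Fg P p) =
      ∑ p ∈ Tn d n, (f p * g p) • Fg P p := by
  classical
  rw [Finset.sum_mul]
  refine Finset.sum_congr rfl fun p hp => ?_
  rw [Finset.mul_sum, Finset.sum_congr rfl fun q hq => by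
    rw [smul_mul_smul_comm, G.F_mul hp hq, smul_ite, smul_zero], Finset.sum_ite_eq, if_pos hp]

theorem lin_star (f : (Fin d → ℕ) × Fin d → ℝ) :
    (∑ p ∈ Tn d n, f p • Fg P p)ᴴ = ∑ p ∈ Tn d n, f p • Fg P p := by
  rw [conjTranspose_sum]
  refine Finset.sum_congr rfl fun p hp => ?_
  rw [conjTranspose_smul, G.F_star hp, star_trivial]

theorem lin_T (f : (Fin d → ℕ) × Fin d → ℝ) (a) :
    Commute (∑ p ∈ Tn d n, f p • Fg P p) (T d n a) :=
  Commute.sum_left _ _ _ fun _ hp => (G.F_T hp a).smul_left _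

theorem lin_W (f : (Fin d → ℕ) × Fin d → ℝ) :
    (∑ p ∈ Tn d n, f p • Fg P p) * W d n =
      io d (n + 1) (∑ p ∈ Tn d n, f p • Qp P p) * W d n := by
  rw [map_sum, Matrix.sum_mul, Matrix.sum_mul]
  refine Finset.sum_congr rfl fun p hp => ?_
  rw [map_smul, Matrix.smul_mul, Matrix.smul_mul, G.F_W hp]

theorem WH_lin_W (f : (Fin d → ℕ) × Fin d → ℝ) :
    (W d n)ᴴ * (∑ p ∈ Tn d n, f p • Fg P p) * W d n =
      ∑ p ∈ Tn d n, (f p * yy p.1 p.2) • P p.1 := by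
  rw [Matrix.mul_assoc, G.lin_W, ← Matrix.mul_assoc, WH_io_W, map_sum]
  refine Finset.sum_congr rfl fun p hp => ?_
  rw [map_smul, Qp, G.pt_Q (mem_Tn.1 hp).1, smul_smul]

theorem pt_lin (f : (Fin d → ℕ) × Fin d → ℝ) :
    pt d (n + 1) (∑ p ∈ Tn d n, f p • Fg P p) =
      ∑ p ∈ Tn d n, (f p * (yy p.1 p.2)⁻¹) • nextP P (tgt p) := by
  rw [map_sum]
  refine Finset.sum_congr rfl fun p hp => ?_
  rw [map_smul, G.pt_F hp, smul_smul]

theorem F_psd (hp : p ∈ Tn d n) : (Fg P p).PosSemidef := by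
  have := posSemidef_conjTranspose_mul_self (Fg P p)
  rwa [G.F_star hp, G.F_mul hp hp, if_pos rfl] at this

theorem P_psd {α} (hα : α ∈ Sn d n) : (P α).PosSemidef := by
  have := posSemidef_conjTranspose_mul_self (P α)
  rwa [G.star, G.sq hα] at this
end Good

theorem psd_real_smul {ι : Type*} [Fintype ι] {A : Matrix ι ι ℂ} (hA : A.PosSemidef) {c : ℝ}
    (hc : 0 ≤ c) :
    (c • A).PosSemidef := by
  have : c • A = (c : ℂ) • A := by ext i j; simp
  rw [this]
  exact hA.smul (by exact_mod_cast hc)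

open scoped MatrixOrder in
theorem psd_factor {ι : Type*} [Fintype ι] [DecidableEq ι] {B : Matrix ι ι ℂ}
    (hB : B.PosSemidef) : ∃ C : Matrix ι ι ℂ, B = Cᴴ * C := by
  obtain ⟨C, rfl⟩ := CStarAlgebra.nonneg_iff_eq_star_mul_self.mp hB.nonneg
  exact ⟨C, rfl⟩

theorem psd_trace_mul {ι : Type*} [Fintype ι] [DecidableEq ι] {A B : Matrix ι ι ℂ}
    (hA : A.PosSemidef) (hB : B.PosSemidef) : 0 ≤ (A * B).trace := by
  obtain ⟨C, hC⟩ := psd_factor hB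
  rw [hC]
  rw [← Matrix.mul_assoc, trace_mul_comm, ← Matrix.mul_assoc]
  exact (hA.mul_mul_conjTranspose_same C).trace_nonneg

end PBT

open scoped ComplexOrder

namespace PBT
open Matrix Finset

variable {d n : ℕ}

open scoped Classical in
/-- The up operator. -/
noncomputable def RR (d n : ℕ) (v : (Fin d → ℕ) → ℝ) (α : Fin d → ℕ) : ℝ :=
  ∑ q ∈ (Tn d n).filter (fun q => q.1 = α), v (tgt q)

theorem RR_pos [NeZero d] {v : (Fin d → ℕ) → ℝ} (hv : ∀ μ ∈ Sn d (n + 1), 0 < v μ) {α}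
    (hα : α ∈ Sn d n) : 0 < RR d n v α := by
  classical
  unfold RR
  refine Finset.sum_pos (fun q hq => ?_) ⟨(α, 0), ?_⟩
  · rw [Finset.mem_filter] at hq
    exact hv _ (mem_Tn.1 hq.1).2
  · rw [Finset.mem_filter, mem_Tn]
    refine ⟨⟨hα, ?_⟩, rfl⟩
    rw [tgt, add_single_mem hα]
    intro i j hij
    have := (mem_Sn.1 hα).1 hij
    simp only [Pi.add_apply]
    rcases eq_or_ne j 0 with rfl | hj
    · have : i = 0 := le_antisymm hij (Fin.zero_le _)
      rw [this]
    · rw [Pi.single_eq_of_ne hj]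
      exact le_trans this (Nat.le_add_right _ _)

theorem psd_sum {ι κ : Type*} [Fintype ι] (s : Finset κ) (A : κ → Matrix ι ι ℂ)
    (h : ∀ k ∈ s, (A k).PosSemidef) : (∑ k ∈ s, A k).PosSemidef := by
  classical
  induction s using Finset.induction_on with
  | empty => simpa using Matrix.PosSemidef.zero
  | insert a s ha ih =>
    rw [Finset.sum_insert ha]
    exact (h a (Finset.mem_insert_self _ _)).add
      (ih fun k hk => h k (Finset.mem_insert_of_mem hk))

theorem trace_mul_mono {ι : Type*} [Fintype ι] [DecidableEq ι] {A B C : Matrix ι ι ℂ}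
    (hA : A.PosSemidef) (h : (C - B).PosSemidef) : (A * B).trace.re ≤ (A * C).trace.re := by
  have h1 := psd_trace_mul hA h
  rw [Matrix.mul_sub, trace_sub] at h1
  have := (Complex.le_def.1 h1).1
  simpa using this

theorem trace_mul_mono' {ι : Type*} [Fintype ι] [DecidableEq ι] {A B C : Matrix ι ι ℂ}
    (hA : A.PosSemidef) (h : (C - B).PosSemidef) : (B * A).trace.re ≤ (C * A).trace.re := by
  rw [trace_mul_comm B, trace_mul_comm C]; exact trace_mul_mono hA h

namespace Good
variable [NeZero d] {P : (Fin d → ℕ) → H d n} (G : Good P) {p q : (Fin d → ℕ) × Fin d}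
include G

theorem lin_psd (f : (Fin d → ℕ) × Fin d → ℝ) (hf : ∀ p ∈ Tn d n, 0 ≤ f p) :
    (∑ p ∈ Tn d n, f p • Fg P p).PosSemidef :=
  psd_sum _ _ fun p hp => psd_real_smul (G.F_psd hp) (hf p hp)

theorem E_lin (f : (Fin d → ℕ) × Fin d → ℝ) :
    (∑ p ∈ Tn d n, Fg P p) * (∑ p ∈ Tn d n, f p • Fg P p) = ∑ p ∈ Tn d n, f p • Fg P p := by
  have := G.lin_mul (fun _ => 1) f
  simpa using this

theorem E_star : (∑ p ∈ Tn d n, Fg P p)ᴴ = ∑ p ∈ Tn d n, Fg P p := by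
  have := G.lin_star (fun _ => 1)
  simpa using this

theorem WH_E : (W d n)ᴴ * (∑ p ∈ Tn d n, Fg P p) = (W d n)ᴴ := by
  have := congrArg conjTranspose G.E_W
  rwa [conjTranspose_mul, G.E_star] at this

theorem C_psd (k : (Fin d → ℕ) × Fin d → ℝ) (hk : ∀ p ∈ Tn d n, 0 < k p)
    (h1 : ∑ p ∈ Tn d n, ((k p)⁻¹ * yy p.1 p.2) • P p.1 = 1) :
    ((∑ p ∈ Tn d n, k p • Fg P p) - W d n * (W d n)ᴴ).PosSemidef := by
  set Y := ∑ p ∈ Tn d n, k p • Fg P p with hY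
  set Z := ∑ p ∈ Tn d n, (k p)⁻¹ • Fg P p with hZ
  set E := ∑ p ∈ Tn d n, Fg P p with hE
  have hYZ : Y * Z = E := by
    rw [hY, hZ, G.lin_mul, hE]
    refine Finset.sum_congr rfl fun p hp => ?_
    rw [mul_inv_cancel₀ (hk p hp).ne', one_smul]
  have hZY : Z * Y = E := by
    rw [hY, hZ, G.lin_mul, hE]
    refine Finset.sum_congr rfl fun p hp => ?_
    rw [inv_mul_cancel₀ (hk p hp).ne', one_smul]
  have hEY : E * Y = Y := G.E_lin k
  have hEW : E * W d n = W d n := G.E_W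
  have hWE : (W d n)ᴴ * E = (W d n)ᴴ := G.WH_E
  have hWZ : (W d n)ᴴ * Z * W d n = 1 := by rw [hZ, G.WH_lin_W, h1]
  have hYs : Yᴴ = Y := G.lin_star k
  have hC : (Y - W d n * (W d n)ᴴ) = (Y - W d n * (W d n)ᴴ) * Z * (Y - W d n * (W d n)ᴴ)ᴴ := by
    have e0 : (Y - W d n * (W d n)ᴴ)ᴴ = Y - W d n * (W d n)ᴴ := by
      rw [conjTranspose_sub, hYs, conjTranspose_mul, conjTranspose_conjTranspose]
    have e1 : (W d n * (W d n)ᴴ) * Z * Y = W d n * (W d n)ᴴ := by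
      rw [Matrix.mul_assoc, hZY, Matrix.mul_assoc, hWE]
    have e2 : E * (W d n * (W d n)ᴴ) = W d n * (W d n)ᴴ := by
      rw [← Matrix.mul_assoc, hEW]
    have e3 : (W d n * (W d n)ᴴ) * Z * (W d n * (W d n)ᴴ) = W d n * (W d n)ᴴ := by
      calc _ = W d n * ((W d n)ᴴ * Z * W d n) * (W d n)ᴴ := by simp only [Matrix.mul_assoc]
        _ = _ := by rw [hWZ, Matrix.mul_one]
    rw [e0, Matrix.sub_mul, Matrix.sub_mul, Matrix.mul_sub, Matrix.mul_sub, hYZ, hEY, e1, e2, e3]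
    abel
  rw [hC]
  exact (G.lin_psd _ fun p hp => (inv_pos.2 (hk p hp)).le).mul_mul_conjTranspose_same _

theorem Y_psd (k : (Fin d → ℕ) × Fin d → ℝ) (hk : ∀ p ∈ Tn d n, 0 < k p)
    (h1 : ∑ p ∈ Tn d n, ((k p)⁻¹ * yy p.1 p.2) • P p.1 = 1) (a) :
    ((∑ p ∈ Tn d n, k p • Fg P p) - Ph d n a).PosSemidef := by
  have h := (G.C_psd k hk h1).mul_mul_conjTranspose_same (T d n a)
  rw [T_star, Matrix.mul_sub, Matrix.sub_mul, ← (G.lin_T k a).eq] at h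
  rwa [Matrix.mul_assoc _ (T d n a) (T d n a), T_sq, Matrix.mul_one] at h

set_option maxHeartbeats 1000000 in
theorem upper (v : (Fin d → ℕ) → ℝ) (hv : ∀ μ ∈ Sn d (n + 1), 0 < v μ) (L : ℝ)
    (hL : ∀ μ ∈ Sn d (n + 1),
      (by classical exact ∑ p ∈ (Tn d n).filter (fun p => tgt p = μ), RR d n v p.1) ≤ L * v μ)
    {x : ℝ} (hx : x ∈ pbtFidelitySet d (n + 1)) : x ≤ (1 / (d : ℝ) ^ 2) * L := by
  classical
  obtain ⟨Qa, X, hQa, hX, hle, htr, hxe⟩ := hx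
  set k : (Fin d → ℕ) × Fin d → ℝ := fun p => yy p.1 p.2 * RR d n v p.1 / v (tgt p) with hkdef
  have hk : ∀ p ∈ Tn d n, 0 < k p := fun p hp =>
    div_pos (mul_pos (G.yy_pos hp) (RR_pos hv (mem_Tn.1 hp).1)) (hv _ (mem_Tn.1 hp).2)
  have h1 : ∑ p ∈ Tn d n, ((k p)⁻¹ * yy p.1 p.2) • P p.1 = 1 := by
    rw [← G.sum, ← Finset.sum_fiberwise_of_maps_to (s := Tn d n) (t := Sn d n)
      (g := fun p => p.1) (fun p hp => (mem_Tn.1 hp).1)]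
    refine Finset.sum_congr rfl fun α hα => ?_
    have hR := RR_pos hv hα
    have : ∀ p ∈ (Tn d n).filter (fun p => p.1 = α), ((k p)⁻¹ * yy p.1 p.2) • P p.1 =
        (v (tgt p) * (RR d n v α)⁻¹) • P α := by
      intro p hp
      obtain ⟨hp', hpe⟩ := Finset.mem_filter.1 hp
      rw [← hpe]
      congr 1
      have := (G.yy_pos hp').ne'
      have h2 := (hv _ (mem_Tn.1 hp').2).ne'
      have h3 := (RR_pos hv (mem_Tn.1 hp').1).ne'
      simp only [hkdef]
      field_simp
    rw [Finset.sum_congr rfl this, ← Finset.sum_smul, ← Finset.sum_mul]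
    change (RR d n v α * _) • _ = _
    rw [mul_inv_cancel₀ hR.ne', one_smul]
  set Y := ∑ p ∈ Tn d n, k p • Fg P p with hY
  have hYp := G.Y_psd k hk h1
  have hY0 : Y.PosSemidef := G.lin_psd k fun p hp => (hk p hp).le
  have hpt : (L • (1 : H d (n + 1)) - pt d (n + 1) Y).PosSemidef := by
    rw [hY, G.pt_lin, ← Finset.sum_fiberwise_of_maps_to (s := Tn d n) (t := Sn d (n + 1))
      (g := tgt) (fun p hp => (mem_Tn.1 hp).2), ← G.next_sum, Finset.smul_sum,
      ← Finset.sum_sub_distrib]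
    refine psd_sum _ _ fun μ hμ => ?_
    have : ∀ p ∈ (Tn d n).filter (fun p => tgt p = μ), (k p * (yy p.1 p.2)⁻¹) • nextP P (tgt p) =
        (RR d n v p.1 * (v μ)⁻¹) • nextP P μ := by
      intro p hp
      obtain ⟨hp', hpe⟩ := Finset.mem_filter.1 hp
      rw [← hpe]
      congr 1
      have := (G.yy_pos hp').ne'
      have h2 := (hv _ (mem_Tn.1 hp').2).ne'
      have h3 := (RR_pos hv (mem_Tn.1 hp').1).ne'
      simp only [hkdef]
      field_simp
    rw [Finset.sum_congr rfl this, ← Finset.sum_smul, ← Finset.sum_mul, ← sub_smul]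
    refine psd_real_smul (G.next.P_psd hμ) ?_
    rw [sub_nonneg, mul_inv_le_iff₀ (hv μ hμ)]
    exact hL μ hμ
  have hd0 : (0 : ℝ) < d := by exact_mod_cast Nat.pos_of_ne_zero (NeZero.ne d)
  have hD : (0 : ℝ) < (d : ℝ) ^ (n + 1) := by positivity
  have key : ∑ a, (Qa a * Ph d n a).trace.re ≤ L * (d : ℝ) ^ (n + 1) := by
    calc ∑ a, (Qa a * Ph d n a).trace.re ≤ ∑ a, (Qa a * Y).trace.re :=
          Finset.sum_le_sum fun a _ => trace_mul_mono (hQa a) (hYp a)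
      _ = ((∑ a, Qa a) * Y).trace.re := by rw [Finset.sum_mul, trace_sum, Complex.re_sum]
      _ ≤ (io d (n + 1) X * Y).trace.re := trace_mul_mono' hY0 hle
      _ = (X * pt d (n + 1) Y).trace.re := by rw [trace_io_mul]
      _ ≤ (X * (L • (1 : H d (n + 1)))).trace.re := trace_mul_mono hX hpt
      _ = L * (d : ℝ) ^ (n + 1) := by
        rw [Matrix.mul_smul, Matrix.mul_one, trace_smul, htr, Complex.real_smul,
          Complex.re_ofReal_mul]
        congr 1
        exact_mod_cast Complex.ofReal_re ((d : ℝ) ^ (n + 1))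
  have hx2 : x = (1 / (d : ℝ) ^ 2) * (((d : ℝ) ^ (n + 1))⁻¹ * ∑ a, (Qa a * Ph d n a).trace.re) := by
    have e : ∀ a, (Qa a * sigmaPBT d (n + 1) a).trace =
        (((d : ℝ) ^ (n + 1))⁻¹ : ℝ) * (Qa a * Ph d n a).trace := by
      intro a
      rw [sigma_eq, Matrix.mul_smul, trace_smul, Complex.real_smul]
    rw [Finset.sum_congr rfl fun a _ => e a, ← Finset.mul_sum] at hxe
    have h2 : (1 / (d : ℂ) ^ 2) = ((1 / (d : ℝ) ^ 2 : ℝ) : ℂ) := by push_cast; rfl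
    have := congrArg Complex.re hxe
    rwa [h2, Complex.re_ofReal_mul, Complex.re_ofReal_mul, Complex.ofReal_re, Complex.re_sum] at this
  rw [hx2]
  refine mul_le_mul_of_nonneg_left ?_ (by positivity)
  rw [inv_mul_le_iff₀ hD]
  linarith

end Good
end PBT

open scoped ComplexOrder

namespace PBT
open Matrix Finset

variable {d n : ℕ}

theorem io_psd {X : H d n} (hX : X.PosSemidef) : (io d n X).PosSemidef := by
  obtain ⟨C, rfl⟩ := psd_factor hX
  rw [map_mul, ← io_conjTranspose]
  exact posSemidef_conjTranspose_mul_self _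

theorem Ph_psd (a : Fin (n + 1)) : (Ph d n a).PosSemidef := by
  have := (posSemidef_self_mul_conjTranspose (W d n)).mul_mul_conjTranspose_same (T d n a)
  rwa [T_star] at this

namespace Good
variable [NeZero d] {P : (Fin d → ℕ) → H d n} (G : Good P) {p q : (Fin d → ℕ) × Fin d}
include G

theorem E_io (c : (Fin d → ℕ) → ℝ) :
    (∑ p ∈ Tn d n, Fg P p) * io d (n + 1) (∑ μ ∈ Sn d (n + 1), c μ • nextP P μ) =
      ∑ p ∈ Tn d n, c (tgt p) • Fg P p := by
  classical
  rw [Finset.sum_mul]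
  refine Finset.sum_congr rfl fun p hp => ?_
  rw [map_sum, Finset.mul_sum, Finset.sum_eq_single_of_mem (tgt p) (mem_Tn.1 hp).2]
  · rw [map_smul, mul_smul_comm, G.F_io hp, if_pos rfl]
  · intro ν _ hν
    rw [map_smul, mul_smul_comm, G.F_io hp, if_neg (Ne.symm hν), smul_zero]

theorem X_psd (c : (Fin d → ℕ) → ℝ) (hc : ∀ μ ∈ Sn d (n + 1), 0 ≤ c μ) :
    (∑ μ ∈ Sn d (n + 1), c μ • nextP P μ).PosSemidef :=
  psd_sum _ _ fun μ hμ => psd_real_smul (G.next.P_psd hμ) (hc μ hμ)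

theorem X_sub_psd (c : (Fin d → ℕ) → ℝ) (hc : ∀ μ ∈ Sn d (n + 1), 0 ≤ c μ) :
    (io d (n + 1) (∑ μ ∈ Sn d (n + 1), c μ • nextP P μ) -
      ∑ p ∈ Tn d n, c (tgt p) • Fg P p).PosSemidef := by
  have h1 := G.E_io c
  have hX := io_psd (G.X_psd c hc)
  set E := ∑ p ∈ Tn d n, Fg P p with hE
  set Y := io d (n + 1) (∑ μ ∈ Sn d (n + 1), c μ • nextP P μ) with hY
  set S := ∑ p ∈ Tn d n, c (tgt p) • Fg P p with hS
  have hEs : Eᴴ = E := G.E_star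
  have hSs : Sᴴ = S := G.lin_star fun p => c (tgt p)
  have hYs : Yᴴ = Y := hX.1
  have h2 : Y * E = S := by
    have := congrArg conjTranspose h1
    rwa [conjTranspose_mul, hEs, hYs, hSs] at this
  have h3 : S * E = S := by
    have := congrArg conjTranspose (G.E_lin fun p => c (tgt p))
    rw [conjTranspose_mul] at this
    change Sᴴ * Eᴴ = Sᴴ at this
    rwa [hEs, hSs] at this
  have h4 := hX.mul_mul_conjTranspose_same (1 - E)
  rw [conjTranspose_sub, conjTranspose_one, hEs, Matrix.sub_mul, Matrix.one_mul, h1,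
    Matrix.mul_sub, Matrix.mul_one, Matrix.sub_mul, h2, h3] at h4
  simpa using h4

theorem val (b : (Fin d → ℕ) × Fin d → ℝ) (a) :
    ((∑ p ∈ Tn d n, b p • Fg P p) * Ph d n a * (∑ p ∈ Tn d n, b p • Fg P p) * Ph d n a).trace =
    ((∑ p ∈ Tn d n, (b p * yy p.1 p.2) • P p.1) *
      (∑ p ∈ Tn d n, (b p * yy p.1 p.2) • P p.1)).trace := by
  rw [← G.WH_lin_W]
  have hT := (G.lin_T b a).eq
  set B := ∑ p ∈ Tn d n, b p • Fg P p with hB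
  have h1 : B * Ph d n a = T d n a * (B * (W d n * (W d n)ᴴ)) * T d n a := by
    rw [Ph, ← Matrix.mul_assoc, ← Matrix.mul_assoc, hT, Matrix.mul_assoc (T d n a)]
  have h2 : B * Ph d n a * B * Ph d n a =
      T d n a * (B * (W d n * (W d n)ᴴ) * (B * (W d n * (W d n)ᴴ))) * T d n a := by
    rw [Matrix.mul_assoc (B * Ph d n a), h1]
    calc _ = T d n a * (B * (W d n * (W d n)ᴴ)) * (T d n a * T d n a) *
          (B * (W d n * (W d n)ᴴ)) * T d n a := by simp only [Matrix.mul_assoc]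
      _ = _ := by rw [T_sq, Matrix.mul_one]; simp only [Matrix.mul_assoc]
  rw [h2, trace_mul_comm, ← Matrix.mul_assoc, T_sq, Matrix.one_mul]
  have h3 : B * (W d n * (W d n)ᴴ) * (B * (W d n * (W d n)ᴴ)) =
    (B * W d n * ((W d n)ᴴ * B * W d n)) * (W d n)ᴴ := by simp only [Matrix.mul_assoc]
  rw [h3, trace_mul_comm]
  simp only [Matrix.mul_assoc]

theorem P_lin_sq (g : (Fin d → ℕ) → ℝ) :
    ((∑ α ∈ Sn d n, g α • P α) * (∑ α ∈ Sn d n, g α • P α)).trace =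
      ((∑ α ∈ Sn d n, g α ^ 2 * tau (P α) : ℝ) : ℂ) := by
  rw [Finset.sum_mul, trace_sum, Complex.ofReal_sum]
  refine Finset.sum_congr rfl fun α hα => ?_
  rw [Finset.mul_sum, Finset.sum_eq_single_of_mem α hα]
  · rw [smul_mul_smul_comm, G.sq hα, trace_smul, G.trace_P hα, Complex.real_smul]
    push_cast; ring
  · intro β hβ hne
    rw [smul_mul_smul_comm, G.mul _ hα _ hβ, if_neg hne.symm, smul_zero]

set_option maxHeartbeats 1000000 in
theorem lower (v : (Fin d → ℕ) → ℝ) (hv : ∑ μ ∈ Sn d (n + 1), v μ ^ 2 = 1) :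
    (1 / (d : ℝ) ^ 2) * ∑ α ∈ Sn d n, RR d n v α ^ 2 ∈ pbtFidelitySet d (n + 1) := by
  classical
  have hd0 : (0 : ℝ) < d := by exact_mod_cast Nat.pos_of_ne_zero (NeZero.ne d)
  set D : ℝ := (d : ℝ) ^ (n + 1) with hDdef
  have hD : (0 : ℝ) < D := by positivity
  have hn : (0 : ℝ) < (n : ℝ) + 1 := by positivity
  set s : (Fin d → ℕ) → ℝ := fun α => √(D / ((n + 1) * tau (P α))) with hs
  have hs2 : ∀ α ∈ Sn d n, s α ^ 2 = D / ((n + 1) * tau (P α)) := by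
    intro α hα
    have := G.tau_pos hα
    exact Real.sq_sqrt (by positivity)
  set b : (Fin d → ℕ) × Fin d → ℝ := fun p => v (tgt p) * s p.1 / yy p.1 p.2 with hb
  set c : (Fin d → ℕ) → ℝ := fun μ => D * v μ ^ 2 / tau (nextP P μ) with hc
  have hc0 : ∀ μ ∈ Sn d (n + 1), 0 ≤ c μ := by
    intro μ hμ
    have := G.next.tau_pos hμ
    simp only [hc]
    positivity
  have hbc : ∀ p ∈ Tn d n, b p * (b p * rr p) = c (tgt p) := by
    intro p hp
    have h1 := G.dim_formula hp
    have h2 := G.yy_pos hp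
    have h3 := G.tau_pos (mem_Tn.1 hp).1
    have h4 := G.next.tau_pos (mem_Tn.1 hp).2
    have e : b p * (b p * rr p) = v (tgt p) ^ 2 * s p.1 ^ 2 / yy p.1 p.2 ^ 2 * rr p := by
      simp only [hb]; ring
    rw [e, hs2 _ (mem_Tn.1 hp).1]
    simp only [hc]
    field_simp
    linear_combination (-(v (tgt p)) ^ 2 : ℝ) * h1
  set B := ∑ p ∈ Tn d n, b p • Fg P p with hB
  have hBs : Bᴴ = B := G.lin_star b
  have hsum : ∑ a, B * Ph d n a * B = ∑ p ∈ Tn d n, c (tgt p) • Fg P p := by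
    rw [← Finset.sum_mul, ← Finset.mul_sum, Matrix.mul_assoc]
    have : (∑ a, Ph d n a) * B = ∑ p ∈ Tn d n, (b p * rr p) • Fg P p := by
      rw [hB, Finset.mul_sum]
      refine Finset.sum_congr rfl fun p hp => ?_
      rw [mul_smul_comm, G.rho_F hp, smul_smul]
    rw [this, hB, G.lin_mul]
    exact Finset.sum_congr rfl fun p hp => by rw [hbc p hp]
  refine ⟨fun a => B * Ph d n a * B, ∑ μ ∈ Sn d (n + 1), c μ • nextP P μ, ?_, G.X_psd c hc0, ?_, ?_, ?_⟩
  · intro a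
    have := (Ph_psd (d := d) a).mul_mul_conjTranspose_same B
    rwa [hBs] at this
  · rw [hsum]
    exact G.X_sub_psd c hc0
  · rw [trace_sum]
    have : ∀ μ ∈ Sn d (n + 1), (c μ • nextP P μ).trace = ((D * v μ ^ 2 : ℝ) : ℂ) := by
      intro μ hμ
      have h4 := G.next.tau_pos hμ
      rw [trace_smul, G.next.trace_P hμ, Complex.real_smul, ← Complex.ofReal_mul]
      congr 1
      simp only [hc]
      field_simp
    rw [Finset.sum_congr rfl this, ← Complex.ofReal_sum, ← Finset.mul_sum, hv, mul_one, hDdef]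
    push_cast; rfl
  · have hM : ∑ p ∈ Tn d n, (b p * yy p.1 p.2) • P p.1 =
        ∑ α ∈ Sn d n, (s α * RR d n v α) • P α := by
      rw [← Finset.sum_fiberwise_of_maps_to (s := Tn d n) (t := Sn d n)
        (g := fun p => p.1) (fun p hp => (mem_Tn.1 hp).1)]
      refine Finset.sum_congr rfl fun α hα => ?_
      have : ∀ p ∈ (Tn d n).filter (fun p => p.1 = α), (b p * yy p.1 p.2) • P p.1 =
          (s α * v (tgt p)) • P α := by
        intro p hp
        obtain ⟨hp', hpe⟩ := Finset.mem_filter.1 hp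
        rw [← hpe]
        congr 1
        have := (G.yy_pos hp').ne'
        simp only [hb]
        field_simp
      rw [Finset.sum_congr rfl this, ← Finset.sum_smul, ← Finset.mul_sum]
      rfl
    have hval : ∀ a, (B * Ph d n a * B * sigmaPBT d (n + 1) a).trace =
        ((((n : ℝ) + 1)⁻¹ * ∑ α ∈ Sn d n, RR d n v α ^ 2 : ℝ) : ℂ) := by
      intro a
      rw [sigma_eq, Matrix.mul_smul, trace_smul, G.val, hM, G.P_lin_sq, Complex.real_smul,
        ← Complex.ofReal_mul]
      congr 1
      rw [Finset.mul_sum, Finset.mul_sum]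
      refine Finset.sum_congr rfl fun α hα => ?_
      have := G.tau_pos hα
      rw [mul_pow, hs2 α hα, ← hDdef]
      field_simp
    rw [Finset.sum_congr rfl fun a _ => hval a, Finset.sum_const, Finset.card_univ, Fintype.card_fin]
    rw [nsmul_eq_mul]
    push_cast
    have : ((n : ℂ) + 1) ≠ 0 := by exact_mod_cast hn.ne'
    field_simp

end Good
end PBT

open scoped ComplexOrder

namespace PBT
open Matrix Finset

variable {d n N : ℕ}

/-- row lengths -/
def row (d : ℕ) (μ : YoungDiagram) : Fin d → ℕ := fun i => μ.rowLen i

theorem lt_of_mem {μ : YoungDiagram} (h : μ.colLen 0 ≤ d) {i j : ℕ} (hm : (i, j) ∈ μ) : i < d := by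
  have : (i, 0) ∈ μ := μ.up_left_mem le_rfl (Nat.zero_le _) hm
  rw [YoungDiagram.mem_iff_lt_colLen] at this
  omega

theorem row_le_iff {μ ν : YoungDiagram} (h : μ.colLen 0 ≤ d) : row d μ ≤ row d ν ↔ μ ≤ ν := by
  constructor
  · rintro hr ⟨i, j⟩ hm
    have hi := lt_of_mem h hm
    have h1 := hr ⟨i, hi⟩
    rw [YoungDiagram.mem_iff_lt_rowLen] at hm
    rw [YoungDiagram.mem_iff_lt_rowLen]
    exact lt_of_lt_of_le hm h1
  · intro hl i
    by_contra hc
    have h1 : ν.rowLen i < μ.rowLen i := not_le.1 hc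
    have h2 := hl (YoungDiagram.mem_iff_lt_rowLen.2 h1)
    rw [YoungDiagram.mem_iff_lt_rowLen] at h2
    exact lt_irrefl _ h2

theorem row_inj {μ ν : YoungDiagram} (h : μ.colLen 0 ≤ d) (h' : ν.colLen 0 ≤ d)
    (he : row d μ = row d ν) : μ = ν :=
  le_antisymm ((row_le_iff h).1 he.le) ((row_le_iff h').1 he.ge)

theorem sum_row {μ : YoungDiagram} (h : μ.colLen 0 ≤ d) : ∑ i, row d μ i = μ.card := by
  have : ∑ i, row d μ i = ∑ i ∈ Finset.range d, μ.rowLen i := by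
    rw [Finset.sum_range]; rfl
  rw [this, YoungDiagram.card, Finset.card_eq_sum_card_fiberwise (f := Prod.fst)
    (t := Finset.range d)]
  · refine Finset.sum_congr rfl fun i _ => ?_
    rw [YoungDiagram.rowLen_eq_card]; rfl
  · rintro ⟨i, j⟩ hm
    simpa using lt_of_mem h ((YoungDiagram.mem_cells _).1 hm)

theorem row_mem {μ : YoungDiagram} (h : μ.card = N ∧ μ.colLen 0 ≤ d) : row d μ ∈ Sn d N := by
  rw [mem_Sn]
  refine ⟨fun i j hij => μ.rowLen_anti _ _ hij, ?_⟩
  rw [sum_row h.2, h.1]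

theorem exists_row {w : Fin d → ℕ} (hw : w ∈ Sn d N) :
    ∃ μ : YoungDiagram, (μ.card = N ∧ μ.colLen 0 ≤ d) ∧ row d μ = w := by
  classical
  obtain ⟨ha, hs⟩ := mem_Sn.1 hw
  have hle : ∀ i, w i ≤ N := fun i => by
    rw [← hs]; exact Finset.single_le_sum (fun _ _ => Nat.zero_le _) (Finset.mem_univ i)
  let μ : YoungDiagram :=
    { cells := (Finset.range d ×ˢ Finset.range N).filter
        fun c => ∃ h : c.1 < d, c.2 < w ⟨c.1, h⟩
      isLowerSet := by
        rintro ⟨i, j⟩ ⟨i', j'⟩ hl hm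
        simp only [Finset.coe_filter, Finset.mem_product, Finset.mem_range, Set.mem_ofPred_eq] at hm ⊢
        obtain ⟨⟨h1, h2⟩, h3, h4⟩ := hm
        obtain ⟨hl1, hl2⟩ := Prod.mk_le_mk.1 hl
        have hi' : i' < d := lt_of_le_of_lt hl1 h1
        have := ha (show (⟨i', hi'⟩ : Fin d) ≤ ⟨i, h3⟩ from hl1)
        exact ⟨⟨hi', lt_of_le_of_lt hl2 h2⟩, hi', by omega⟩ }
  have hmem : ∀ i j, (i, j) ∈ μ ↔ ∃ h : i < d, j < w ⟨i, h⟩ := by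
    intro i j
    rw [← YoungDiagram.mem_cells]
    simp only [μ, Finset.mem_filter, Finset.mem_product, Finset.mem_range]
    constructor
    · exact fun h => h.2
    · rintro ⟨h, h'⟩
      exact ⟨⟨h, lt_of_lt_of_le h' (hle _)⟩, h, h'⟩
  have hrow : row d μ = w := by
    funext i
    have h : ∀ j, j < row d μ i ↔ j < w i := by
      intro j
      rw [row, ← YoungDiagram.mem_iff_lt_rowLen, hmem]
      exact ⟨fun ⟨_, h⟩ => h, fun h => ⟨i.2, h⟩⟩
    exact le_antisymm (not_lt.1 fun hc => lt_irrefl _ ((h _).1 hc))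
      (not_lt.1 fun hc => lt_irrefl _ ((h _).2 hc))
  have hcol : μ.colLen 0 ≤ d := by
    by_contra hc
    have := (hmem d 0).1 (YoungDiagram.mem_iff_lt_colLen.2 (not_le.1 hc))
    exact lt_irrefl _ this.1
  refine ⟨μ, ⟨?_, hcol⟩, hrow⟩
  rw [← sum_row hcol, hrow, hs]

/-- adding a box -/
def Ad (α μ : Fin d → ℕ) : Prop := ∃ i, α + Pi.single i 1 = μ

theorem Ad.le {α μ : Fin d → ℕ} (h : Ad α μ) : α ≤ μ := by
  obtain ⟨i, rfl⟩ := h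
  exact le_self_add

theorem Ad.sum {α μ : Fin d → ℕ} (h : Ad α μ) : ∑ i, μ i = ∑ i, α i + 1 := by
  obtain ⟨i, rfl⟩ := h
  simp [Finset.sum_add_distrib]

theorem Ad_of {α μ : Fin d → ℕ} (h : α ≤ μ) (hs : ∑ i, μ i = ∑ i, α i + 1) : Ad α μ := by
  have h1 : ∑ i, (μ i - α i) = 1 := by
    have : ∑ i, (μ i - α i) + ∑ i, α i = ∑ i, μ i := by
      rw [← Finset.sum_add_distrib]
      exact Finset.sum_congr rfl fun i _ => Nat.sub_add_cancel (h i)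
    omega
  obtain ⟨i, hi⟩ : ∃ i, μ i - α i ≠ 0 := by
    by_contra hc
    push Not at hc
    rw [Finset.sum_eq_zero fun i _ => hc i] at h1
    omega
  refine ⟨i, ?_⟩
  rw [← Finset.add_sum_erase _ _ (Finset.mem_univ i)] at h1
  have h2 : ∑ j ∈ Finset.univ.erase i, (μ j - α j) = 0 := by omega
  rw [Finset.sum_eq_zero_iff] at h2
  funext j
  have hj : α j ≤ μ j := h j
  rcases eq_or_ne j i with rfl | hne
  · simp; omega
  · have := h2 j (Finset.mem_erase.2 ⟨hne, Finset.mem_univ _⟩)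
    simp [hne]; omega

theorem AddBox_iff {α μ : YoungDiagram} (hα : α.colLen 0 ≤ d) (hμ : μ.colLen 0 ≤ d) :
    AddBox α μ ↔ Ad (row d α) (row d μ) := by
  constructor
  · rintro ⟨h1, h2⟩
    refine Ad_of ((row_le_iff hα).2 h1) ?_
    rw [sum_row hα, sum_row hμ, h2]
  · intro h
    refine ⟨(row_le_iff hα).1 h.le, ?_⟩
    rw [← sum_row hα, ← sum_row hμ, h.sum]

theorem AddBox.col {α μ : YoungDiagram} (h : AddBox α μ) (hμ : μ.colLen 0 ≤ d) :
    α.colLen 0 ≤ d := by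
  by_contra hc
  have h1 := h.1 (YoungDiagram.mem_iff_lt_colLen.2 (not_le.1 hc))
  exact lt_irrefl _ (lt_of_mem hμ h1)

open scoped Classical in
/-- common predecessors -/
noncomputable def cnt (d n : ℕ) (μ ν : Fin d → ℕ) : Finset (Fin d → ℕ) :=
  (Sn d n).filter fun α => Ad α μ ∧ Ad α ν

theorem Ad_min {α μ ν : Fin d → ℕ} (h1 : Ad α μ) (h2 : Ad α ν) (hne : μ ≠ ν) : α = μ ⊓ ν := by
  obtain ⟨i, rfl⟩ := h1
  obtain ⟨j, rfl⟩ := h2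
  have hij : i ≠ j := fun h => hne (by rw [h])
  funext x
  simp only [Pi.inf_apply, Pi.add_apply]
  rcases eq_or_ne x i with rfl | hx
  · simp [hij]
  · rw [Pi.single_eq_of_ne hx]; simp

theorem mem_cnt_of {α μ ν : YoungDiagram} (hμ : μ.card = n + 1 ∧ μ.colLen 0 ≤ d)
    (hν : ν.colLen 0 ≤ d) (h1 : AddBox α μ) (h2 : AddBox α ν) :
    row d α ∈ cnt d n (row d μ) (row d ν) := by
  classical
  have hα := AddBox.col h1 hμ.2
  rw [cnt, Finset.mem_filter]
  refine ⟨row_mem ⟨?_, hα⟩, (AddBox_iff hα hμ.2).1 h1, (AddBox_iff hα hν).1 h2⟩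
  have := h1.2
  omega

theorem exists_of_mem_cnt {a : Fin d → ℕ} {μ ν : YoungDiagram} (hμ : μ.colLen 0 ≤ d)
    (hν : ν.colLen 0 ≤ d) (h : a ∈ cnt d n (row d μ) (row d ν)) :
    ∃ α : YoungDiagram, row d α = a ∧ AddBox α μ ∧ AddBox α ν := by
  classical
  rw [cnt, Finset.mem_filter] at h
  obtain ⟨α, hα, rfl⟩ := exists_row h.1
  exact ⟨α, rfl, (AddBox_iff hα.2 hμ).2 h.2.1, (AddBox_iff hα.2 hν).2 h.2.2⟩

theorem MF_eq (μ ν : PartLE (n + 1) d) :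
    MF (n + 1) d μ ν = ((cnt d n (row d μ.1) (row d ν.1)).card : ℝ) := by
  classical
  unfold MF
  by_cases h : μ = ν
  · subst h
    rw [if_pos rfl]
    congr 1
    rw [nBox, ← Nat.card_eq_finsetCard]
    refine Nat.card_congr (Equiv.ofBijective
      (fun α => (⟨row d α.1, mem_cnt_of μ.2 μ.2.2 α.2 α.2⟩ :
        {x // x ∈ cnt d n (row d μ.1) (row d μ.1)})) ⟨?_, ?_⟩)
    · intro α β hαβ
      exact Subtype.ext (row_inj (AddBox.col α.2 μ.2.2) (AddBox.col β.2 μ.2.2)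
        (congrArg Subtype.val hαβ))
    · rintro ⟨a, ha⟩
      obtain ⟨α, h1, h2, _⟩ := exists_of_mem_cnt μ.2.2 μ.2.2 ha
      exact ⟨⟨α, h2⟩, Subtype.ext h1⟩
  · have hne : row d μ.1 ≠ row d ν.1 := fun hc => h (Subtype.ext (row_inj μ.2.2 ν.2.2 hc))
    rw [if_neg h]
    have hsub : ∀ a ∈ cnt d n (row d μ.1) (row d ν.1), a = row d μ.1 ⊓ row d ν.1 := by
      intro a ha
      rw [cnt, Finset.mem_filter] at ha
      exact Ad_min ha.2.1 ha.2.2 hne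
    by_cases hm : MoveBox μ.1 ν.1
    · rw [if_pos hm]
      obtain ⟨_, α, h1, h2⟩ := hm
      have hmem := mem_cnt_of μ.2 ν.2.2 h1 h2
      have : cnt d n (row d μ.1) (row d ν.1) = {row d α} := by
        ext a
        rw [Finset.mem_singleton]
        constructor
        · intro ha
          rw [hsub a ha, hsub _ hmem]
        · rintro rfl; exact hmem
      rw [this]; simp
    · rw [if_neg hm]
      have : cnt d n (row d μ.1) (row d ν.1) = ∅ := by
        rw [Finset.eq_empty_iff_forall_notMem]
        intro a ha
        obtain ⟨α, _, h1, h2⟩ := exists_of_mem_cnt μ.2.2 ν.2.2 ha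
        exact hm ⟨fun hc => h (Subtype.ext hc), α, h1, h2⟩
      rw [this]; simp

end PBT

open scoped ComplexOrder

namespace PBT
open Matrix Finset

variable {d n N : ℕ}

theorem single_inj' {α : Fin d → ℕ} {i j : Fin d}
    (h : α + Pi.single i 1 = α + Pi.single j 1) : i = j := by
  have h1 := congrFun (add_left_cancel h) i
  by_contra hc
  simp [hc] at h1

open scoped Classical in
theorem RR_eq (v : (Fin d → ℕ) → ℝ) {α} (hα : α ∈ Sn d n) :
    RR d n v α = ∑ ν ∈ Sn d (n + 1), if Ad α ν then v ν else 0 := by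
  rw [RR, ← Finset.sum_filter]
  refine Finset.sum_bij (fun p _ => tgt p) ?_ ?_ ?_ ?_
  · intro p hp
    obtain ⟨h1, h2⟩ := Finset.mem_filter.1 hp
    exact Finset.mem_filter.2 ⟨(mem_Tn.1 h1).2, p.2, by rw [← h2]; rfl⟩
  · rintro ⟨a, i⟩ hp ⟨b, j⟩ hq h
    obtain ⟨_, h2⟩ := Finset.mem_filter.1 hp
    obtain ⟨_, h3⟩ := Finset.mem_filter.1 hq
    simp only at h2 h3
    subst h2 h3
    have hij : i = j := single_inj' h
    rw [hij]
  · intro ν hν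
    obtain ⟨h1, i, h2⟩ := Finset.mem_filter.1 hν
    exact ⟨(α, i), Finset.mem_filter.2 ⟨mem_Tn.2 ⟨hα, by rw [tgt, h2]; exact h1⟩, rfl⟩, h2⟩
  · intro p _; rfl

open scoped Classical in
theorem down_eq (g : (Fin d → ℕ) → ℝ) {μ} (hμ : μ ∈ Sn d (n + 1)) :
    ∑ p ∈ (Tn d n).filter (fun p => tgt p = μ), g p.1 =
      ∑ α ∈ Sn d n, if Ad α μ then g α else 0 := by
  rw [← Finset.sum_filter]
  refine Finset.sum_bij (fun p _ => p.1) ?_ ?_ ?_ ?_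
  · intro p hp
    obtain ⟨h1, h2⟩ := Finset.mem_filter.1 hp
    exact Finset.mem_filter.2 ⟨(mem_Tn.1 h1).1, p.2, by rw [← h2]; rfl⟩
  · rintro ⟨a, i⟩ hp ⟨b, j⟩ hq h
    obtain ⟨_, h2⟩ := Finset.mem_filter.1 hp
    obtain ⟨_, h3⟩ := Finset.mem_filter.1 hq
    simp only at h
    subst h
    have hij : i = j := single_inj' (h2.trans h3.symm)
    rw [hij]
  · intro α hα
    obtain ⟨h1, i, h2⟩ := Finset.mem_filter.1 hα
    exact ⟨(α, i), Finset.mem_filter.2 ⟨mem_Tn.2 ⟨h1, by rw [tgt, h2]; exact hμ⟩, h2⟩, rfl⟩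
  · intro p _; rfl

theorem sum_PartLE (f : (Fin d → ℕ) → ℝ) :
    ∑ x ∈ Sn d N, f x = ∑ μ : PartLE N d, f (row d μ.1) := by
  symm
  refine Finset.sum_bij (fun μ _ => row d μ.1) ?_ ?_ ?_ ?_
  · intro μ _; exact row_mem μ.2
  · intro μ _ ν _ h; exact Subtype.ext (row_inj μ.2.2 ν.2.2 h)
  · intro x hx
    obtain ⟨μ, h1, h2⟩ := exists_row hx
    exact ⟨⟨μ, h1⟩, Finset.mem_univ _, h2⟩
  · intro μ _; rfl

open scoped Classical in
/-- transport of a vector -/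
noncomputable def VV (w : PartLE N d → ℝ) (x : Fin d → ℕ) : ℝ :=
  ∑ μ : PartLE N d, if row d μ.1 = x then w μ else 0

theorem VV_row (w : PartLE N d → ℝ) (μ : PartLE N d) : VV w (row d μ.1) = w μ := by
  classical
  rw [VV, Finset.sum_eq_single_of_mem μ (Finset.mem_univ _), if_pos rfl]
  intro ν _ hν
  rw [if_neg]
  exact fun h => hν (Subtype.ext (row_inj ν.2.2 μ.2.2 h))

open scoped Classical in
theorem MF_mulVec (w : PartLE (n + 1) d → ℝ) (μ : PartLE (n + 1) d) :
    ∑ α ∈ Sn d n, (if Ad α (row d μ.1) then RR d n (VV w) α else 0) =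
      (MF (n + 1) d).mulVec w μ := by
  have h : ∀ α ∈ Sn d n, (if Ad α (row d μ.1) then RR d n (VV w) α else 0) =
      ∑ ν : PartLE (n + 1) d, if Ad α (row d μ.1) ∧ Ad α (row d ν.1) then w ν else 0 := by
    intro α hα
    split_ifs with h
    · rw [RR_eq _ hα, sum_PartLE]
      refine Finset.sum_congr rfl fun ν _ => ?_
      rw [VV_row]
      simp [h]
    · simp [h]
  rw [Finset.sum_congr rfl h, Finset.sum_comm]
  simp only [mulVec, dotProduct]
  refine Finset.sum_congr rfl fun ν _ => ?_
  rw [MF_eq, cnt, ← Finset.sum_filter, Finset.sum_const, nsmul_eq_mul]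

theorem sum_RR_sq (w : PartLE (n + 1) d → ℝ) :
    ∑ α ∈ Sn d n, RR d n (VV w) α ^ 2 = w ⬝ᵥ (MF (n + 1) d).mulVec w := by
  classical
  simp only [dotProduct, ← MF_mulVec]
  have h : ∀ α ∈ Sn d n, RR d n (VV w) α ^ 2 = ∑ μ : PartLE (n + 1) d,
      w μ * (if Ad α (row d μ.1) then RR d n (VV w) α else 0) := by
    intro α hα
    rw [sq]
    nth_rewrite 1 [RR_eq _ hα]
    rw [sum_PartLE, Finset.sum_mul]
    refine Finset.sum_congr rfl fun ν _ => ?_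
    rw [VV_row]
    split_ifs <;> simp
  rw [Finset.sum_congr rfl h, Finset.sum_comm]
  refine Finset.sum_congr rfl fun ν _ => ?_
  rw [Finset.mul_sum]

section lin
variable {V : Type*} [Fintype V] [DecidableEq V]

theorem psd_of_greatest (M : Matrix V V ℝ) (hM : M.IsHermitian) (lam : ℝ)
    (h : ∀ x : ℝ, (∃ v : V → ℝ, v ≠ 0 ∧ M.mulVec v = x • v) → x ≤ lam) :
    (lam • (1 : Matrix V V ℝ) - M).PosSemidef := by
  have hA : (lam • (1 : Matrix V V ℝ) - M).IsHermitian := by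
    rw [Matrix.IsHermitian, conjTranspose_sub, conjTranspose_smul, conjTranspose_one, hM.eq,
      star_trivial]
  rw [hA.posSemidef_iff_eigenvalues_nonneg]
  intro i
  have h1 := hA.mulVec_eigenvectorBasis i
  have h2 : M.mulVec (hA.eigenvectorBasis i).ofLp =
      (lam - hA.eigenvalues i) • (hA.eigenvectorBasis i).ofLp := by
    rw [sub_mulVec, smul_mulVec, one_mulVec] at h1
    rw [sub_smul, ← h1]
    abel
  have h3 := h _ ⟨_, ?_, h2⟩
  · simp only [Pi.zero_apply]; linarith
  · intro hc
    have := hA.eigenvectorBasis.orthonormal.ne_zero i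
    exact this (by ext j; simpa using congrFun hc j)

theorem exists_pos_vec (M : Matrix V V ℝ) (hM0 : ∀ i j, 0 ≤ M i j) (lam L : ℝ) (hL : lam < L)
    (h : (lam • (1 : Matrix V V ℝ) - M).PosSemidef) :
    ∃ v : V → ℝ, (∀ i, 0 < v i) ∧ ∀ i, M.mulVec v i ≤ L * v i := by
  have hq : ∀ w : V → ℝ, w ⬝ᵥ M.mulVec w ≤ lam * (w ⬝ᵥ w) := by
    intro w
    have := h.dotProduct_mulVec_nonneg w
    rw [star_trivial, sub_mulVec, smul_mulVec, one_mulVec, dotProduct_sub, dotProduct_smul,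
      smul_eq_mul] at this
    linarith
  have hinj : Function.Injective (L • (1 : Matrix V V ℝ) - M).mulVec := by
    intro x y hxy
    have h1 : (L • (1 : Matrix V V ℝ) - M).mulVec (x - y) = 0 := by
      rw [mulVec_sub, hxy, sub_self]
    have h2 : (x - y) ⬝ᵥ (L • (1 : Matrix V V ℝ) - M).mulVec (x - y) = 0 := by
      rw [h1, dotProduct_zero]
    rw [sub_mulVec, smul_mulVec, one_mulVec, dotProduct_sub, dotProduct_smul, smul_eq_mul] at h2
    have h3 := hq (x - y)
    have h4 : 0 ≤ (x - y) ⬝ᵥ (x - y) := Finset.sum_nonneg fun i _ => mul_self_nonneg _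
    have h5 : (x - y) ⬝ᵥ (x - y) = 0 := by nlinarith
    exact sub_eq_zero.1 (dotProduct_self_eq_zero.1 h5)
  have hu := Matrix.mulVec_injective_iff_isUnit.1 hinj
  obtain ⟨v, hv⟩ := Matrix.mulVec_surjective_iff_isUnit.2 hu (fun _ => 1)
  have hv' : ∀ i, L * v i - M.mulVec v i = 1 := by
    intro i
    have := congrFun hv i
    rwa [sub_mulVec, smul_mulVec, one_mulVec] at this
  set w : V → ℝ := fun i => max (-v i) 0 with hw
  set u : V → ℝ := fun i => max (v i) 0 with hudef
  have hvu : v = u - w := by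
    funext i
    simp only [hw, hudef, Pi.sub_apply]
    rcases le_total (v i) 0 with h | h
    · rw [max_eq_right h, max_eq_left (by linarith)]; ring
    · rw [max_eq_left h, max_eq_right (by linarith)]; ring
  have hw0 : ∀ i, 0 ≤ w i := fun i => le_max_right _ _
  have hu0 : ∀ i, 0 ≤ u i := fun i => le_max_right _ _
  have hwu : w ⬝ᵥ u = 0 := by
    refine Finset.sum_eq_zero fun i _ => ?_
    simp only [hw, hudef]
    rcases le_total (v i) 0 with h | h
    · rw [max_eq_right h, mul_zero]
    · rw [max_eq_right (show -v i ≤ 0 by linarith), zero_mul]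
  have hMu : 0 ≤ w ⬝ᵥ M.mulVec u := Finset.sum_nonneg fun i _ => mul_nonneg (hw0 i)
    (Finset.sum_nonneg fun j _ => mul_nonneg (hM0 i j) (hu0 j))
  have hsum : 0 ≤ L * (w ⬝ᵥ v) - w ⬝ᵥ M.mulVec v := by
    simp only [dotProduct]
    rw [Finset.mul_sum, ← Finset.sum_sub_distrib]
    refine Finset.sum_nonneg fun i _ => ?_
    have : L * (w i * v i) - w i * M.mulVec v i = w i := by linear_combination w i * hv' i
    rw [this]; exact hw0 i
  rw [hvu, dotProduct_sub, mulVec_sub, dotProduct_sub, hwu] at hsum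
  have h3 := hq w
  have h4 : 0 ≤ w ⬝ᵥ w := Finset.sum_nonneg fun i _ => mul_self_nonneg _
  have h5 : w ⬝ᵥ w = 0 := by nlinarith
  have h6 : w = 0 := dotProduct_self_eq_zero.1 h5
  have hv0 : ∀ i, 0 ≤ v i := by
    intro i
    rw [hvu, h6, sub_zero]
    exact hu0 i
  refine ⟨v, fun i => lt_of_le_of_ne (hv0 i) ?_, fun i => by linarith [hv' i]⟩
  intro hc
  have h7 := hv' i
  rw [← hc, mul_zero] at h7
  have h8 : 0 ≤ M.mulVec v i := Finset.sum_nonneg fun j _ => mul_nonneg (hM0 i j) (hv0 j)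
  linarith

theorem abs_vec (M : Matrix V V ℝ) (hM0 : ∀ i j, 0 ≤ M i j) (lam : ℝ) (v : V → ℝ) (hv : v ≠ 0)
    (h : M.mulVec v = lam • v) :
    ∃ u : V → ℝ, ∑ i, u i ^ 2 = 1 ∧ lam ≤ u ⬝ᵥ M.mulVec u := by
  have hs : 0 < ∑ i, v i ^ 2 := by
    obtain ⟨i, hi⟩ := Function.ne_iff.1 hv
    exact Finset.sum_pos' (fun i _ => sq_nonneg _) ⟨i, Finset.mem_univ _, by
      have : v i ≠ 0 := hi
      positivity⟩
  set s := ∑ i, v i ^ 2 with hsd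
  refine ⟨fun i => |v i| / √s, ?_, ?_⟩
  · simp only [div_pow, sq_abs, Real.sq_sqrt hs.le]
    rw [← Finset.sum_div, ← hsd, div_self hs.ne']
  · have h1 : lam * s = v ⬝ᵥ M.mulVec v := by
      rw [h, dotProduct_smul, smul_eq_mul, hsd]
      congr 1
      exact Finset.sum_congr rfl fun i _ => sq _
    have h2 : v ⬝ᵥ M.mulVec v ≤ ∑ i, ∑ j, |v i| * (M i j * |v j|) := by
      simp only [dotProduct, mulVec, Finset.mul_sum]
      refine Finset.sum_le_sum fun i _ => Finset.sum_le_sum fun j _ => ?_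
      calc v i * (M i j * v j) ≤ |v i * (M i j * v j)| := le_abs_self _
        _ = _ := by rw [abs_mul, abs_mul, abs_of_nonneg (hM0 i j)]
    have h3 : (fun i => |v i| / √s) ⬝ᵥ M.mulVec (fun i => |v i| / √s) =
        (∑ i, ∑ j, |v i| * (M i j * |v j|)) / s := by
      simp only [dotProduct, mulVec, Finset.mul_sum, Finset.sum_div]
      refine Finset.sum_congr rfl fun i _ => Finset.sum_congr rfl fun j _ => ?_
      have : √s * √s = s := Real.mul_self_sqrt hs.le
      nth_rewrite 3 [← this]
      have : √s ≠ 0 := (Real.sqrt_pos.2 hs).ne'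
      field_simp
    rw [h3, le_div_iff₀ hs]
    linarith
end lin

theorem MF_nonneg (μ ν : PartLE (n + 1) d) : 0 ≤ MF (n + 1) d μ ν := by
  rw [MF_eq]; positivity

theorem MF_herm : (MF (n + 1) d).IsHermitian := by
  ext μ ν
  rw [conjTranspose_apply, star_trivial, MF_eq, MF_eq]
  have : cnt d n (row d ν.1) (row d μ.1) = cnt d n (row d μ.1) (row d ν.1) := by
    classical
    unfold cnt
    exact Finset.filter_congr fun α _ => and_comm
  rw [this]

theorem main [NeZero d] (lam : ℝ)
    (hlam : IsGreatest {x : ℝ | ∃ v : PartLE (n + 1) d → ℝ,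
      v ≠ 0 ∧ (MF (n + 1) d).mulVec v = x • v} lam) :
    sSup (pbtFidelitySet d (n + 1)) = (1 / (d : ℝ) ^ 2) * lam := by
  classical
  have G := good (d := d) n
  have hd0 : (0 : ℝ) < d := by exact_mod_cast Nat.pos_of_ne_zero (NeZero.ne d)
  have hpsd := psd_of_greatest (MF (n + 1) d) MF_herm lam fun x hx => hlam.2 hx
  have hup : ∀ L, lam < L → ∀ x ∈ pbtFidelitySet d (n + 1), x ≤ (1 / (d : ℝ) ^ 2) * L := by
    intro L hL x hx
    obtain ⟨v, hv1, hv2⟩ := exists_pos_vec (MF (n + 1) d) MF_nonneg lam L hL hpsd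
    refine G.upper (VV v) ?_ L ?_ hx
    · intro μ hμ
      obtain ⟨μ', h1, rfl⟩ := exists_row hμ
      rw [VV_row v ⟨μ', h1⟩]
      exact hv1 _
    · intro μ hμ
      obtain ⟨μ', h1, rfl⟩ := exists_row hμ
      rw [VV_row v ⟨μ', h1⟩]
      have h3 := (down_eq (RR d n (VV v)) hμ).trans (MF_mulVec v ⟨μ', h1⟩)
      exact (le_of_eq (by convert h3)).trans (hv2 _)
  have hupl : ∀ x ∈ pbtFidelitySet d (n + 1), x ≤ (1 / (d : ℝ) ^ 2) * lam := by
    intro x hx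
    have : x * (d : ℝ) ^ 2 ≤ lam := by
      refine le_of_forall_gt_imp_ge_of_dense fun L hL => ?_
      have := hup L hL x hx
      rw [one_div, ← div_eq_inv_mul, le_div_iff₀ (by positivity)] at this
      exact this
    rw [one_div, ← div_eq_inv_mul, le_div_iff₀ (by positivity)]
    exact this
  obtain ⟨⟨v, hv, hve⟩, _⟩ := hlam
  obtain ⟨u, hu1, hu2⟩ := abs_vec (MF (n + 1) d) MF_nonneg lam v hv hve
  have hlow := G.lower (VV u) (by
    rw [sum_PartLE]
    simp only [VV_row]
    exact hu1)
  rw [sum_RR_sq] at hlow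
  apply le_antisymm
  · exact csSup_le ⟨_, hlow⟩ hupl
  · exact (mul_le_mul_of_nonneg_left hu2 (by positivity)).trans (le_csSup ⟨_, hupl⟩ hlow)

end PBT

/-- Fix `d ≥ 2` and `N ≥ 1`.  The optimal fidelity of deterministic port-based teleportation
of a `d`-dimensional state through `N` ports, optimized simultaneously over the resource state
and the measurement, i.e. the supremum of `(1/d²)·∑_{a=1}^N tr(Π_a σ_a)` over all families
`(Π_a)` of positive semidefinite matrices and positive semidefinite `X` with
`∑_a Π_a ≤ X ⊗ I_d` and `tr X = d^N`, equals `(1/d²)·λ_max(M_F^d(N))`, where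
`λ_max(M_F^d(N))` is the largest eigenvalue of the Teleportation Matrix restricted to
partitions of `N` with at most `d` parts. -/
theorem pbt_optimal_fidelity_primal (d N : ℕ) (hd : 2 ≤ d) (hN : 1 ≤ N) (lam : ℝ)
    (hlam : IsGreatest
      {x : ℝ | ∃ v : PartLE N d → ℝ, v ≠ 0 ∧ (MF N d).mulVec v = x • v} lam) :
    sSup (pbtFidelitySet d N) = (1 / (d : ℝ) ^ 2) * lam := by
  obtain ⟨n, rfl⟩ : ∃ n, N = n + 1 := ⟨N - 1, by omega⟩
  have : NeZero d := ⟨by omega⟩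
  exact PBT.main lam hlam
end
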